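/- Let d ∈ {2, 3}, let r ≥ 1, and let E₀ : Set(ℤ^d) → Set(ℤ^d) be an enhancement of range r, i.e. E₀(ω) = E₀(ω') whenever ω ∩ B^∞_r = ω' ∩ B^∞_r, and E₀(ω) ⊆ B^∞_r for every ω. Suppose E₀ is essential: there exists a configuration ω ⊆ ℤ^d containing no doubly infinite path such that ω ∪ E₀(ω) does contain one. Then for every s with 0 < s < 1 there exists π(s) < p_c such that for every p with π(s) < p < p_c one has θ(p, s) > 0, where θ(p, s) is the probability, when ω is a p-Bernoulli random configuration and α an independent s-Bernoulli random configuration, that the origin lies in an infinite cluster of the enhanced configuration E(ω, α). -/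

import Mathlib

open MeasureTheory

/-- The `ℓ1`-norm of a point of `ℤ^d`. -/
def norm1 {d : ℕ} (x : Fin d → ℤ) : ℤ := ∑ i, |x i|

/-- Grid adjacency in `ℤ^d`: `u` and `v` are adjacent iff `‖u - v‖₁ = 1`. -/
def Adj {d : ℕ} (u v : Fin d → ℤ) : Prop := norm1 (u - v) = 1

/-- The `ℓ∞`-ball `B^∞_r = {v : ‖v‖_∞ ≤ r}` in `ℤ^d`. -/
def Binf (d : ℕ) (r : ℤ) : Set (Fin d → ℤ) := {x | ∀ i, |x i| ≤ r}

/-- The configuration (set of open sites) of `ω : ℤ^d → Bool`. -/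
def toConfig {d : ℕ} (ω : (Fin d → ℤ) → Bool) : Set (Fin d → ℤ) := {v | ω v = true}

/-- The enhanced configuration `E(ω, α) = ω ∪ ⋃_{v ∈ α} (E₀(ω − v) + v)`. -/
def enhancedConfig {d : ℕ} (E0 : Set (Fin d → ℤ) → Set (Fin d → ℤ))
    (ω α : Set (Fin d → ℤ)) : Set (Fin d → ℤ) :=
  ω ∪ ⋃ v ∈ α, (fun y => y + v) '' E0 ((fun x => x - v) '' ω)

/-- `σ` contains a path joining `x` to `y`: a finite sequence of distinct points of `σ`,
starting at `x` and ending at `y`, with consecutive points adjacent. -/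
def HasPathJoining {d : ℕ} (σ : Set (Fin d → ℤ)) (x y : Fin d → ℤ) : Prop :=
  ∃ (L : List (Fin d → ℤ)) (h : L ≠ []),
    L.Nodup ∧ L.Chain' Adj ∧ (∀ z ∈ L, z ∈ σ) ∧ L.head h = x ∧ L.getLast h = y

/-- `σ` contains a doubly infinite path: an injective `f : ℤ → ℤ^d` with `f i ∈ σ`
and `f i` adjacent to `f (i+1)` for every `i`. -/
def HasDoublyInfinitePath {d : ℕ} (σ : Set (Fin d → ℤ)) : Prop :=
  ∃ f : ℤ → Fin d → ℤ, Function.Injective f ∧ ∀ i : ℤ, f i ∈ σ ∧ Adj (f i) (f (i + 1))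

/-- The origin lies in an infinite cluster of the configuration `σ`. -/
def OriginInInfiniteCluster {d : ℕ} (σ : Set (Fin d → ℤ)) : Prop :=
  (0 : Fin d → ℤ) ∈ σ ∧ {x | HasPathJoining σ 0 x}.Infinite

/-- `μ` is the product over the sites of `ℤ^d` of Bernoulli(`p`) measures:
a probability measure giving each cylinder event its product probability. -/
def IsBernoulliProduct (d : ℕ) (p : ℝ) (μ : Measure ((Fin d → ℤ) → Bool)) : Prop :=
  IsProbabilityMeasure μ ∧
    ∀ (F : Finset (Fin d → ℤ)) (g : (Fin d → ℤ) → Bool),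
      μ {ω | ∀ v ∈ F, ω v = g v} =
        ∏ v ∈ F, (if g v then ENNReal.ofReal p else ENNReal.ofReal (1 - p))

/-- `θ(p, s)` for given disorder measures `μ = μ_p`, `ν = μ_s`: the probability that
the origin lies in an infinite cluster of the enhanced configuration. -/
noncomputable def theta {d : ℕ} (E0 : Set (Fin d → ℤ) → Set (Fin d → ℤ))
    (μ ν : Measure ((Fin d → ℤ) → Bool)) : ENNReal :=
  (μ.prod ν)
    {ωα | OriginInInfiniteCluster (enhancedConfig E0 (toConfig ωα.1) (toConfig ωα.2))}

/-- `θ₀(p)` for a given disorder measure `μ = μ_p`: the probability that the origin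
lies in an infinite cluster of the (unenhanced) random configuration. -/
noncomputable def theta0 {d : ℕ} (μ : Measure ((Fin d → ℤ) → Bool)) : ENNReal :=
  μ {ω | OriginInInfiniteCluster (toConfig ω)}

/-- The critical probability `p_c = inf {p ∈ [0,1] : θ₀(p) > 0}`, given the family
`p ↦ μ_p` of disorder measures. -/
noncomputable def pc {d : ℕ} (μ : ℝ → Measure ((Fin d → ℤ) → Bool)) : ℝ :=
  sInf {p : ℝ | p ∈ Set.Icc (0 : ℝ) 1 ∧ 0 < theta0 (μ p)}

/-! ### Basics: moves, adjacency, connectivity -/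

/-- move coordinate `i` by `e` -/
def mv {d : ℕ} (z : Fin d → ℤ) (i : Fin d) (e : ℤ) : Fin d → ℤ := Function.update z i (z i + e)

theorem mv_self {d : ℕ} (z : Fin d → ℤ) (i : Fin d) (e : ℤ) : mv z i e i = z i + e := by
  simp [mv]

theorem mv_ne {d : ℕ} (z : Fin d → ℤ) {i j : Fin d} (h : j ≠ i) (e : ℤ) : mv z i e j = z j := by
  simp [mv, h]

theorem mv_mv {d : ℕ} (z : Fin d → ℤ) (i : Fin d) (e e' : ℤ) :
    mv (mv z i e) i e' = mv z i (e + e') := by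
  funext j
  by_cases h : j = i
  · subst h; simp [mv_self]; ring
  · simp [mv_ne _ h]

theorem mv_zero {d : ℕ} (z : Fin d → ℤ) (i : Fin d) : mv z i 0 = z := by
  funext j
  by_cases h : j = i
  · subst h; simp [mv_self]
  · simp [mv_ne _ h]

theorem adj_iff {d : ℕ} (u v : Fin d → ℤ) :
    Adj u v ↔ ∃ i e, (e = 1 ∨ e = -1) ∧ v = mv u i e := by
  constructor
  · intro h
    unfold Adj norm1 at h
    have hex : ∃ i, u i - v i ≠ 0 := by
      by_contra hc
      push Not at hc
      simp [Pi.sub_apply, hc] at h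
    obtain ⟨i, hi⟩ := hex
    have h2 := Finset.add_sum_erase Finset.univ (fun j => |(u - v) j|) (Finset.mem_univ i)
    rw [h] at h2
    have h3 : (1:ℤ) ≤ |(u - v) i| := Int.one_le_abs hi
    have h4 : 0 ≤ ∑ x ∈ Finset.univ.erase i, |(u - v) x| :=
      Finset.sum_nonneg (fun _ _ => abs_nonneg _)
    have h5 : ∑ x ∈ Finset.univ.erase i, |(u - v) x| = 0 := by linarith
    have h6 : |(u - v) i| = 1 := by linarith
    rw [Finset.sum_eq_zero_iff_of_nonneg (fun _ _ => abs_nonneg _)] at h5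
    refine ⟨i, v i - u i, ?_, ?_⟩
    · rw [Pi.sub_apply] at h6
      rcases (abs_eq (by norm_num)).1 h6 with h7 | h7 <;> omega
    · funext j
      by_cases hj : j = i
      · subst hj; rw [mv_self]; ring
      · rw [mv_ne _ hj]
        have := h5 j (by simp [hj])
        rw [abs_eq_zero, Pi.sub_apply] at this
        omega
  · rintro ⟨i, e, he, rfl⟩
    unfold Adj norm1
    rw [Finset.sum_eq_single i]
    · rw [Pi.sub_apply, mv_self]
      rcases he with rfl | rfl <;> simp
    · intro j _ hj
      rw [Pi.sub_apply, mv_ne _ hj]; simp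
    · simp

theorem adj_mv {d : ℕ} (u : Fin d → ℤ) (i : Fin d) {e : ℤ} (he : e = 1 ∨ e = -1) :
    Adj u (mv u i e) := (adj_iff _ _).2 ⟨i, e, he, rfl⟩

theorem adj_symm {d : ℕ} {u v : Fin d → ℤ} (h : Adj u v) : Adj v u := by
  obtain ⟨i, e, he, rfl⟩ := (adj_iff _ _).1 h
  refine (adj_iff _ _).2 ⟨i, -e, by omega, ?_⟩
  rw [mv_mv]; simp [mv_zero]

theorem adj_add {d : ℕ} {u v : Fin d → ℤ} (w : Fin d → ℤ) : Adj (u + w) (v + w) ↔ Adj u v := by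
  unfold Adj; rw [add_sub_add_right_eq_sub]

theorem adj_ne {d : ℕ} {u v : Fin d → ℤ} (h : Adj u v) : u ≠ v := by
  rintro rfl
  simp [Adj, norm1] at h

/-- coordinates of adjacent points -/
theorem adj_coord {d : ℕ} {u v : Fin d → ℤ} (h : Adj u v) :
    ∃ i, (v i = u i + 1 ∨ v i = u i - 1) ∧ ∀ j, j ≠ i → v j = u j := by
  obtain ⟨i, e, he, rfl⟩ := (adj_iff _ _).1 h
  refine ⟨i, ?_, fun j hj => mv_ne _ hj _⟩
  rw [mv_self]; omega

theorem adj_of_coord {d : ℕ} {u v : Fin d → ℤ} (i : Fin d) (h : v i = u i + 1 ∨ v i = u i - 1)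
    (h2 : ∀ j, j ≠ i → v j = u j) : Adj u v := by
  refine (adj_iff _ _).2 ⟨i, v i - u i, by omega, ?_⟩
  funext j
  by_cases hj : j = i
  · subst hj; rw [mv_self]; ring
  · rw [mv_ne _ hj, h2 j hj]

theorem adj_coord_le {d : ℕ} {u v : Fin d → ℤ} (h : Adj u v) (j : Fin d) :
    v j ≤ u j + 1 ∧ u j - 1 ≤ v j := by
  obtain ⟨i, h1, h2⟩ := adj_coord h
  by_cases hj : j = i
  · subst hj; omega
  · rw [h2 j hj]; omega

/-- connectivity inside a configuration -/
def Conn {d : ℕ} (σ : Set (Fin d → ℤ)) (a b : Fin d → ℤ) : Prop :=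
  a ∈ σ ∧ Relation.ReflTransGen (fun u v => Adj u v ∧ v ∈ σ) a b

theorem Conn.refl {d : ℕ} {σ : Set (Fin d → ℤ)} {a : Fin d → ℤ} (h : a ∈ σ) : Conn σ a a :=
  ⟨h, .refl⟩

theorem Conn.left_mem {d : ℕ} {σ : Set (Fin d → ℤ)} {a b : Fin d → ℤ} (h : Conn σ a b) : a ∈ σ :=
  h.1

theorem Conn.right_mem {d : ℕ} {σ : Set (Fin d → ℤ)} {a b : Fin d → ℤ} (h : Conn σ a b) :
    b ∈ σ := by
  obtain ⟨h1, h2⟩ := h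
  cases h2 with
  | refl => exact h1
  | tail _ h => exact h.2

theorem Conn.trans {d : ℕ} {σ : Set (Fin d → ℤ)} {a b c : Fin d → ℤ} (h : Conn σ a b)
    (h' : Conn σ b c) : Conn σ a c := ⟨h.1, h.2.trans h'.2⟩

theorem Conn.tail {d : ℕ} {σ : Set (Fin d → ℤ)} {a b c : Fin d → ℤ} (h : Conn σ a b)
    (h' : Adj b c) (hc : c ∈ σ) : Conn σ a c := ⟨h.1, h.2.tail ⟨h', hc⟩⟩

theorem Conn.single {d : ℕ} {σ : Set (Fin d → ℤ)} {a b : Fin d → ℤ} (ha : a ∈ σ) (hb : b ∈ σ)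
    (h : Adj a b) : Conn σ a b := (Conn.refl ha).tail h hb

theorem Conn.symm {d : ℕ} {σ : Set (Fin d → ℤ)} {a b : Fin d → ℤ} (h : Conn σ a b) :
    Conn σ b a := by
  obtain ⟨h1, h2⟩ := h
  induction h2 with
  | refl => exact Conn.refl h1
  | @tail b c hab hbc ih =>
    have hb : b ∈ σ := ih.1
    exact (Conn.single hbc.2 hb (adj_symm hbc.1)).trans ih

theorem Conn.mono {d : ℕ} {σ τ : Set (Fin d → ℤ)} {a b : Fin d → ℤ} (h : Conn σ a b)
    (hs : σ ⊆ τ) : Conn τ a b :=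
  ⟨hs h.1, Relation.ReflTransGen.mono (fun _ _ h => ⟨h.1, hs h.2⟩) _ _ h.2⟩

theorem Conn.closed {d : ℕ} {σ S : Set (Fin d → ℤ)} {a b : Fin d → ℤ} (h : Conn σ a b)
    (hS : ∀ u ∈ S, ∀ v ∈ σ, Adj u v → v ∈ S) (ha : a ∈ S) : b ∈ S := by
  obtain ⟨h1, h2⟩ := h
  induction h2 with
  | refl => exact ha
  | tail _ hbc ih => exact hS _ ih _ hbc.2 hbc.1

/-- connectivity restricted to the component -/
theorem Conn.restrict {d : ℕ} {σ S : Set (Fin d → ℤ)} {a b : Fin d → ℤ} (h : Conn σ a b)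
    (hS : ∀ u ∈ S, ∀ v ∈ σ, Adj u v → v ∈ S) (ha : a ∈ S) : Conn (σ ∩ S) a b := by
  obtain ⟨h1, h2⟩ := h
  induction h2 with
  | refl => exact Conn.refl ⟨h1, ha⟩
  | tail _ hbc ih => exact ih.tail hbc.1 ⟨hbc.2, hS _ ih.right_mem.2 _ hbc.2 hbc.1⟩

theorem Conn.translate {d : ℕ} {σ : Set (Fin d → ℤ)} {a b : Fin d → ℤ} (w : Fin d → ℤ)
    (h : Conn σ a b) : Conn {z | z - w ∈ σ} (a + w) (b + w) := by
  obtain ⟨h1, h2⟩ := h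
  induction h2 with
  | refl => exact Conn.refl (by simpa using h1)
  | tail _ hbc ih => exact ih.tail ((adj_add w).2 hbc.1) (by simpa using hbc.2)

/-- a walk of length `n` -/
def IsWalk {d : ℕ} (σ : Set (Fin d → ℤ)) (g : ℕ → Fin d → ℤ) (n : ℕ) : Prop :=
  (∀ i ≤ n, g i ∈ σ) ∧ ∀ i < n, Adj (g i) (g (i + 1))

theorem IsWalk.conn {d : ℕ} {σ : Set (Fin d → ℤ)} {g : ℕ → Fin d → ℤ} {n : ℕ}
    (h : IsWalk σ g n) : ∀ j ≤ n, ∀ i ≤ j, Conn σ (g i) (g j) := by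
  intro j
  induction j with
  | zero => intro _ i hi; obtain rfl : i = 0 := by omega
            exact Conn.refl (h.1 _ (by omega))
  | succ j ih =>
    intro hj i hi
    rcases Nat.lt_or_ge j i with h1 | h1
    · obtain rfl : i = j + 1 := by omega
      exact Conn.refl (h.1 _ hj)
    · exact (ih (by omega) i h1).tail (h.2 j (by omega)) (h.1 _ hj)

theorem Conn.exists_walk {d : ℕ} {σ : Set (Fin d → ℤ)} {a b : Fin d → ℤ} (h : Conn σ a b) :
    ∃ n g, IsWalk σ g n ∧ g 0 = a ∧ g n = b := by
  obtain ⟨h1, h2⟩ := h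
  induction h2 with
  | refl => exact ⟨0, fun _ => a, ⟨fun _ _ => h1, by simp⟩, rfl, rfl⟩
  | @tail b c _ hbc ih =>
    obtain ⟨n, g, ⟨hg1, hg2⟩, hg0, hgn⟩ := ih
    refine ⟨n + 1, fun i => if i ≤ n then g i else c, ⟨?_, ?_⟩, ?_, ?_⟩
    · intro i hi
      by_cases hin : i ≤ n
      · simp [hin, hg1 i hin]
      · simp [hin, hbc.2]
    · intro i hi
      by_cases hin : i < n
      · have : i ≤ n := by omega
        have h3 : i + 1 ≤ n := by omega
        simp only [this, h3, if_true]; exact hg2 i hin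
      · obtain rfl : i = n := by omega
        simp [hgn, hbc.1]
    · simp [hg0]
    · simp

/-- a shortest walk is injective -/
theorem Conn.exists_path {d : ℕ} {σ : Set (Fin d → ℤ)} {a b : Fin d → ℤ} (h : Conn σ a b) :
    ∃ n g, IsWalk σ g n ∧ g 0 = a ∧ g n = b ∧ ∀ i ≤ n, ∀ j ≤ n, g i = g j → i = j := by
  classical
  have hex := h.exists_walk
  let n := Nat.find hex
  obtain ⟨g, hg, hg0, hgn⟩ := Nat.find_spec hex
  refine ⟨n, g, hg, hg0, hgn, ?_⟩
  have key : ∀ i ≤ n, ∀ j ≤ n, i < j → g i ≠ g j := by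
    intro i hi j hj hij he
    refine Nat.find_min hex (m := n - (j - i)) (by omega) ?_
    refine ⟨fun k => if k ≤ i then g k else g (k + (j - i)), ⟨?_, ?_⟩, ?_, ?_⟩
    · intro k hk
      by_cases hki : k ≤ i
      · simp only [hki, if_true]; exact hg.1 k (by omega)
      · simp only [hki, if_false]; exact hg.1 _ (by omega)
    · intro k hk
      by_cases hki : k ≤ i
      · by_cases hki2 : k + 1 ≤ i
        · simp only [hki, hki2, if_true]; exact hg.2 k (by omega)
        · obtain rfl : k = i := by omega
          simp only [hki, hki2, if_true, if_false]
          rw [he, show k + 1 + (j - k) = j + 1 by omega]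
          exact hg.2 j (by omega)
      · have hki2 : ¬ k + 1 ≤ i := by omega
        simp only [hki, hki2, if_false]
        rw [show k + 1 + (j - i) = k + (j - i) + 1 by omega]
        exact hg.2 _ (by omega)
    · simp [hg0]
    · by_cases hki : n - (j - i) ≤ i
      · have : n = j := by omega
        have h2 : n - (j - i) = i := by omega
        simp only [h2, le_refl, if_true]
        rw [he, ← this]; exact hgn
      · simp only [hki, if_false]
        rw [show n - (j - i) + (j - i) = n by omega]; exact hgn
  intro i hi j hj he
  rcases lt_trichotomy i j with h1 | h1 | h1
  · exact absurd he (key i hi j hj h1)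
  · exact h1
  · exact absurd he.symm (key j hj i hi h1)

theorem HasPathJoining.conn {d : ℕ} {σ : Set (Fin d → ℤ)} {a b : Fin d → ℤ}
    (h : HasPathJoining σ a b) : Conn σ a b := by
  obtain ⟨L, hL, -, hch, hmem, hh, hl⟩ := h
  have key : ∀ (L : List (Fin d → ℤ)) (hL : L ≠ []), L.IsChain Adj → (∀ z ∈ L, z ∈ σ) →
      Conn σ (L.head hL) (L.getLast hL) := by
    intro L
    induction L with
    | nil => intro h; exact absurd rfl h
    | cons x t ih =>
      intro _ hc hm
      cases t with
      | nil => exact Conn.refl (by simpa using hm x (by simp))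
      | cons y t =>
        rw [List.isChain_cons_cons] at hc
        have := ih (by simp) hc.2 (fun z hz => hm z (by simp at hz ⊢; tauto))
        simp only [List.head_cons] at this ⊢
        rw [List.getLast_cons (by simp)]
        exact (Conn.single (hm x (by simp)) (hm y (by simp)) hc.1).trans this
  rw [← hh, ← hl]
  exact key L hL hch hmem

theorem Conn.hasPathJoining {d : ℕ} {σ : Set (Fin d → ℤ)} {a b : Fin d → ℤ}
    (h : Conn σ a b) : HasPathJoining σ a b := by
  obtain ⟨n, g, hg, h0, hn, hinj⟩ := h.exists_path
  refine ⟨(List.range (n + 1)).map g, by simp, ?_, ?_, ?_, ?_, ?_⟩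
  · refine List.Nodup.map_on ?_ List.nodup_range
    intro x hx y hy hxy
    simp at hx hy
    exact hinj x (by omega) y (by omega) hxy
  · show List.IsChain _ _
    rw [List.isChain_iff_getElem]
    intro i hi
    simp at hi
    simp only [List.getElem_map, List.getElem_range]
    exact hg.2 i (by omega)
  · intro z hz
    simp at hz
    obtain ⟨i, hi, rfl⟩ := hz
    exact hg.1 i (by omega)
  · simp [List.head_range, h0]
  · simp [hn]

theorem Conn.dist {d : ℕ} {σ : Set (Fin d → ℤ)} {g : ℕ → Fin d → ℤ} {n : ℕ}
    (h : IsWalk σ g n) (j : Fin d) : ∀ i ≤ n, (g i j - g 0 j).natAbs ≤ i := by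
  intro i
  induction i with
  | zero => simp
  | succ i ih =>
    intro hi
    have := ih (by omega)
    have h2 := adj_coord_le (h.2 i (by omega)) j
    omega

/-- first index at which a predicate holds -/
theorem exists_first {P : ℕ → Prop} {n : ℕ} (h : P n) : ∃ m ≤ n, P m ∧ ∀ i < m, ¬ P i := by
  classical
  exact ⟨Nat.find ⟨n, h⟩, Nat.find_min' _ h, Nat.find_spec ⟨n, h⟩, fun i hi => Nat.find_min _ hi⟩


/-! ### The gadget -/

theorem mem_Binf {d : ℕ} {r : ℤ} {z : Fin d → ℤ} :
    z ∈ Binf d r ↔ ∀ i, -r ≤ z i ∧ z i ≤ r := by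
  simp [Binf, abs_le]

theorem not_mem_Binf {d : ℕ} {r : ℤ} {z : Fin d → ℤ} :
    z ∉ Binf d r ↔ ∃ i, z i < -r ∨ r < z i := by
  rw [mem_Binf]; push Not
  refine exists_congr fun i => ?_
  constructor <;> intro h <;> [by_cases h1 : -r ≤ z i; intro h1] <;> omega

theorem Binf_finite (d : ℕ) (r : ℤ) : (Binf d r).Finite := by
  have : Binf d r = Set.Icc (fun _ => -r) (fun _ => r) := by
    ext z; rw [mem_Binf, Set.mem_Icc, Pi.le_def, Pi.le_def]
    exact ⟨fun h => ⟨fun i => (h i).1, fun i => (h i).2⟩, fun h i => ⟨h.1 i, h.2 i⟩⟩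
  rw [this]; exact Set.finite_Icc _ _

theorem Binf_mono {d : ℕ} {r r' : ℤ} (h : r ≤ r') : Binf d r ⊆ Binf d r' := by
  intro z hz; rw [mem_Binf] at *; intro i; have := hz i; omega

theorem adj_two {d : ℕ} {u v : Fin d → ℤ} (h : Adj u v) {i j : Fin d} (hij : i ≠ j) :
    u i = v i ∨ u j = v j := by
  obtain ⟨k, -, h2⟩ := adj_coord h
  by_cases hik : i = k
  · right; exact (h2 j (by rintro rfl; exact hij hik)).symm
  · left; exact (h2 i hik).symm

theorem conn_line {d : ℕ} {σ : Set (Fin d → ℤ)} (z : Fin d → ℤ) (i : Fin d) {s : ℤ}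
    (hs : s = 1 ∨ s = -1) (n : ℕ) (h : ∀ k : ℕ, k ≤ n → mv z i (s * k) ∈ σ) :
    Conn σ z (mv z i (s * n)) := by
  induction n with
  | zero =>
    have := h 0 le_rfl
    simp only [Nat.cast_zero, mul_zero, mv_zero] at this ⊢
    exact Conn.refl this
  | succ n ih =>
    have h1 := ih (fun k hk => h k (by omega))
    refine h1.tail ?_ (h (n+1) le_rfl)
    have : mv z i (s * ((n+1 : ℕ):ℤ)) = mv (mv z i (s * n)) i s := by
      rw [mv_mv]; push_cast; congr 1; ring
    rw [this]; exact adj_mv _ _ hs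

/-- line connectivity, coordinate form -/
theorem conn_seg {d : ℕ} {σ : Set (Fin d → ℤ)} (z z' : Fin d → ℤ) (i : Fin d)
    (hz : ∀ j, j ≠ i → z' j = z j)
    (h : ∀ u : Fin d → ℤ, (∀ j, j ≠ i → u j = z j) →
      ((z i ≤ u i ∧ u i ≤ z' i) ∨ (z' i ≤ u i ∧ u i ≤ z i)) → u ∈ σ) :
    Conn σ z z' := by
  by_cases hle : z i ≤ z' i
  · have := conn_line (σ := σ) z i (s := 1) (Or.inl rfl) (z' i - z i).toNat (by
      intro k hk
      apply h
      · intro j hj; rw [mv_ne _ hj]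
      · rw [mv_self]; omega)
    convert this using 1
    funext j
    by_cases hj : j = i
    · subst hj; rw [mv_self]; omega
    · rw [mv_ne _ hj, hz j hj]
  · have := conn_line (σ := σ) z i (s := -1) (Or.inr rfl) (z i - z' i).toNat (by
      intro k hk
      apply h
      · intro j hj; rw [mv_ne _ hj]
      · rw [mv_self]; omega)
    convert this using 1
    funext j
    by_cases hj : j = i
    · subst hj; rw [mv_self]; omega
    · rw [mv_ne _ hj, hz j hj]

theorem exists_exit {d : ℕ} (g : ℕ → Fin d → ℤ) (hg : Function.Injective g)
    (hadj : ∀ i, Adj (g i) (g (i+1))) (L : ℤ) (h0 : g 0 ∈ Binf d L) :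
    ∃ m, (∀ i ≤ m, g i ∈ Binf d L) ∧ ∃ i s, (s = 1 ∨ s = -1) ∧ s * g m i = L := by
  have hex : ∃ n, g n ∉ Binf d L := by
    by_contra hc
    push Not at hc
    exact Set.infinite_of_injective_forall_mem hg hc (Binf_finite d L)
  obtain ⟨n, hn⟩ := hex
  obtain ⟨m, -, hm, hlt⟩ := exists_first (P := fun n => g n ∉ Binf d L) hn
  obtain ⟨m, rfl⟩ : ∃ k, m = k + 1 := by
    cases m with
    | zero => exact absurd h0 hm
    | succ k => exact ⟨k, rfl⟩
  refine ⟨m, fun i hi => by have := hlt i (by omega); simpa using this, ?_⟩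
  obtain ⟨i, hi⟩ := not_mem_Binf.1 hm
  have h1 := hlt m (by omega)
  rw [not_not] at h1
  have h2 := mem_Binf.1 h1 i
  have h3 := adj_coord_le (hadj m) i
  rcases hi with hi | hi
  · exact ⟨i, -1, Or.inr rfl, by omega⟩
  · exact ⟨i, 1, Or.inl rfl, by omega⟩

/-- two rays of a doubly infinite path joined in `ω` give a doubly infinite path -/
theorem dip_of_rays {d : ℕ} {ω : Set (Fin d → ℤ)} (f : ℤ → Fin d → ℤ)
    (hf : Function.Injective f) (hadj : ∀ i, Adj (f i) (f (i+1))) (N : ℤ) (hN : 0 ≤ N)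
    (h1 : ∀ i, N ≤ i → f i ∈ ω) (h2 : ∀ i, i ≤ -N-1 → f i ∈ ω)
    (hc : Conn ω (f N) (f (-N-1))) : HasDoublyInfinitePath ω := by
  classical
  have hex : ∃ n, ∃ g : ℕ → Fin d → ℤ, ∃ i j : ℤ, N ≤ i ∧ j ≤ -N-1 ∧ IsWalk ω g n ∧ g 0 = f i ∧
      g n = f j := by
    obtain ⟨n, g, hg, h0, hn, -⟩ := hc.exists_path
    exact ⟨n, g, N, -N-1, le_rfl, le_rfl, hg, h0, hn⟩
  have hmin := fun m => @Nat.find_min _ _ hex m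
  have hsp := Nat.find_spec hex
  generalize Nat.find hex = n at hmin hsp
  obtain ⟨g, i, j, hi, hj, hg, hg0, hgn⟩ := hsp
  -- interior points avoid the rays
  have hav1 : ∀ k, 0 < k → k ≤ n → ∀ i', N ≤ i' → g k ≠ f i' := by
    intro k hk hkn i' hi' he
    refine hmin (n - k) (by omega) ⟨fun l => g (l + k), i', j, hi', hj, ⟨?_, ?_⟩, ?_, ?_⟩
    · intro l hl; exact hg.1 _ (by omega)
    · intro l hl
      have := hg.2 (l + k) (by omega)
      show Adj (g (l + k)) (g (l + 1 + k))
      rw [show l + 1 + k = l + k + 1 by omega]; exact this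
    · simpa using he
    · simp only; rw [show n - k + k = n by omega]; exact hgn
  have hav2 : ∀ k, k < n → ∀ j', j' ≤ -N-1 → g k ≠ f j' := by
    intro k hkn j' hj' he
    exact hmin k hkn ⟨g, i, j', hi, hj', ⟨fun l hl => hg.1 l (by omega),
      fun l hl => hg.2 l (by omega)⟩, hg0, he⟩
  have hinj : ∀ k ≤ n, ∀ l ≤ n, k < l → g k ≠ g l := by
    intro k hk l hl hkl he
    refine hmin (n - (l - k)) (by omega)
      ⟨fun m => if m ≤ k then g m else g (m + (l - k)), i, j, hi, hj, ⟨?_, ?_⟩, ?_, ?_⟩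
    · intro m hm
      by_cases hmk : m ≤ k
      · simp only [hmk, if_true]; exact hg.1 m (by omega)
      · simp only [hmk, if_false]; exact hg.1 _ (by omega)
    · intro m hm
      by_cases hmk : m ≤ k
      · by_cases hmk2 : m + 1 ≤ k
        · simp only [hmk, hmk2, if_true]; exact hg.2 m (by omega)
        · obtain rfl : m = k := by omega
          simp only [hmk, hmk2, if_true, if_false]
          rw [he, show m + 1 + (l - m) = l + 1 by omega]
          exact hg.2 l (by omega)
      · have hmk2 : ¬ m + 1 ≤ k := by omega
        simp only [hmk, hmk2, if_false]
        rw [show m + 1 + (l - k) = m + (l - k) + 1 by omega]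
        exact hg.2 _ (by omega)
    · simp [hg0]
    · by_cases hmk : n - (l - k) ≤ k
      · have : n = l := by omega
        have h2 : n - (l - k) = k := by omega
        simp only [h2, le_refl, if_true]
        rw [he, ← this]; exact hgn
      · simp only [hmk, if_false]
        rw [show n - (l - k) + (l - k) = n by omega]; exact hgn
  have hn0 : 0 < n := by
    rcases Nat.eq_zero_or_pos n with h | h
    · subst h
      rw [hg0] at hgn
      have := hf hgn
      omega
    · exact h
  let F : ℤ → Fin d → ℤ := fun k =>
    if k ≤ 0 then f (i - k) else if k < n then g k.toNat else f (j - (k - n))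
  have F1 : ∀ k : ℤ, k ≤ 0 → F k = f (i - k) := fun k hk => by simp [F, hk]
  have F2 : ∀ k : ℤ, 0 ≤ k → k ≤ n → F k = g k.toNat := by
    intro k h0 hk
    by_cases hk0 : k = 0
    · subst hk0; simp [F, hg0]
    · by_cases hkn : k < n
      · have : ¬ k ≤ 0 := by omega
        simp [F, this, hkn]
      · have : ¬ k ≤ 0 := by omega
        obtain rfl : k = n := by omega
        simp [F, hgn]; omega
  have F3 : ∀ k : ℤ, n ≤ k → F k = f (j - (k - n)) := by
    intro k hk
    have h3 : ¬ k ≤ 0 := by omega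
    have h4 : ¬ k < n := by omega
    simp [F, h3, h4]
  have hne : ∀ k l : ℤ, k < l → F k ≠ F l := by
    intro k l hkl he
    by_cases hl0 : l ≤ 0
    · rw [F1 k (by omega), F1 l hl0] at he
      have := hf he; omega
    by_cases hk0 : n ≤ k
    · rw [F3 k (by omega), F3 l (by omega)] at he
      have := hf he; omega
    by_cases hk1 : k ≤ 0
    · rw [F1 k hk1] at he
      by_cases hln : l ≤ n
      · rw [F2 l (by omega) hln] at he
        exact hav1 l.toNat (by omega) (by omega) (i - k) (by omega) he.symm
      · rw [F3 l (by omega)] at he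
        have := hf he; omega
    · rw [F2 k (by omega) (by omega)] at he
      by_cases hln : l ≤ n
      · rw [F2 l (by omega) hln] at he
        exact hinj k.toNat (by omega) l.toNat (by omega) (by omega) he
      · rw [F3 l (by omega)] at he
        exact hav2 k.toNat (by omega) _ (by omega) he
  refine ⟨F, ?_, ?_⟩
  · intro k l he
    rcases lt_trichotomy k l with h | h | h
    · exact absurd he (hne _ _ h)
    · exact h
    · exact absurd he.symm (hne _ _ h)
  · intro k
    by_cases hk : k < 0
    · refine ⟨by rw [F1 k (by omega)]; exact h1 _ (by omega), ?_⟩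
      rw [F1 k (by omega), F1 (k+1) (by omega)]
      have := hadj (i - (k+1))
      rw [show i - (k+1) + 1 = i - k by ring] at this
      exact adj_symm this
    by_cases hk2 : k < n
    · refine ⟨by rw [F2 k (by omega) (by omega)]; exact hg.1 _ (by omega), ?_⟩
      rw [F2 k (by omega) (by omega), F2 (k+1) (by omega) (by omega)]
      have := hg.2 k.toNat (by omega)
      rwa [show k.toNat + 1 = (k+1).toNat by omega] at this
    · refine ⟨by rw [F3 k (by omega)]; exact h2 _ (by omega), ?_⟩
      rw [F3 k (by omega), F3 (k+1) (by omega)]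
      have := hadj (j - (k + 1 - n))
      rw [show j - (k+1-n) + 1 = j - (k-n) by ring] at this
      exact adj_symm this

/-- a pre-gadget: two boundary points of a box, connected only thanks to `E`. -/
structure PreG {d : ℕ} (ω E : Set (Fin d → ℤ)) (r L : ℤ) (G : Set (Fin d → ℤ))
    (x y : Fin d → ℤ) (i : Fin d) (s : ℤ) (j : Fin d) (t : ℤ) : Prop where
  hL : 1 ≤ L
  hrL : r ≤ L
  sub : G ⊆ Binf d L
  hx : x ∈ G
  hy : y ∈ G
  hs : s = 1 ∨ s = -1
  ht : t = 1 ∨ t = -1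
  hxi : s * x i = L
  hyj : t * y j = L
  nconn : ¬ Conn G x y
  conn : Conn (G ∪ E) x y
  loc : G ∩ Binf d r = ω ∩ Binf d r

theorem PreG.swap {d : ℕ} {ω E : Set (Fin d → ℤ)} {r L : ℤ} {G : Set (Fin d → ℤ)}
    {x y : Fin d → ℤ} {i : Fin d} {s : ℤ} {j : Fin d} {t : ℤ}
    (h : PreG ω E r L G x y i s j t) : PreG ω E r L G y x j t i s :=
  ⟨h.hL, h.hrL, h.sub, h.hy, h.hx, h.ht, h.hs, h.hyj, h.hxi, fun h' => h.nconn h'.symm,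
    h.conn.symm, h.loc⟩

theorem preG_base {d : ℕ} {ω E : Set (Fin d → ℤ)} {r : ℤ} (hE : E ⊆ Binf d r)
    (h1 : ¬ HasDoublyInfinitePath ω) (h2 : HasDoublyInfinitePath (ω ∪ E)) :
    ∃ L G x y i s j t, PreG ω E r L G x y i s j t := by
  obtain ⟨f, hf, hf2⟩ := h2
  have hfin : (f ⁻¹' (Binf d r)).Finite := (Binf_finite d r).preimage hf.injOn
  obtain ⟨N, hN0, hN⟩ : ∃ N : ℤ, 0 ≤ N ∧ ∀ i, (N ≤ i ∨ i ≤ -N-1) → f i ∉ Binf d r := by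
    obtain ⟨a, ha⟩ := hfin.bddBelow
    obtain ⟨b, hb⟩ := hfin.bddAbove
    refine ⟨max 0 (max (b+1) (1-a)), le_max_left _ _, fun i hi hm => ?_⟩
    have h3 := ha hm
    have h4 := hb hm
    omega
  have hω : ∀ i, (N ≤ i ∨ i ≤ -N-1) → f i ∈ ω := fun i hi =>
    (hf2 i).1.resolve_right (fun h => hN i hi (hE h))
  have hadj := fun i => (hf2 i).2
  have hnc : ¬ Conn ω (f N) (f (-N-1)) := fun hc =>
    h1 (dip_of_rays f hf hadj N hN0 (fun i hi => hω i (Or.inl hi)) (fun i hi => hω i (Or.inr hi)) hc)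
  -- a large box
  obtain ⟨L, hL1, hLr, hL⟩ : ∃ L : ℤ, 1 ≤ L ∧ r ≤ L ∧
      ∀ i, -N-1 ≤ i → i ≤ N → f i ∈ Binf d L := by
    have hfin2 : ((fun p : ℤ × Fin d => |f p.1 p.2|) '' (Set.Icc (-N-1) N ×ˢ Set.univ)).Finite :=
      ((Set.finite_Icc _ _).prod Set.finite_univ).image _
    obtain ⟨b, hb⟩ := hfin2.bddAbove
    refine ⟨max 1 (max r b), by omega, by omega, fun i hi hi2 => mem_Binf.2 fun k => ?_⟩
    have h3 : |f i k| ≤ b := hb ⟨(i, k), ⟨⟨hi, hi2⟩, trivial⟩, rfl⟩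
    have := abs_le.1 h3
    omega
  obtain ⟨m, hm, i, s, hs, hmi⟩ := exists_exit (fun k : ℕ => f (N + k))
    (fun a b hab => by have := hf hab; omega) (fun k => by
      have := hadj (N + k); push_cast; rwa [show N + ((k:ℤ)+1) = N + k + 1 by ring]) L
    (by simpa using hL N (by omega) le_rfl)
  obtain ⟨l, hl, j, t, ht, hlj⟩ := exists_exit (fun k : ℕ => f (-N - 1 - k))
    (fun a b hab => by have := hf hab; omega) (fun k => by
      have := hadj (-N-1 - (k+1)); push_cast
      rw [show -N-1-((k:ℤ)+1) + 1 = -N-1-k by ring] at this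
      exact adj_symm this) L
    (by simpa using hL (-N-1) le_rfl (by omega))
  have c1 : Conn (ω ∩ Binf d L) (f N) (f (N + m)) := by
    have hw : IsWalk (ω ∩ Binf d L) (fun k : ℕ => f (N + k)) m :=
      ⟨fun k hk => ⟨hω _ (by omega), hm k hk⟩, fun k hk => by
        have := hadj (N + k); push_cast; rwa [show N + ((k:ℤ)+1) = N + k + 1 by ring]⟩
    simpa using hw.conn m le_rfl 0 (by omega)
  have c2 : Conn (ω ∩ Binf d L) (f (-N-1)) (f (-N-1 - l)) := by
    have hw : IsWalk (ω ∩ Binf d L) (fun k : ℕ => f (-N-1 - k)) l :=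
      ⟨fun k hk => ⟨hω _ (by omega), hl k hk⟩, fun k hk => by
        have := hadj (-N-1 - (k+1)); push_cast
        rw [show -N-1-((k:ℤ)+1) + 1 = -N-1-k by ring] at this
        exact adj_symm this⟩
    simpa using hw.conn l le_rfl 0 (by omega)
  have c3 : Conn (ω ∩ Binf d L ∪ E) (f (-N-1)) (f N) := by
    have hw : IsWalk (ω ∩ Binf d L ∪ E) (fun k : ℕ => f (-N-1 + k)) (2*N+1).toNat :=
      ⟨fun k hk => by
        rcases (hf2 (-N-1+k)).1 with h | h
        · exact Or.inl ⟨h, hL _ (by omega) (by omega)⟩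
        · exact Or.inr h, fun k hk => by
        have := hadj (-N-1 + k); push_cast; rwa [show -N-1 + ((k:ℤ)+1) = -N-1 + k + 1 by ring]⟩
    have := hw.conn _ le_rfl 0 (by omega)
    rw [show -N-1+((2*N+1).toNat : ℤ) = N by omega] at this
    simpa using this
  refine ⟨L, ω ∩ Binf d L, f (N+m), f (-N-1-l), i, s, j, t, hL1, hLr, Set.inter_subset_right,
    c1.right_mem, c2.right_mem, hs, ht, hmi, hlj, ?_, ?_, ?_⟩
  · intro hc
    exact hnc (((c1.trans hc).trans c2.symm).mono Set.inter_subset_left)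
  · exact ((c1.symm.mono Set.subset_union_left).trans c3.symm).trans
      (c2.mono Set.subset_union_left)
  · rw [Set.inter_assoc, Set.inter_eq_right.2 (Binf_mono hLr)]

theorem arms {d : ℕ} {E G B Ax Ay : Set (Fin d → ℤ)} {x y x' y' : Fin d → ℤ}
    (hG : G ⊆ B) (hnc : ¬ Conn G x y) (hc : Conn (G ∪ E) x y) (hx : x ∈ G) (hy : y ∈ G)
    (hAx : ∀ z ∈ Ax, ∀ u ∈ B, z ≠ u ∧ (Adj z u → u = x))
    (hAy : ∀ z ∈ Ay, ∀ u ∈ B, z ≠ u ∧ (Adj z u → u = y))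
    (hd : ∀ z ∈ Ax, ∀ u ∈ Ay, z ≠ u ∧ ¬ Adj z u)
    (cx : Conn (insert x Ax) x x') (hx' : x' ∈ Ax)
    (cy : Conn (insert y Ay) y y') (hy' : y' ∈ Ay) :
    ¬ Conn (G ∪ Ax ∪ Ay) x' y' ∧ Conn (G ∪ Ax ∪ Ay ∪ E) x' y' := by
  constructor
  · intro h
    have := h.closed (S := {z | Conn G x z} ∪ Ax) (by
      rintro u (hu | hu) v hv huv
      · rcases hv with (hv | hv) | hv
        · exact Or.inl (hu.tail huv hv)
        · exact Or.inr hv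
        · have h3 := (hAy v hv u (hG hu.right_mem)).2 (adj_symm huv)
          subst h3; exact absurd hu hnc
      · rcases hv with (hv | hv) | hv
        · have h3 := (hAx u hu v (hG hv)).2 huv
          subst h3; exact Or.inl (Conn.refl hv)
        · exact Or.inr hv
        · exact absurd huv (hd u hu v hv).2) (Or.inr hx')
    rcases this with h3 | h3
    · exact (hAy y' hy' y' (hG h3.right_mem)).1 rfl
    · exact (hd y' h3 y' hy').1 rfl
  · refine ((cx.symm.mono ?_).trans (hc.mono ?_)).trans (cy.mono ?_)
    · rintro z (rfl | hz)
      · exact Or.inl (Or.inl (Or.inl hx))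
      · exact Or.inl (Or.inl (Or.inr hz))
    · rintro z (hz | hz)
      · exact Or.inl (Or.inl (Or.inl hz))
      · exact Or.inr hz
    · rintro z (rfl | hz)
      · exact Or.inl (Or.inl (Or.inl hy))
      · exact Or.inl (Or.inr hz)


/-! ### Arms of the gadget -/

def StrArm {d : ℕ} (L : ℤ) (x : Fin d → ℤ) (i : Fin d) (s : ℤ) : Set (Fin d → ℤ) :=
  {z | (∀ j, j ≠ i → z j = x j) ∧ L < s * z i ∧ s * z i ≤ L + 4}

def BentArm {d : ℕ} (L : ℤ) (x : Fin d → ℤ) (i : Fin d) (s : ℤ) (j : Fin d) (t : ℤ) :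
    Set (Fin d → ℤ) :=
  {z | (∀ k, k ≠ i → z k = x k) ∧ L < s * z i ∧ s * z i ≤ L + 2} ∪
  {z | (∀ k, k ≠ i → k ≠ j → z k = x k) ∧ s * z i = L + 2 ∧ t * x j ≤ t * z j ∧ t * z j ≤ L + 4}

theorem strArm_B {d : ℕ} {L : ℤ} {x : Fin d → ℤ} {i : Fin d} {s : ℤ} (hs : s = 1 ∨ s = -1)
    (hx : s * x i = L) : ∀ z ∈ StrArm L x i s, ∀ u ∈ Binf d L, z ≠ u ∧ (Adj z u → u = x) := by
  rintro z ⟨hz1, hz2, hz3⟩ u hu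
  rw [mem_Binf] at hu
  have hui := hu i
  constructor
  · rintro rfl; rcases hs with rfl | rfl <;> omega
  · intro h
    funext j
    by_cases hj : j = i
    · subst hj
      have := adj_coord_le h j
      rcases hs with rfl | rfl <;> omega
    · rw [← hz1 j hj]
      rcases adj_two h hj with h1 | h1
      · exact h1.symm
      · rcases hs with rfl | rfl <;> omega

theorem bentArm_B {d : ℕ} {L : ℤ} {x : Fin d → ℤ} {i j : Fin d} {s t : ℤ} (hs : s = 1 ∨ s = -1)
    (hx : s * x i = L) :
    ∀ z ∈ BentArm L x i s j t, ∀ u ∈ Binf d L, z ≠ u ∧ (Adj z u → u = x) := by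
  rintro z (⟨hz1, hz2, hz3⟩ | ⟨hz1, hz2, hz3⟩) u hu
  · exact strArm_B hs hx z ⟨hz1, hz2, by omega⟩ u hu
  · rw [mem_Binf] at hu
    have hui := hu i
    constructor
    · rintro rfl; rcases hs with rfl | rfl <;> omega
    · intro h
      have := adj_coord_le h i
      rcases hs with rfl | rfl <;> omega

theorem strArm_conn {d : ℕ} {L : ℤ} {x : Fin d → ℤ} {i : Fin d} {s : ℤ} (hs : s = 1 ∨ s = -1)
    (hx : s * x i = L) : Conn (insert x (StrArm L x i s)) x (mv x i (s * 4)) := by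
  apply conn_seg x _ i
  · intro j hj; exact mv_ne _ hj _
  · intro u hu h
    rw [mv_self] at h
    by_cases hux : u i = x i
    · left; funext j
      by_cases hj : j = i
      · rw [hj, hux]
      · exact hu j hj
    · right; refine ⟨hu, ?_⟩
      rcases hs with rfl | rfl <;> omega

theorem strArm_end {d : ℕ} {L : ℤ} {x : Fin d → ℤ} {i : Fin d} {s : ℤ} (hs : s = 1 ∨ s = -1)
    (hx : s * x i = L) : mv x i (s * 4) ∈ StrArm L x i s := by
  refine ⟨fun j hj => mv_ne _ hj _, ?_⟩
  rw [mv_self]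
  rcases hs with rfl | rfl <;> omega

/-- endpoint of a bent arm -/
def bentEnd {d : ℕ} (L : ℤ) (x : Fin d → ℤ) (i : Fin d) (s : ℤ) (j : Fin d) (t : ℤ) :
    Fin d → ℤ := Function.update (mv x i (s * 2)) j (t * (L + 4))

theorem bentArm_end {d : ℕ} {L : ℤ} {x : Fin d → ℤ} {i j : Fin d} {s t : ℤ} (hij : i ≠ j)
    (hs : s = 1 ∨ s = -1) (ht : t = 1 ∨ t = -1) (hxj : t * x j ≤ L)
    (hx : s * x i = L) : bentEnd L x i s j t ∈ BentArm L x i s j t := by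
  right
  refine ⟨fun k hk hkj => ?_, ?_, ?_⟩
  · simp [bentEnd, hkj, mv_ne _ hk]
  · simp only [bentEnd, Function.update_of_ne hij, mv_self]
    rcases hs with rfl | rfl <;> omega
  · simp only [bentEnd, Function.update_self]
    rcases ht with rfl | rfl <;> omega

theorem bentArm_conn {d : ℕ} {L : ℤ} {x : Fin d → ℤ} {i j : Fin d} {s t : ℤ} (hij : i ≠ j)
    (hs : s = 1 ∨ s = -1) (ht : t = 1 ∨ t = -1) (hxj : t * x j ≤ L)
    (hx : s * x i = L) : Conn (insert x (BentArm L x i s j t)) x (bentEnd L x i s j t) := by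
  have c1 : Conn (insert x (BentArm L x i s j t)) x (mv x i (s * 2)) := by
    apply conn_seg x _ i
    · intro k hk; exact mv_ne _ hk _
    · intro u hu h
      rw [mv_self] at h
      by_cases hux : u i = x i
      · left; funext j
        by_cases hj : j = i
        · rw [hj, hux]
        · exact hu j hj
      · right; left; refine ⟨hu, ?_⟩
        rcases hs with rfl | rfl <;> omega
  refine c1.trans ?_
  apply conn_seg _ _ j
  · intro k hk; simp [bentEnd, hk]
  · intro u hu h
    right; right
    rw [mv_ne _ hij.symm] at h
    simp only [bentEnd, Function.update_self] at h
    refine ⟨fun k hk hkj => by rw [hu k hkj, mv_ne _ hk], ?_, ?_⟩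
    · rw [hu i hij, mv_self]; rcases hs with rfl | rfl <;> omega
    · rcases ht with rfl | rfl <;> omega

/-- stage 1: normals can be made distinct -/
theorem preG_distinct {d : ℕ} {ω E : Set (Fin d → ℤ)} {r L : ℤ} {G : Set (Fin d → ℤ)}
    {x y : Fin d → ℤ} {i : Fin d} {s : ℤ} {j : Fin d} {t : ℤ}
    (h : PreG ω E r L G x y i s j t) :
    ∃ L G x y i s j t, PreG ω E r L G x y i s j t ∧ (i ≠ j ∨ s ≠ t) := by
  by_cases hne : i ≠ j ∨ s ≠ t
  · exact ⟨L, G, x, y, i, s, j, t, h, hne⟩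
  push Not at hne
  obtain ⟨rfl, rfl⟩ := hne
  have hxy : x ≠ y := fun he => h.nconn (by rw [← he]; exact Conn.refl h.hx)
  have hnadj : ¬ Adj x y := fun ha => h.nconn (Conn.single h.hx h.hy ha)
  obtain ⟨k, hk⟩ : ∃ k, x k ≠ y k := by
    by_contra hc; push Not at hc; exact hxy (funext hc)
  have hki : k ≠ i := by
    rintro rfl
    have h1 := h.hxi; have h2 := h.hyj
    rcases h.hs with hs | hs <;> subst hs <;> omega
  obtain ⟨τ, hτ, hτk⟩ : ∃ τ : ℤ, (τ = 1 ∨ τ = -1) ∧ τ * x k < τ * y k := by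
    rcases lt_or_gt_of_ne hk with h1 | h1
    · exact ⟨1, Or.inl rfl, by omega⟩
    · exact ⟨-1, Or.inr rfl, by omega⟩
  have hyk : τ * y k ≤ L := by
    have := mem_Binf.1 (h.sub h.hy) k
    rcases hτ with rfl | rfl <;> omega
  have hsep : ∀ z ∈ StrArm L x i s, ∀ u ∈ BentArm L y i s k τ, z ≠ u ∧ ¬ Adj z u := by
    rintro z ⟨hz1, -, -⟩ u hu
    -- transverse coordinates
    have hzk := hz1 k hki
    have huk : τ * y k ≤ τ * u k := by
      rcases hu with ⟨h1, -, -⟩ | ⟨-, -, h1, -⟩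
      · rw [h1 k hki]
      · exact h1
    have huo : ∀ l, l ≠ i → l ≠ k → u l = y l := by
      intro l hl hlk
      rcases hu with ⟨h1, -, -⟩ | ⟨h1, -, -⟩
      · exact h1 l hl
      · exact h1 l hl hlk
    have hzu : z k ≠ u k := by
      rw [hzk]; rcases hτ with rfl | rfl <;> omega
    refine ⟨fun he => hzu (by rw [he]), fun ha => hnadj ?_⟩
    obtain ⟨m, hm1, hm2⟩ := adj_coord ha
    obtain rfl : m = k := by
      by_contra hmk; exact hzu (hm2 k (fun hh => hmk hh.symm)).symm
    apply adj_of_coord m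
    · rw [hzk] at hm1
      rcases hτ with rfl | rfl <;> omega
    · intro l hl
      by_cases hli : l = i
      · subst hli
        have h1 := h.hxi; have h2 := h.hyj
        rcases h.hs with hs | hs <;> subst hs <;> omega
      · rw [← huo l hli hl, hm2 l hl, hz1 l hli]
  obtain ⟨hn, hc⟩ := arms h.sub h.nconn h.conn h.hx h.hy (strArm_B h.hs h.hxi)
    (bentArm_B h.hs h.hyj) hsep (strArm_conn h.hs h.hxi) (strArm_end h.hs h.hxi)
    (bentArm_conn hki.symm h.hs hτ hyk h.hyj) (bentArm_end hki.symm h.hs hτ hyk h.hyj)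
  have hL := h.hL
  refine ⟨L + 4, _, _, _, i, s, k, τ, ⟨by omega, by have := h.hrL; omega, ?_, ?_, ?_, h.hs, hτ, ?_,
    ?_, hn, hc, ?_⟩, Or.inl hki.symm⟩
  · have hxB := mem_Binf.1 (h.sub h.hx)
    have hyB := mem_Binf.1 (h.sub h.hy)
    rintro z ((hz | ⟨hz1, hz2, hz3⟩) | (⟨hz1, hz2, hz3⟩ | ⟨hz1, hz2, hz3, hz4⟩))
    · exact Binf_mono (by omega) (h.sub hz)
    · refine mem_Binf.2 fun l => ?_
      have := hxB l
      by_cases hl : l = i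
      · subst hl; rcases h.hs with hs | hs <;> subst hs <;> omega
      · rw [hz1 l hl]; omega
    · refine mem_Binf.2 fun l => ?_
      have := hyB l
      by_cases hl : l = i
      · subst hl; rcases h.hs with hs | hs <;> subst hs <;> omega
      · rw [hz1 l hl]; omega
    · refine mem_Binf.2 fun l => ?_
      have := hyB l
      by_cases hl : l = i
      · subst hl; rcases h.hs with hs | hs <;> subst hs <;> omega
      · by_cases hlk : l = k
        · subst hlk; rcases hτ with hs | hs <;> subst hs <;> omega
        · rw [hz1 l hl hlk]; omega
  · exact Or.inl (Or.inr (strArm_end h.hs h.hxi))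
  · exact Or.inr (bentArm_end hki.symm h.hs hτ hyk h.hyj)
  · rw [mv_self]; have := h.hxi
    rcases h.hs with hs | hs <;> subst hs <;> omega
  · simp only [bentEnd, Function.update_self]; rcases hτ with hs | hs <;> subst hs <;> omega
  · rw [← h.loc]
    ext z
    constructor
    · rintro ⟨(hz | hz) | hz, hzr⟩
      · exact ⟨hz, hzr⟩
      · exact absurd rfl (strArm_B h.hs h.hxi z hz z (Binf_mono h.hrL hzr)).1
      · exact absurd rfl (bentArm_B h.hs h.hyj z hz z (Binf_mono h.hrL hzr)).1
    · rintro ⟨hz, hzr⟩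
      exact ⟨Or.inl (Or.inl hz), hzr⟩

/-- the oriented gadget -/
structure Gadget {d : ℕ} (ω E : Set (Fin d → ℤ)) (r L : ℤ) (a : Fin d) (σ : ℤ)
    (G : Set (Fin d → ℤ)) (x y : Fin d → ℤ) : Prop where
  hL : 1 ≤ L
  hrL : r ≤ L
  sub : G ⊆ Binf d L
  hx : x ∈ G
  hy : y ∈ G
  hxa : σ * x a = L
  hxo : ∀ i, i ≠ a → -L < x i ∧ x i < L
  hyo : (∃ i, i ≠ a ∧ (y i = L ∨ y i = -L)) ∨ σ * y a = -L
  bd : ∀ z ∈ G, ∀ i, (z i = L ∨ z i = -L) → z = x ∨ z = y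
  nconn : ¬ Conn G x y
  conn : Conn (G ∪ E) x y
  loc : G ∩ Binf d r = ω ∩ Binf d r

theorem gadget_of_arms {d : ℕ} {ω E : Set (Fin d → ℤ)} {r L : ℤ} {G : Set (Fin d → ℤ)}
    {x y : Fin d → ℤ} {i : Fin d} {s : ℤ} {j : Fin d} {t : ℤ}
    (h : PreG ω E r L G x y i s j t) {a : Fin d} {σ : ℤ}
    {Ax Ay : Set (Fin d → ℤ)} {x' y' : Fin d → ℤ}
    (hAx : ∀ z ∈ Ax, ∀ u ∈ Binf d L, z ≠ u ∧ (Adj z u → u = x))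
    (hAy : ∀ z ∈ Ay, ∀ u ∈ Binf d L, z ≠ u ∧ (Adj z u → u = y))
    (hd : ∀ z ∈ Ax, ∀ u ∈ Ay, z ≠ u ∧ ¬ Adj z u)
    (cx : Conn (insert x Ax) x x') (hx' : x' ∈ Ax)
    (cy : Conn (insert y Ay) y y') (hy' : y' ∈ Ay)
    (hxa : σ * x' a = L + 4)
    (hxo : ∀ i, i ≠ a → -(L+4) < x' i ∧ x' i < L + 4)
    (hyo : (∃ i, i ≠ a ∧ (y' i = L + 4 ∨ y' i = -(L + 4))) ∨ σ * y' a = -(L+4))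
    (hbx : ∀ z ∈ Ax, (∀ i, -(L+4) ≤ z i ∧ z i ≤ L + 4) ∧
      ∀ i, (z i = L+4 ∨ z i = -(L+4)) → z = x')
    (hby : ∀ z ∈ Ay, (∀ i, -(L+4) ≤ z i ∧ z i ≤ L + 4) ∧
      ∀ i, (z i = L+4 ∨ z i = -(L+4)) → z = y') :
    ∃ G x y, Gadget ω E r (L+4) a σ G x y := by
  obtain ⟨hn, hc⟩ := arms h.sub h.nconn h.conn h.hx h.hy hAx hAy hd cx hx' cy hy'
  have hL := h.hL
  refine ⟨G ∪ Ax ∪ Ay, x', y', by omega, by have := h.hrL; omega, ?_, Or.inl (Or.inr hx'),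
    Or.inr hy', hxa, hxo, hyo, ?_, hn, hc, ?_⟩
  · rintro z ((hz | hz) | hz)
    · exact Binf_mono (by omega) (h.sub hz)
    · exact mem_Binf.2 (hbx z hz).1
    · exact mem_Binf.2 (hby z hz).1
  · rintro z ((hz | hz) | hz) k hk
    · have := mem_Binf.1 (h.sub hz) k
      omega
    · exact Or.inl ((hbx z hz).2 k hk)
    · exact Or.inr ((hby z hz).2 k hk)
  · rw [← h.loc]
    ext z
    constructor
    · rintro ⟨(hz | hz) | hz, hzr⟩
      · exact ⟨hz, hzr⟩
      · exact absurd rfl (hAx z hz z (Binf_mono h.hrL hzr)).1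
      · exact absurd rfl (hAy z hz z (Binf_mono h.hrL hzr)).1
    · rintro ⟨hz, hzr⟩
      exact ⟨Or.inl (Or.inl hz), hzr⟩

theorem strArm_bd {d : ℕ} {L : ℤ} {x : Fin d → ℤ} {i : Fin d} {s : ℤ} (hL : 1 ≤ L)
    (hs : s = 1 ∨ s = -1) (hx : s * x i = L) (hxB : x ∈ Binf d L) :
    ∀ z ∈ StrArm L x i s, (∀ i, -(L+4) ≤ z i ∧ z i ≤ L + 4) ∧
      ∀ l, (z l = L+4 ∨ z l = -(L+4)) → z = mv x i (s*4) := by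
  rintro z ⟨hz1, hz2, hz3⟩
  rw [mem_Binf] at hxB
  constructor
  · intro l
    have := hxB l
    by_cases hl : l = i
    · subst hl; rcases hs with rfl | rfl <;> omega
    · rw [hz1 l hl]; omega
  · intro l hl
    have := hxB l
    have hli : l = i := by
      by_contra hli
      rw [hz1 l hli] at hl; omega
    subst hli
    funext k
    by_cases hk : k = l
    · subst hk; rw [mv_self]; rcases hs with rfl | rfl <;> omega
    · rw [mv_ne _ hk, hz1 k hk]

theorem bentArm_bd {d : ℕ} {L : ℤ} {x : Fin d → ℤ} {i j : Fin d} {s t : ℤ} (hL : 1 ≤ L)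
    (hij : i ≠ j) (hs : s = 1 ∨ s = -1) (ht : t = 1 ∨ t = -1) (hx : s * x i = L)
    (hxB : x ∈ Binf d L) :
    ∀ z ∈ BentArm L x i s j t, (∀ i, -(L+4) ≤ z i ∧ z i ≤ L + 4) ∧
      ∀ l, (z l = L+4 ∨ z l = -(L+4)) → z = bentEnd L x i s j t := by
  rw [mem_Binf] at hxB
  rintro z (⟨hz1, hz2, hz3⟩ | ⟨hz1, hz2, hz3, hz4⟩)
  · have key : ∀ l, -(L+4) < z l ∧ z l < L + 4 := by
      intro l
      have := hxB l
      by_cases hl : l = i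
      · subst hl; rcases hs with rfl | rfl <;> omega
      · rw [hz1 l hl]; omega
    refine ⟨fun l => by have := key l; omega, fun l hl => by have := key l; omega⟩
  · have key : ∀ l, l ≠ j → -(L+4) < z l ∧ z l < L + 4 := by
      intro l hlj
      have := hxB l
      by_cases hl : l = i
      · subst hl; rcases hs with rfl | rfl <;> omega
      · rw [hz1 l hl hlj]; omega
    have hxj := hxB j
    refine ⟨fun l => ?_, fun l hl => ?_⟩
    · by_cases hlj : l = j
      · subst hlj; rcases ht with rfl | rfl <;> omega
      · have := key l hlj; omega
    · have hlj : l = j := by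
        by_contra hlj
        have := key l hlj; omega
      subst hlj
      funext k
      by_cases hk : k = l
      · subst hk; simp only [bentEnd, Function.update_self]
        rcases ht with rfl | rfl <;> omega
      · simp only [bentEnd, Function.update_of_ne hk]
        by_cases hki : k = i
        · subst hki; rw [mv_self]; rcases hs with rfl | rfl <;> omega
        · rw [mv_ne _ hki, hz1 k hki hk]

/-- both arms straight -/
theorem gadget_case1 {d : ℕ} {ω E : Set (Fin d → ℤ)} {r L : ℤ} {G : Set (Fin d → ℤ)}
    {x y : Fin d → ℤ} {i : Fin d} {s : ℤ} {j : Fin d} {t : ℤ}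
    (h : PreG ω E r L G x y i s j t) (hne : i ≠ j ∨ s ≠ t) :
    ∃ G x y, Gadget ω E r (L+4) i s G x y := by
  have hxB := mem_Binf.1 (h.sub h.hx)
  have hyB := mem_Binf.1 (h.sub h.hy)
  have hL := h.hL
  have hxi := h.hxi
  have hyj := h.hyj
  have hs := h.hs
  have ht := h.ht
  refine gadget_of_arms h (strArm_B h.hs h.hxi) (strArm_B h.ht h.hyj) ?_
    (strArm_conn h.hs h.hxi) (strArm_end h.hs h.hxi) (strArm_conn h.ht h.hyj)
    (strArm_end h.ht h.hyj) ?_ ?_ ?_ (strArm_bd h.hL h.hs h.hxi (h.sub h.hx))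
    (strArm_bd h.hL h.ht h.hyj (h.sub h.hy))
  · rintro z ⟨hz1, hz2, hz3⟩ u ⟨hu1, hu2, hu3⟩
    by_cases hij : i = j
    · subst hij
      have : t = -s := by omega
      subst this
      refine ⟨fun he => ?_, fun ha => ?_⟩
      · subst he; rcases hs with rfl | rfl <;> omega
      · have := adj_coord_le ha i
        rcases hs with rfl | rfl <;> omega
    · have h1 := hz1 j (Ne.symm hij)
      have h2 := hu1 i hij
      have h3 := hxB j
      have h4 := hyB i
      have h5 : z i ≠ u i := by rw [h2]; rcases hs with rfl | rfl <;> omega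
      have h6 : z j ≠ u j := by rw [h1]; rcases ht with rfl | rfl <;> omega
      exact ⟨fun he => h5 (by rw [he]), fun ha => (adj_two ha hij).elim h5 h6⟩
  · rw [mv_self]; rcases hs with rfl | rfl <;> omega
  · intro k hk; rw [mv_ne _ hk]; have := hxB k; omega
  · by_cases hij : i = j
    · subst hij
      have : t = -s := by omega
      subst this
      right; rw [mv_self]; rcases hs with rfl | rfl <;> omega
    · left; refine ⟨j, Ne.symm hij, ?_⟩
      rw [mv_self]; rcases ht with rfl | rfl <;> omega

/-- `x` bends upward, `y` straight -/
theorem gadget_case4 {d : ℕ} {ω E : Set (Fin d → ℤ)} {r L : ℤ} {G : Set (Fin d → ℤ)}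
    {x y : Fin d → ℤ} {i : Fin d} {s : ℤ} {j : Fin d} {t : ℤ}
    (h : PreG ω E r L G x y i s j t) (hne : i ≠ j ∨ s ≠ t) {a : Fin d} {σ : ℤ}
    (hσ : σ = 1 ∨ σ = -1) (hia : i ≠ a) (hj : j ≠ a ∨ t = -σ) :
    ∃ G x y, Gadget ω E r (L+4) a σ G x y := by
  have hxB := mem_Binf.1 (h.sub h.hx)
  have hyB := mem_Binf.1 (h.sub h.hy)
  have hL := h.hL
  have hxi := h.hxi
  have hyj := h.hyj
  have hs := h.hs
  have ht := h.ht
  have hxa : σ * x a ≤ L := by have := hxB a; rcases hσ with rfl | rfl <;> omega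
  refine gadget_of_arms h (bentArm_B h.hs h.hxi) (strArm_B h.ht h.hyj) ?_
    (bentArm_conn hia hs hσ hxa h.hxi) (bentArm_end hia hs hσ hxa h.hxi) (strArm_conn h.ht h.hyj)
    (strArm_end h.ht h.hyj) ?_ ?_ ?_ (bentArm_bd h.hL hia h.hs hσ h.hxi (h.sub h.hx))
    (strArm_bd h.hL h.ht h.hyj (h.sub h.hy))
  · rintro z hz u ⟨hu1, hu2, hu3⟩
    have hzi : L < s * z i := by
      rcases hz with ⟨-, hz, -⟩ | ⟨-, hz, -⟩ <;> omega
    by_cases hij : i = j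
    · subst hij
      have : t = -s := by omega
      subst this
      refine ⟨fun he => ?_, fun ha => ?_⟩
      · subst he; rcases hs with rfl | rfl <;> omega
      · have := adj_coord_le ha i
        rcases hs with rfl | rfl <;> omega
    · have h2 := hu1 i hij
      have h4 := hyB i
      have h5 : z i ≠ u i := by rw [h2]; rcases hs with rfl | rfl <;> omega
      have h6 : z j ≠ u j := by
        have h3 := hxB j
        by_cases hja : j = a
        · subst hja
          have ht' : t = -σ := by tauto
          have h7 : σ * x j ≤ σ * z j := by
            rcases hz with ⟨hz, -, -⟩ | ⟨-, -, hz, -⟩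
            · rw [hz j (Ne.symm hij)]
            · exact hz
          subst ht'
          rcases hσ with rfl | rfl <;> omega
        · have : z j = x j := by
            rcases hz with ⟨hz, -, -⟩ | ⟨hz, -, -⟩
            · exact hz j (Ne.symm hij)
            · exact hz j (Ne.symm hij) hja
          rw [this]; rcases ht with rfl | rfl <;> omega
      exact ⟨fun he => h5 (by rw [he]), fun ha => (adj_two ha hij).elim h5 h6⟩
  · simp only [bentEnd, Function.update_self]; rcases hσ with rfl | rfl <;> omega
  · intro k hk
    simp only [bentEnd, Function.update_of_ne hk]
    by_cases hki : k = i
    · subst hki; rw [mv_self]; rcases hs with rfl | rfl <;> omega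
    · rw [mv_ne _ hki]; have := hxB k; omega
  · by_cases hja : j = a
    · subst hja
      have ht' : t = -σ := by tauto
      subst ht'
      right; rw [mv_self]; rcases hσ with rfl | rfl <;> omega
    · left; refine ⟨j, hja, ?_⟩
      rw [mv_self]; rcases ht with rfl | rfl <;> omega

/-- Gadgets exist in every direction, with a common size. -/
theorem gadget_exists {d : ℕ} {ω E : Set (Fin d → ℤ)} {r : ℤ} (hE : E ⊆ Binf d r)
    (h1 : ¬ HasDoublyInfinitePath ω) (h2 : HasDoublyInfinitePath (ω ∪ E)) :
    ∃ L : ℤ, ∀ (a : Fin d) (σ : ℤ), (σ = 1 ∨ σ = -1) → ∃ G x y, Gadget ω E r L a σ G x y := by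
  obtain ⟨L, G, x, y, i, s, j, t, h⟩ := preG_base hE h1 h2
  obtain ⟨L, G, x, y, i, s, j, t, h, hne⟩ := preG_distinct h
  refine ⟨L + 4, fun a σ hσ => ?_⟩
  have hs := h.hs
  have ht := h.ht
  by_cases c1 : i = a ∧ s = σ
  · obtain ⟨rfl, rfl⟩ := c1
    exact gadget_case1 h hne
  by_cases c2 : j = a ∧ t = σ
  · obtain ⟨rfl, rfl⟩ := c2
    exact gadget_case1 h.swap (hne.imp Ne.symm Ne.symm)
  by_cases hia : i = a
  · subst hia
    have hss : s = -σ := by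
      have : s ≠ σ := fun h => c1 ⟨rfl, h⟩
      omega
    have hji : j ≠ i := by
      rintro rfl
      have h3 : t ≠ σ := fun h => c2 ⟨rfl, h⟩
      have h4 : s ≠ t := by tauto
      omega
    exact gadget_case4 h.swap (hne.imp Ne.symm Ne.symm) hσ hji (Or.inr hss)
  · refine gadget_case4 h hne hσ hia ?_
    by_cases hja : j = a
    · right
      have : t ≠ σ := fun h => c2 ⟨hja, h⟩
      omega
    · exact Or.inl hja


/-! ### Tower -/

/-- all points of an integer box contained in `σ` are connected -/
theorem conn_box {d : ℕ} {σ : Set (Fin d → ℤ)} (lo hi z z' : Fin d → ℤ)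
    (hz : ∀ i, lo i ≤ z i ∧ z i ≤ hi i) (hz' : ∀ i, lo i ≤ z' i ∧ z' i ≤ hi i)
    (h : ∀ u : Fin d → ℤ, (∀ i, lo i ≤ u i ∧ u i ≤ hi i) → u ∈ σ) : Conn σ z z' := by
  classical
  have key : ∀ s : Finset (Fin d), Conn σ z (fun i => if i ∈ s then z' i else z i) := by
    intro s
    induction s using Finset.induction_on with
    | empty => simpa using Conn.refl (h z hz)
    | insert k s hk ih =>
      refine ih.trans ?_
      apply conn_seg _ _ k
      · intro j hj; simp [hj]
      · intro u hu hk2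
        apply h
        intro i
        have h1 := hz i
        have h2 := hz' i
        by_cases hik : i = k
        · subst hik
          simp [hk] at hk2
          omega
        · rw [hu i hik]; split_ifs <;> omega
  simpa using key Finset.univ

def ExtC {d : ℕ} (N : ℤ) (z : Fin d → ℤ) (i : Fin d) : Prop := z i = N + 1 ∨ z i = -(N + 1)

def Zr (d : ℕ) (N : ℤ) : Set (Fin d → ℤ) :=
  {z | (∀ i, -(N+1) ≤ z i ∧ z i ≤ N + 1) ∧ ∀ i j, i ≠ j → ExtC N z i → ¬ ExtC N z j}

/-- the core of a side region -/
def Core {d : ℕ} (N : ℤ) (a : Fin d) (σ h : ℤ) (z : Fin d → ℤ) : Prop :=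
  (∀ i, i ≠ a → -N ≤ z i ∧ z i ≤ N) ∧ -(N+1) ≤ σ * z a ∧ σ * z a ≤ h - 1

structure Side {d : ℕ} (N : ℤ) (a : Fin d) (σ h : ℤ) (P : Set (Fin d → ℤ)) : Prop where
  sub : P ⊆ Zr d N
  low : ∀ z ∈ P, σ * z a ≤ h - 1 ∨ (σ * z a = h ∧ ∃ i, i ≠ a ∧ ExtC N z i)
  core : ∀ z, Core N a σ h z → z ∈ P
  reach : ∀ z ∈ P, Core N a σ h z ∨ ∃ z', Core N a σ h z' ∧
    Conn (P ∩ {u | ∃ i, i ≠ a ∧ (N ≤ u i ∨ u i ≤ -N)}) z z'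

def TT {d : ℕ} (L : ℤ) (a : Fin d) (σ : ℤ) : Set (Fin d → ℤ) :=
  {z | (∀ i, i ≠ a → -L ≤ z i ∧ z i ≤ L) ∧ -2*L-1 ≤ σ * z a}

def Col {d : ℕ} (a : Fin d) (σ h : ℤ) (x : Fin d → ℤ) : Set (Fin d → ℤ) :=
  {z | (∀ i, i ≠ a → z i = x i) ∧ 0 ≤ σ * z a ∧ σ * z a ≤ h}

def wpt {d : ℕ} (L : ℤ) (a : Fin d) (σ : ℤ) : Fin d → ℤ := mv 0 a (σ * (-L-1))

def Tow {d : ℕ} (L : ℤ) (a : Fin d) (σ h : ℤ) (G P1 P2 : Set (Fin d → ℤ)) (x : Fin d → ℤ) :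
    Set (Fin d → ℤ) :=
  (P1 \ TT L a σ) ∪ P2 ∪ Col a σ h x ∪ {z | z - wpt L a σ ∈ G}

def TowS {d : ℕ} (L : ℤ) (a : Fin d) (σ h : ℤ) (G P2 : Set (Fin d → ℤ)) (x : Fin d → ℤ) :
    Set (Fin d → ℤ) :=
  P2 ∪ Col a σ h x ∪ {z | Conn G x (z - wpt L a σ)}

theorem wpt_a {d : ℕ} (L : ℤ) (a : Fin d) (σ : ℤ) (hσ : σ = 1 ∨ σ = -1) (z : Fin d → ℤ) :
    σ * (z - wpt L a σ) a = σ * z a + L + 1 := by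
  rw [Pi.sub_apply, wpt, mv_self]
  rcases hσ with rfl | rfl <;> simp <;> ring

theorem wpt_i {d : ℕ} (L : ℤ) (a : Fin d) (σ : ℤ) (z : Fin d → ℤ) {i : Fin d} (hi : i ≠ a) :
    (z - wpt L a σ) i = z i := by
  rw [Pi.sub_apply, wpt, mv_ne _ hi]; simp

section Tower
variable {d : ℕ} {ω E : Set (Fin d → ℤ)} {r L N : ℤ} {a : Fin d} {σ h : ℤ}
  {G P1 P2 : Set (Fin d → ℤ)} {x y : Fin d → ℤ}

/-- levels in the gadget box -/
theorem gad_lvl (hσ : σ = 1 ∨ σ = -1) (hG : Gadget ω E r L a σ G x y) {u : Fin d → ℤ}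
    (hu : u - wpt L a σ ∈ G) :
    (-2*L-1 ≤ σ * u a ∧ σ * u a ≤ -1) ∧ ∀ i, i ≠ a → -L ≤ u i ∧ u i ≤ L := by
  have h1 := mem_Binf.1 (hG.sub hu)
  refine ⟨?_, fun i hi => by have := h1 i; rwa [wpt_i _ _ _ _ hi] at this⟩
  have h2 := h1 a
  have h3 := wpt_a L a σ hσ u
  rcases hσ with rfl | rfl <;> omega

theorem tow_closed (hσ : σ = 1 ∨ σ = -1) (hG : Gadget ω E r L a σ G x y)
    (hN : 2 * L + 5 ≤ N) (hh : 0 ≤ h) (s2 : Side N a (-σ) (-h) P2)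
    (hsep : ∀ u ∈ P1, ∀ v ∈ P2, u ≠ v ∧ ¬ Adj u v) :
    ∀ u ∈ TowS L a σ h G P2 x, ∀ v ∈ Tow L a σ h G P1 P2 x, Adj u v →
      v ∈ TowS L a σ h G P2 x := by
  have hL := hG.hL
  -- P2 is not adjacent to the gadget box
  have key : ∀ u ∈ P2, ∀ v, v - wpt L a σ ∈ G → ¬ Adj u v := by
    intro u hu v hv ha
    have h1 := gad_lvl hσ hG hv
    have h2 := adj_coord_le ha a
    rcases s2.low u hu with h3 | ⟨h3, i, hi, h4⟩
    · rcases hσ with rfl | rfl <;> omega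
    · have h5 := h1.2 i hi
      have h6 := adj_coord_le ha i
      unfold ExtC at h4
      omega
  rintro u ((hu | hu) | hu) v (((hv | hv) | hv) | hv) ha
  · exact absurd (adj_symm ha) (hsep v hv.1 u hu).2
  · exact Or.inl (Or.inl hv)
  · exact Or.inl (Or.inr hv)
  · exact absurd ha (key u hu v hv)
  · exfalso
    apply hv.2
    refine ⟨fun i hi => ?_, ?_⟩
    · have h1 := hG.hxo i hi
      have h2 := hu.1 i hi
      have h3 := adj_coord_le ha i
      omega
    · have h1 := hu.2
      have h3 := adj_coord_le ha a
      rcases hσ with rfl | rfl <;> omega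
  · exact Or.inl (Or.inl hv)
  · exact Or.inl (Or.inr hv)
  · right
    have h1 := gad_lvl hσ hG hv
    have h2 := adj_coord_le ha a
    have h3 := hu.2
    have hne : u a ≠ v a := by
      intro he; rw [he] at h3; omega
    have : v - wpt L a σ = x := by
      funext i
      by_cases hi : i = a
      · subst hi
        have h4 := wpt_a L i σ hσ v
        have h5 := hG.hxa
        rcases hσ with rfl | rfl <;> omega
      · rw [wpt_i _ _ _ _ hi, ← hu.1 i hi]
        rcases adj_two ha hi with h6 | h6
        · exact h6.symm
        · exact absurd h6 hne
    show Conn G x _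
    rw [this]; exact Conn.refl hG.hx
  · exfalso
    have hu' : u - wpt L a σ ∈ G := hu.right_mem
    have h1 := gad_lvl hσ hG hu'
    have h3 := adj_coord_le ha a
    -- `u` is the image of a boundary point
    have hb : ∃ i, ((u - wpt L a σ) i = L ∨ (u - wpt L a σ) i = -L) ∧
        (i ≠ a ∨ σ * (u - wpt L a σ) a = -L) := by
      by_contra hc
      push Not at hc
      apply hv.2
      refine ⟨fun i hi => ?_, ?_⟩
      · have h4 := hc i
        have h5 := h1.2 i hi
        have h6 := adj_coord_le ha i
        rw [wpt_i _ _ _ _ hi] at h4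
        by_contra hcc
        have : u i = L ∨ u i = -L := by omega
        exact hi (h4 this).1
      · have h4 := hc a
        have h5 := wpt_a L a σ hσ u
        by_contra hcc
        have h7 : σ * (u - wpt L a σ) a = -L := by rcases hσ with rfl | rfl <;> omega
        exact (h4 (by rcases hσ with rfl | rfl <;> omega)).2 h7
    obtain ⟨i, hi1, hi2⟩ := hb
    rcases hG.bd _ hu' i hi1 with he | he
    · have h5 := hG.hxa
      rw [he] at hi1 hi2
      rcases hi2 with hi2 | hi2
      · have := hG.hxo i hi2
        omega
      · omega
    · have hu2 : Conn G x (u - wpt L a σ) := hu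
      rw [he] at hu2; exact hG.nconn hu2
  · exact Or.inl (Or.inl hv)
  · exact Or.inl (Or.inr hv)
  · right
    have hu2 : Conn G x (u - wpt L a σ) := hu
    refine hu2.tail ?_ hv
    have := (adj_add (-wpt L a σ)).2 ha
    simpa [sub_eq_add_neg] using this

theorem tow_disj (hσ : σ = 1 ∨ σ = -1) (hG : Gadget ω E r L a σ G x y)
    (hN : 2 * L + 5 ≤ N)
    (hsep : ∀ u ∈ P1, ∀ v ∈ P2, u ≠ v ∧ ¬ Adj u v) :
    ∀ u ∈ P1 \ TT L a σ, u ∉ TowS L a σ h G P2 x := by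
  have hL := hG.hL
  rintro u ⟨hu, huT⟩ ((h1 | h1) | h1)
  · exact (hsep u hu u h1).1 rfl
  · apply huT
    refine ⟨fun i hi => ?_, ?_⟩
    · have h2 := hG.hxo i hi
      have h3 := h1.1 i hi
      omega
    · have := h1.2; omega
  · have h2 := gad_lvl hσ hG (Conn.right_mem h1)
    exact huT ⟨h2.2, h2.1.1⟩

theorem tow_loc (hσ : σ = 1 ∨ σ = -1) (hG : Gadget ω E r L a σ G x y)
    (hh : 0 ≤ h) (hN : 2 * L + 5 ≤ N) (s2 : Side N a (-σ) (-h) P2) :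
    ∀ z, z - wpt L a σ ∈ Binf d L →
      (z ∈ Tow L a σ h G P1 P2 x ↔ z - wpt L a σ ∈ G) := by
  intro z hz
  have hL := hG.hL
  have hlv : (-2*L-1 ≤ σ * z a ∧ σ * z a ≤ -1) ∧ ∀ i, i ≠ a → -L ≤ z i ∧ z i ≤ L := by
    have h1 := mem_Binf.1 hz
    refine ⟨?_, fun i hi => by have := h1 i; rwa [wpt_i _ _ _ _ hi] at this⟩
    have h2 := h1 a
    have h3 := wpt_a L a σ hσ z
    rcases hσ with rfl | rfl <;> omega
  constructor
  · rintro (((hv | hv) | hv) | hv)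
    · exact absurd ⟨hlv.2, hlv.1.1⟩ hv.2
    · exfalso
      rcases s2.low z hv with h3 | ⟨h3, i, hi, h4⟩
      · rcases hσ with rfl | rfl <;> omega
      · rcases hσ with rfl | rfl <;> omega
    · exfalso; have := hv.2; omega
    · exact hv
  · exact fun h => Or.inr h

/-- the tower away from the side regions is deep inside -/
theorem tow_deep (hσ : σ = 1 ∨ σ = -1) (hG : Gadget ω E r L a σ G x y)
    (hhN : h ≤ N) (hN : 2 * L + 5 ≤ N) :
    ∀ z, z ∈ Col a σ h x ∨ z - wpt L a σ ∈ G → ∀ i, -N ≤ z i ∧ z i ≤ N := by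
  have hL := hG.hL
  rintro z (hz | hz) i
  · by_cases hi : i = a
    · subst hi; have := hz.2; rcases hσ with rfl | rfl <;> omega
    · have h2 := hG.hxo i hi
      have h3 := hz.1 i hi
      omega
  · have h1 := gad_lvl hσ hG hz
    by_cases hi : i = a
    · subst hi; rcases hσ with rfl | rfl <;> omega
    · have := h1.2 i hi; omega

theorem core_conn (hσ : σ = 1 ∨ σ = -1) {S : Set (Fin d → ℤ)} (l1 l2 : ℤ) (z z' : Fin d → ℤ)
    (h : ∀ u : Fin d → ℤ, (∀ i, i ≠ a → -N ≤ u i ∧ u i ≤ N) → l1 ≤ σ * u a → σ * u a ≤ l2 → u ∈ S)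
    (hz : (∀ i, i ≠ a → -N ≤ z i ∧ z i ≤ N) ∧ l1 ≤ σ * z a ∧ σ * z a ≤ l2)
    (hz' : (∀ i, i ≠ a → -N ≤ z' i ∧ z' i ≤ N) ∧ l1 ≤ σ * z' a ∧ σ * z' a ≤ l2) :
    Conn S z z' := by
  classical
  apply conn_box (fun i => if i = a then (if σ = 1 then l1 else -l2) else -N)
    (fun i => if i = a then (if σ = 1 then l2 else -l1) else N)
  · intro i
    by_cases hi : i = a
    · subst hi; rcases hσ with rfl | rfl <;> simp <;> omega
    · simp [hi]; exact hz.1 i hi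
  · intro i
    by_cases hi : i = a
    · subst hi; rcases hσ with rfl | rfl <;> simp <;> omega
    · simp [hi]; exact hz'.1 i hi
  · intro u hu
    apply h
    · intro i hi
      have := hu i; simpa [hi] using this
    · have := hu a; rcases hσ with rfl | rfl <;> simp at this <;> omega
    · have := hu a; rcases hσ with rfl | rfl <;> simp at this <;> omega

theorem tow_conn (hσ : σ = 1 ∨ σ = -1) (hG : Gadget ω E r L a σ G x y)
    (hh : 0 ≤ h) (hhN : h ≤ N) (hN : 2 * L + 5 ≤ N)
    (s1 : Side N a σ h P1) (s2 : Side N a (-σ) (-h) P2) :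
    ∀ p1 ∈ P1 \ TT L a σ, ∀ p2 ∈ P2,
      Conn (Tow L a σ h G P1 P2 x ∪ {z | z - wpt L a σ ∈ E}) p1 p2 := by
  have hL := hG.hL
  intro p1 hp1 p2 hp2
  set W := Tow L a σ h G P1 P2 x ∪ {z | z - wpt L a σ ∈ E} with hW
  have hσ' : -σ = 1 ∨ -σ = -1 := by omega
  have hσσ : σ * σ = 1 := by rcases hσ with rfl | rfl <;> rfl
  have W1 : P1 \ TT L a σ ⊆ W := fun z hz => Or.inl (Or.inl (Or.inl (Or.inl hz)))
  have W2 : P2 ⊆ W := fun z hz => Or.inl (Or.inl (Or.inl (Or.inr hz)))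
  have W3 : Col a σ h x ⊆ W := fun z hz => Or.inl (Or.inl (Or.inr hz))
  -- thin side
  let c : Fin d → ℤ := Function.update x a (σ * (h + 1))
  have hca : σ * c a = h + 1 := by
    simp only [c, Function.update_self]; rw [← mul_assoc, hσσ, one_mul]
  have hci : ∀ i, i ≠ a → c i = x i := fun i hi => by simp [c, hi]
  have hcore2 : Core N a (-σ) (-h) c := by
    refine ⟨fun i hi => ?_, ?_, ?_⟩
    · rw [hci i hi]; have := hG.hxo i hi; omega
    · rw [neg_mul, hca]; omega
    · rw [neg_mul, hca]; omega
  have thin0 : ∀ z, Core N a (-σ) (-h) z → Conn W z c := by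
    intro z hz
    refine core_conn (N := N) (a := a) hσ' (-(N+1)) (-h-1) z c ?_ hz hcore2
    intro u h1 h2 h3
    exact W2 (s2.core u ⟨h1, h2, h3⟩)
  have thin : Conn W c p2 := by
    rcases s2.reach p2 hp2 with h1 | ⟨z', h1, h2⟩
    · exact (thin0 _ h1).symm
    · exact ((h2.mono (fun z hz => W2 hz.1)).trans (thin0 _ h1)).symm
  -- thick side
  let b : Fin d → ℤ := Function.update 0 a (σ * (-(N+1)))
  have hba : σ * b a = -(N+1) := by
    simp only [b, Function.update_self]; rw [← mul_assoc, hσσ, one_mul]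
  have hbi : ∀ i, i ≠ a → b i = 0 := fun i hi => by simp [b, hi]
  have hmem1 : ∀ u, Core N a σ h u → u ∉ TT L a σ → u ∈ W := fun u h1 h2 => W1 ⟨s1.core u h1, h2⟩
  have thick0 : ∀ z, Core N a σ h z → z ∉ TT L a σ → Conn W z b := by
    intro z hz hzT
    let z' : Fin d → ℤ := Function.update z a (σ * (-(N+1)))
    have hza : σ * z' a = -(N+1) := by
      simp only [z', Function.update_self]; rw [← mul_assoc, hσσ, one_mul]
    have hzi : ∀ i, i ≠ a → z' i = z i := fun i hi => by simp [z', hi]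
    have c1 : Conn W z z' := by
      apply conn_seg z z' a hzi
      intro u hu hua
      have hlv : -(N+1) ≤ σ * u a ∧ σ * u a ≤ σ * z a := by
        have := hz.2
        rcases hσ with rfl | rfl <;> omega
      apply hmem1 u
      · refine ⟨fun i hi => by rw [hu i hi]; exact hz.1 i hi, hlv.1, ?_⟩
        have := hz.2; omega
      · rintro ⟨h1, h2⟩
        exact hzT ⟨fun i hi => by rw [← hu i hi]; exact h1 i hi, by omega⟩
    refine c1.trans ?_
    refine core_conn (N := N) (a := a) hσ (-(N+1)) (-2*L-2) z' b ?_ ?_ ?_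
    · intro u h1 h2 h3
      apply hmem1 u ⟨h1, h2, by omega⟩
      rintro ⟨-, h4⟩; omega
    · exact ⟨fun i hi => by rw [hzi i hi]; exact hz.1 i hi, by omega, by omega⟩
    · exact ⟨fun i hi => by rw [hbi i hi]; omega, by omega, by omega⟩
  have thick : Conn W p1 b := by
    rcases s1.reach p1 hp1.1 with h1 | ⟨z', h1, h2⟩
    · exact thick0 _ h1 hp1.2
    · have hT : ∀ u : Fin d → ℤ, (∃ i, i ≠ a ∧ (N ≤ u i ∨ u i ≤ -N)) → u ∉ TT L a σ := by
        rintro u ⟨i, hi, h3⟩ ⟨h4, -⟩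
        have := h4 i hi; omega
      refine (h2.mono (fun z hz => W1 ⟨hz.1, hT z hz.2⟩)).trans (thick0 _ h1 (hT _ h2.right_mem.2))
  -- column
  have col : Conn W (x + wpt L a σ) c := by
    apply conn_seg _ _ a
    · intro i hi; rw [hci i hi]; simp [wpt, mv_ne _ hi]
    · intro u hu hua
      have hui : ∀ i, i ≠ a → u i = x i := fun i hi => by rw [hu i hi]; simp [wpt, mv_ne _ hi]
      have hxw : σ * (x + wpt L a σ) a = -1 := by
        have := wpt_a L a σ hσ (x + wpt L a σ)
        rw [add_sub_cancel_right, hG.hxa] at this; omega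
      have hl : -1 ≤ σ * u a ∧ σ * u a ≤ h + 1 := by
        rcases hσ with rfl | rfl <;> omega
      by_cases e1 : σ * u a = -1
      · have : u = x + wpt L a σ := by
          funext i
          by_cases hi : i = a
          · subst hi; rcases hσ with rfl | rfl <;> omega
          · exact hu i hi
        rw [this]; left; right
        show x + wpt L a σ - wpt L a σ ∈ G
        rw [add_sub_cancel_right]; exact hG.hx
      · by_cases e2 : σ * u a = h + 1
        · have : u = c := by
            funext i
            by_cases hi : i = a
            · subst hi; rcases hσ with rfl | rfl <;> omega
            · rw [hui i hi, hci i hi]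
          rw [this]; exact W2 (s2.core c hcore2)
        · exact W3 ⟨hui, by omega, by omega⟩
  -- gadget
  have gad : Conn W (x + wpt L a σ) (y + wpt L a σ) := by
    refine (hG.conn.translate (wpt L a σ)).mono ?_
    rintro z (hz | hz)
    · exact Or.inl (Or.inr hz)
    · exact Or.inr hz
  -- exit
  have hyG : (y + wpt L a σ) - wpt L a σ ∈ G := by rw [add_sub_cancel_right]; exact hG.hy
  have hlv := gad_lvl hσ hG hyG
  have hya : σ * y a = σ * (y + wpt L a σ) a + L + 1 := by
    have := wpt_a L a σ hσ (y + wpt L a σ)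
    rwa [add_sub_cancel_right] at this
  have hyi : ∀ i, i ≠ a → (y + wpt L a σ) i = y i := fun i hi => by simp [wpt, mv_ne _ hi]
  have hex : ∃ v, Adj (y + wpt L a σ) v ∧ Core N a σ h v ∧ v ∉ TT L a σ := by
    rcases hG.hyo with ⟨i, hi, h1⟩ | h1
    · obtain ⟨e, he, hye⟩ : ∃ e : ℤ, (e = 1 ∨ e = -1) ∧ e * y i = L := by
        rcases h1 with h1 | h1
        · exact ⟨1, Or.inl rfl, by omega⟩
        · exact ⟨-1, Or.inr rfl, by omega⟩
      have hvi : mv (y + wpt L a σ) i e i = y i + e := by rw [mv_self, hyi i hi]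
      refine ⟨mv (y + wpt L a σ) i e, adj_mv _ _ he, ⟨fun k hk => ?_, ?_⟩, ?_⟩
      · by_cases hki : k = i
        · subst hki; rw [hvi]; rcases he with rfl | rfl <;> omega
        · rw [mv_ne _ hki]; have := hlv.2 k hk; omega
      · rw [mv_ne _ (Ne.symm hi)]; have := hlv.1; omega
      · rintro ⟨h2, -⟩
        have := h2 i hi; rw [hvi] at this
        rcases he with rfl | rfl <;> omega
    · have hva : σ * mv (y + wpt L a σ) a (-σ) a = -2*L-2 := by
        rw [mv_self, mul_add, mul_neg, hσσ]; omega
      refine ⟨mv (y + wpt L a σ) a (-σ), adj_mv _ _ hσ', ⟨fun k hk => ?_, ?_⟩, ?_⟩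
      · rw [mv_ne _ hk]; have := hlv.2 k hk; omega
      · omega
      · rintro ⟨-, h2⟩; omega
  obtain ⟨v, hv1, hv2, hv3⟩ := hex
  have exit : Conn W (y + wpt L a σ) v :=
    Conn.single gad.right_mem (hmem1 v hv2 hv3) hv1
  exact (thick.trans (thick0 v hv2 hv3).symm).trans
    (((exit.symm.trans gad.symm).trans col).trans thin)

end Tower



/-! ### Regions -/

def Split {d : ℕ} (N : ℤ) (PX PY : Set (Fin d → ℤ)) : Prop :=
  ∃ (b : Fin d) (s h : ℤ), (s = 1 ∨ s = -1) ∧ -N ≤ h ∧ h ≤ N ∧ Side N b s h PX ∧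
    Side N b (-s) (-h) PY ∧ ∀ u ∈ PX, ∀ v ∈ PY, u ≠ v ∧ ¬ Adj u v

theorem Split.symm {d : ℕ} {N : ℤ} {PX PY : Set (Fin d → ℤ)} (h : Split N PX PY) :
    Split N PY PX := by
  obtain ⟨b, s, h, hs, h1, h2, h3, h4, h5⟩ := h
  refine ⟨b, -s, -h, by omega, by omega, by omega, h4, by simpa using h3, ?_⟩
  intro u hu v hv
  exact ⟨fun e => (h5 v hv u hu).1 e.symm, fun e => (h5 v hv u hu).2 (adj_symm e)⟩

theorem core_zr {d : ℕ} {N : ℤ} {b : Fin d} {s h : ℤ} (hs : s = 1 ∨ s = -1) (hN : 1 ≤ N)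
    (hh2 : h ≤ N) {z : Fin d → ℤ}
    (hz : Core N b s h z) : z ∈ Zr d N := by
  constructor
  · intro i
    by_cases hi : i = b
    · subst hi; have := hz.2; rcases hs with rfl | rfl <;> omega
    · have := hz.1 i hi; omega
  · intro i j hij h1 h2
    by_cases hi : i = b
    · have := hz.1 j (fun e => hij (hi.trans e.symm)); unfold ExtC at h2; omega
    · have := hz.1 i hi; unfold ExtC at h1; omega

theorem zr_noncore {d : ℕ} {N : ℤ} {b : Fin d} {s h : ℤ} (hs : s = 1 ∨ s = -1) (hN : 1 ≤ N)
    {z : Fin d → ℤ} (hz : z ∈ Zr d N) (hl : s * z b ≤ h - 1) (hc : ¬ Core N b s h z) :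
    ∃ i, i ≠ b ∧ ExtC N z i := by
  by_contra hcc
  apply hc
  refine ⟨fun i hi => ?_, ?_, hl⟩
  · have h1 : ¬ ExtC N z i := fun e => hcc ⟨i, hi, e⟩
    have h2 := hz.1 i
    unfold ExtC at h1
    omega
  · have h2 := hz.1 b; rcases hs with rfl | rfl <;> omega

/-- move an extreme coordinate inwards -/
theorem inward {d : ℕ} {N : ℤ} {b : Fin d} {s h : ℤ} (hs : s = 1 ∨ s = -1) (hN : 1 ≤ N)
    {z : Fin d → ℤ} (hz : z ∈ Zr d N) (hl : s * z b ≤ h - 1) {i : Fin d} (hi : i ≠ b)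
    (he : ExtC N z i) : ∃ z', Core N b s h z' ∧ Adj z z' ∧ (N ≤ z' i ∨ z' i ≤ -N) := by
  have : ∃ e : ℤ, (e = 1 ∨ e = -1) ∧ (z i + e = N ∨ z i + e = -N) := by
    rcases he with h1 | h1
    · exact ⟨-1, Or.inr rfl, by omega⟩
    · exact ⟨1, Or.inl rfl, by omega⟩
  obtain ⟨e, he1, he2⟩ := this
  refine ⟨mv z i e, ⟨fun j hj => ?_, ?_, ?_⟩, adj_mv _ _ he1, ?_⟩
  · by_cases hji : j = i
    · subst hji; rw [mv_self]; omega
    · rw [mv_ne _ hji]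
      have h1 := hz.2 i j (fun h => hji h.symm) he
      have h2 := hz.1 j
      unfold ExtC at h1; omega
  · rw [mv_ne _ hi.symm]
    have h2 := hz.1 b; rcases hs with rfl | rfl <;> omega
  · rw [mv_ne _ hi.symm]; exact hl
  · rw [mv_self]; omega

/-- generic side lemma -/
theorem side_of {d : ℕ} {N : ℤ} {b : Fin d} {s h : ℤ} (hs : s = 1 ∨ s = -1) (hN : 1 ≤ N)
    (hh2 : h ≤ N) {P : Set (Fin d → ℤ)}
    (hsub : P ⊆ Zr d N) (hcore : ∀ z, Core N b s h z → z ∈ P)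
    (hlow : ∀ z ∈ P, s * z b ≤ h - 1 ∨ (s * z b = h ∧ (∃ i, i ≠ b ∧ ExtC N z i) ∧
      mv z b (-s) ∈ P)) : Side N b s h P := by
  have step : ∀ z ∈ P, s * z b ≤ h - 1 → Core N b s h z ∨ ((∃ i, i ≠ b ∧ ExtC N z i) ∧
      ∃ z', Core N b s h z' ∧
      Conn (P ∩ {u | ∃ i, i ≠ b ∧ (N ≤ u i ∨ u i ≤ -N)}) z z') := by
    intro z hz h1
    by_cases hc : Core N b s h z
    · exact Or.inl hc
    · obtain ⟨i, hi, he⟩ := zr_noncore hs hN (hsub hz) h1 hc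
      obtain ⟨z', h2, h3, h4⟩ := inward hs hN (hsub hz) h1 hi he
      refine Or.inr ⟨⟨i, hi, he⟩, z', h2, Conn.single ⟨hz, i, hi, ?_⟩ ⟨hcore _ h2, i, hi, h4⟩ h3⟩
      unfold ExtC at he; omega
  refine ⟨hsub, ?_, hcore, ?_⟩
  · intro z hz
    rcases hlow z hz with h1 | ⟨h1, h2, -⟩
    · exact Or.inl h1
    · exact Or.inr ⟨h1, h2⟩
  · intro z hz
    rcases hlow z hz with h1 | ⟨h1, ⟨i, hi, he⟩, h3⟩
    · rcases step z hz h1 with h2 | ⟨-, h2⟩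
      · exact Or.inl h2
      · exact Or.inr h2
    · right
      have h4 : s * (mv z b (-s)) b ≤ h - 1 := by
        rw [mv_self]; rcases hs with rfl | rfl <;> omega
      have he' : ExtC N (mv z b (-s)) i := by unfold ExtC at *; rwa [mv_ne _ hi]
      have hsingle : Conn (P ∩ {u | ∃ i, i ≠ b ∧ (N ≤ u i ∨ u i ≤ -N)}) z (mv z b (-s)) := by
        refine Conn.single ⟨hz, i, hi, ?_⟩ ⟨h3, i, hi, ?_⟩ (adj_mv _ _ (by omega))
        · unfold ExtC at he; omega
        · unfold ExtC at he'; omega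
      rcases step _ h3 h4 with h2 | ⟨-, z', h5, h6⟩
      · exact ⟨_, h2, hsingle⟩
      · exact ⟨z', h5, hsingle.trans h6⟩

theorem split_plain {d : ℕ} {N : ℤ} (b : Fin d) (s h : ℤ) (hs : s = 1 ∨ s = -1) (hN : 1 ≤ N)
    (hh1 : -N ≤ h) (hh2 : h ≤ N) :
    Split N {z | z ∈ Zr d N ∧ s * z b ≤ h - 1} {z | z ∈ Zr d N ∧ h + 1 ≤ s * z b} := by
  have hs' : -s = 1 ∨ -s = -1 := by omega
  refine ⟨b, s, h, hs, hh1, hh2, ?_, ?_, ?_⟩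
  · apply side_of hs hN hh2
    · exact fun z hz => hz.1
    · exact fun z hz => ⟨core_zr hs hN hh2 hz, hz.2.2⟩
    · exact fun z hz => Or.inl hz.2
  · apply side_of hs' hN (by omega)
    · exact fun z hz => hz.1
    · intro z hz
      refine ⟨core_zr hs' hN (by omega) hz, ?_⟩
      have := hz.2.2; rw [neg_mul] at this; omega
    · intro z hz; left; have := hz.2; rw [neg_mul]; omega
  · intro u hu v hv
    have h1 := hu.2
    have h2 := hv.2
    refine ⟨by rintro rfl; omega, fun ha => ?_⟩
    have := adj_coord_le ha b
    rcases hs with rfl | rfl <;> omega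

theorem split_bump {d : ℕ} {N : ℤ} (b : Fin d) (s h : ℤ) (hs : s = 1 ∨ s = -1) (hN : 1 ≤ N)
    (hh1 : -N < h) (hh2 : h ≤ N) (p : Fin d → ℤ) (hp : p ∈ Zr d N) (hpl : s * p b = h)
    (hpe : ∃ i, i ≠ b ∧ ExtC N p i) :
    Split N {z | z ∈ Zr d N ∧ (s * z b ≤ h - 1 ∨ z = p)}
      {z | z ∈ Zr d N ∧ h + 1 ≤ s * z b ∧ ¬ Adj z p} := by
  have hs' : -s = 1 ∨ -s = -1 := by omega
  refine ⟨b, s, h, hs, by omega, hh2, ?_, ?_, ?_⟩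
  · apply side_of hs hN hh2
    · exact fun z hz => hz.1
    · exact fun z hz => ⟨core_zr hs hN hh2 hz, Or.inl hz.2.2⟩
    · rintro z ⟨hz, h1 | rfl⟩
      · exact Or.inl h1
      · right
        obtain ⟨i, hi, he⟩ := hpe
        refine ⟨hpl, ⟨i, hi, he⟩, ⟨?_, ?_⟩, Or.inl ?_⟩
        · intro j
          have h2 := hz.1 j
          by_cases hj : j = b
          · subst hj; rw [mv_self]; rcases hs with rfl | rfl <;> omega
          · rw [mv_ne _ hj]; exact h2
        · have hb : ¬ ExtC N (mv z b (-s)) b := by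
            unfold ExtC; rw [mv_self]; rcases hs with rfl | rfl <;> omega
          intro j k hjk h1 h2
          have hj : j ≠ b := by rintro rfl; exact hb h1
          have hk : k ≠ b := by rintro rfl; exact hb h2
          unfold ExtC at h1 h2
          rw [mv_ne _ hj] at h1
          rw [mv_ne _ hk] at h2
          exact hz.2 j k hjk h1 h2
        · rw [mv_self]; rcases hs with rfl | rfl <;> omega
  · apply side_of hs' hN (by omega)
    · exact fun z hz => hz.1
    · intro z hz
      have h3 := hz.2.2; rw [neg_mul] at h3
      refine ⟨core_zr hs' hN (by omega) hz, by omega, ?_⟩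
      intro ha
      obtain ⟨i, hi, he⟩ := hpe
      obtain ⟨k, hk1, hk2⟩ := adj_coord ha
      have hkb : b = k := by
        by_contra hne; have := hk2 b hne; rw [this] at hpl; omega
      have h4 := hk2 i (fun e => hi (e.trans hkb.symm))
      have := hz.1 i hi
      unfold ExtC at he; omega
    · intro z hz; left; have := hz.2.1; rw [neg_mul]; omega
  · rintro u ⟨hu, h1 | rfl⟩ v hv
    · have h2 := hv.2.1
      refine ⟨by rintro rfl; omega, fun ha => ?_⟩
      have := adj_coord_le ha b
      rcases hs with rfl | rfl <;> omega
    · refine ⟨?_, fun ha => hv.2.2 (adj_symm ha)⟩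
      rintro rfl; have := hv.2.1; omega

def Reg {d : ℕ} (N : ℤ) (NC ND : Set (Fin d → ℤ)) (pC pD : Fin d → ℤ) : Prop :=
  ∃ PX PY, Split N PX PY ∧ pC ∈ PX ∧ pD ∈ PY ∧ (∀ z ∈ NC, z ∉ PY) ∧ ∀ z ∈ ND, z ∉ PX

theorem Reg.symm {d : ℕ} {N : ℤ} {NC ND : Set (Fin d → ℤ)} {pC pD : Fin d → ℤ}
    (h : Reg N NC ND pC pD) : Reg N ND NC pD pC := by
  obtain ⟨PX, PY, h1, h2, h3, h4, h5⟩ := h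
  exact ⟨PY, PX, h1.symm, h3, h2, h5, h4⟩

theorem reg_plain {d : ℕ} {N : ℤ} (b : Fin d) (s h : ℤ) (hs : s = 1 ∨ s = -1) (hN : 1 ≤ N)
    (hh1 : -N ≤ h) (hh2 : h ≤ N) {NC ND : Set (Fin d → ℤ)} {pC pD : Fin d → ℤ}
    (hC : pC ∈ Zr d N) (hD : pD ∈ Zr d N) (hC1 : s * pC b ≤ h - 1) (hD1 : h + 1 ≤ s * pD b)
    (hNC : ∀ z ∈ NC, s * z b ≤ h) (hND : ∀ z ∈ ND, h ≤ s * z b) : Reg N NC ND pC pD := by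
  refine ⟨_, _, split_plain b s h hs hN hh1 hh2, ⟨hC, hC1⟩, ⟨hD, hD1⟩, ?_, ?_⟩
  · intro z hz h1; have := hNC z hz; have := h1.2; omega
  · intro z hz h1; have := hND z hz; have := h1.2; omega

theorem reg_bump {d : ℕ} {N : ℤ} (b : Fin d) (s h : ℤ) (hs : s = 1 ∨ s = -1) (hN : 1 ≤ N)
    (hh1 : -N < h) (hh2 : h ≤ N) {NC ND : Set (Fin d → ℤ)} {pC pD : Fin d → ℤ}
    (hC : pC ∈ Zr d N) (hD : pD ∈ Zr d N) (hC1 : s * pC b = h) (hD1 : h + 1 ≤ s * pD b)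
    (hpe : ∃ i, i ≠ b ∧ ExtC N pC i) (hna : ¬ Adj pD pC)
    (hNC : ∀ z ∈ NC, s * z b ≤ h) (hND : ∀ z ∈ ND, h ≤ s * z b) (hCN : pC ∉ ND) :
    Reg N NC ND pC pD := by
  refine ⟨_, _, split_bump b s h hs hN hh1 hh2 pC hC hC1 hpe, ⟨hC, Or.inr rfl⟩, ⟨hD, hD1, hna⟩,
    ?_, ?_⟩
  · intro z hz h1; have := hNC z hz; have := h1.2.1; omega
  · rintro z hz ⟨h1, h2 | rfl⟩
    · have := hND z hz; omega
    · exact hCN hz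

theorem reg_cap {d : ℕ} {N : ℤ} (b : Fin d) (s : ℤ) (hs : s = 1 ∨ s = -1) (hN : 1 ≤ N)
    {NC ND : Set (Fin d → ℤ)} {pC pD : Fin d → ℤ}
    (hC : pC ∈ Zr d N) (hD : pD ∈ Zr d N) (hD1 : s * pD b = N + 1)
    (hpe : ∃ i, ExtC N pC i) (hpC : pC ∈ NC)
    (hNC : ∀ z ∈ NC, s * z b ≤ N) (hND : ∀ z ∈ ND, N ≤ s * z b) (hCN : pC ∉ ND) :
    Reg N NC ND pC pD := by
  have h1 := hNC pC hpC
  by_cases h2 : s * pC b = N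
  · obtain ⟨i, hi⟩ := hpe
    have hib : i ≠ b := by
      rintro rfl; unfold ExtC at hi; rcases hs with rfl | rfl <;> omega
    refine reg_bump b s N hs hN (by omega) le_rfl hC hD h2 (by omega) ⟨i, hib, hi⟩ ?_ hNC hND hCN
    intro ha
    obtain ⟨k, hk1, hk2⟩ := adj_coord ha
    have hkb : b = k := by
      by_contra hne; have := hk2 b hne; rw [this] at h2; omega
    have h4 := hk2 i (fun e => hib (e.trans hkb.symm))
    have h5 : ExtC N pD i := by unfold ExtC at *; omega
    refine hD.2 i b hib h5 ?_
    unfold ExtC; rcases hs with rfl | rfl <;> omega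
  · exact reg_plain b s N hs hN (by omega) le_rfl hC hD (by omega) (by omega) hNC hND



/-! ### Assembly -/

theorem deep_nbr {d : ℕ} {N : ℤ} {z v : Fin d → ℤ} (hz : ∀ i, -N ≤ z i ∧ z i ≤ N)
    (ha : Adj z v) : v ∈ Zr d N := by
  obtain ⟨k, hk1, hk2⟩ := adj_coord ha
  have key : ∀ i, i ≠ k → ¬ ExtC N v i := by
    intro i hi h; have := hk2 i hi; have := hz i; unfold ExtC at h; omega
  refine ⟨fun i => ?_, fun i j hij h1 h2 => ?_⟩
  · have := hz i; have := adj_coord_le ha i; omega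
  · by_cases hi : i = k
    · exact key j (fun e => hij (hi.trans e.symm)) h2
    · exact key i hi h1

theorem zr_nbr_in {d : ℕ} {N : ℤ} {z v : Fin d → ℤ} (hz : z ∈ Zr d N)
    (ha : Adj z v) : v ∈ Binf d (N + 2) := by
  rw [mem_Binf]
  intro i; have := hz.1 i; have := adj_coord_le ha i; omega

theorem zr_in {d : ℕ} {N : ℤ} : Zr d N ⊆ Binf d (N + 2) := by
  intro z hz; rw [mem_Binf]; intro i; have := hz.1 i; omega

structure Good {d : ℕ} (N : ℤ) (H X Y : Set (Fin d → ℤ)) (x0 y0 : Fin d → ℤ)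
    (KX KY : Set (Fin d → ℤ)) (fX fY pX pY : Fin d → ℤ) (PX PY : Set (Fin d → ℤ)) : Prop where
  kx : ∀ u ∈ KX, u ∈ Binf d (N + 2) ∧ u ∉ Zr d N
  ky : ∀ u ∈ KY, u ∈ Binf d (N + 2) ∧ u ∉ Zr d N
  sepK : ∀ u ∈ KX, ∀ v ∈ KY, u ≠ v ∧ ¬ Adj u v
  nx : ∀ u ∈ KX, ∀ v ∈ H, v ∉ Binf d (N + 2) → Adj u v → v ∈ X
  ny : ∀ u ∈ KY, ∀ v ∈ H, v ∉ Binf d (N + 2) → Adj u v → v ∈ Y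
  cx : Conn ((X \ Binf d (N + 2)) ∪ KX) x0 fX
  cy : Conn ((Y \ Binf d (N + 2)) ∪ KY) y0 fY
  ax : Adj fX pX
  ay : Adj fY pY
  px : pX ∈ PX
  py : pY ∈ PY
  ex : ∃ i, ExtC N pX i
  ey : ∃ i, ExtC N pY i
  split : Split N PX PY
  nxp : ∀ u ∈ KX, ∀ z ∈ PY, ¬ Adj u z
  nyp : ∀ u ∈ KY, ∀ z ∈ PX, ¬ Adj u z

theorem asm_closed {d : ℕ} {N : ℤ} {H X Y : Set (Fin d → ℤ)} {KX KY Q SX : Set (Fin d → ℤ)}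
    (hXH : ∀ u ∈ X, ∀ v ∈ H, Adj u v → v ∈ X) (hXY : ∀ u ∈ X, u ∉ Y) (hX : X ⊆ H)
    (sepK : ∀ u ∈ KX, ∀ v ∈ KY, u ≠ v ∧ ¬ Adj u v)
    (nx : ∀ u ∈ KX, ∀ v ∈ H, v ∉ Binf d (N + 2) → Adj u v → v ∈ X)
    (ny : ∀ u ∈ KY, ∀ v ∈ H, v ∉ Binf d (N + 2) → Adj u v → v ∈ Y)
    (hQ : Q ⊆ Zr d N)
    (hc : ∀ u ∈ SX, ∀ v ∈ Q, Adj u v → v ∈ SX) (hSQ : SX ⊆ Q)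
    (h1 : ∀ u ∈ KX, ∀ v ∈ Q, Adj u v → v ∈ SX)
    (h2 : ∀ u ∈ KY, ∀ v ∈ SX, ¬ Adj u v) :
    ∀ u ∈ (X \ Binf d (N + 2)) ∪ KX ∪ SX, ∀ v ∈ (H \ Binf d (N + 2)) ∪ (KX ∪ KY ∪ Q),
      Adj u v → v ∈ (X \ Binf d (N + 2)) ∪ KX ∪ SX := by
  rintro u ((hu | hu) | hu) v (hv | ((hv | hv) | hv)) ha
  · exact Or.inl (Or.inl ⟨hXH u hu.1 v hv.1 ha, hv.2⟩)
  · exact Or.inl (Or.inr hv)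
  · exact absurd (ny v hv u (hX hu.1) hu.2 (adj_symm ha)) (hXY u hu.1)
  · exact absurd (zr_nbr_in (hQ hv) (adj_symm ha)) hu.2
  · exact Or.inl (Or.inl ⟨nx u hu v hv.1 hv.2 ha, hv.2⟩)
  · exact Or.inl (Or.inr hv)
  · exact absurd ha (sepK u hu v hv).2
  · exact Or.inr (h1 u hu v hv ha)
  · exact absurd (zr_nbr_in (hQ (hSQ hu)) ha) hv.2
  · exact Or.inl (Or.inr hv)
  · exact absurd (adj_symm ha) (h2 v hv u hu)
  · exact Or.inr (hc u hu v hv ha)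

/-- the common consequences of the tower -/
theorem asm_tow {d : ℕ} {ω E : Set (Fin d → ℤ)} {r L N : ℤ} {a : Fin d} {σ h : ℤ}
    {G P1 P2 : Set (Fin d → ℤ)} {x y : Fin d → ℤ} (hσ : σ = 1 ∨ σ = -1)
    (hG : Gadget ω E r L a σ G x y) (hh : 0 ≤ h) (hhN : h ≤ N) (hN : 2 * L + 5 ≤ N)
    (s1 : Side N a σ h P1) (s2 : Side N a (-σ) (-h) P2)
    (hsep : ∀ u ∈ P1, ∀ v ∈ P2, u ≠ v ∧ ¬ Adj u v) {K1 K2 : Set (Fin d → ℤ)}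
    (k1 : ∀ u ∈ K1, u ∉ Zr d N) (k2 : ∀ u ∈ K2, u ∉ Zr d N)
    (n1 : ∀ u ∈ K1, ∀ z ∈ P2, ¬ Adj u z) (n2 : ∀ u ∈ K2, ∀ z ∈ P1, ¬ Adj u z)
    {p1 p2 : Fin d → ℤ} (hp1 : p1 ∈ P1) (hp2 : p2 ∈ P2) (he1 : ∃ i, ExtC N p1 i) :
    ∃ S2 ⊆ Tow L a σ h G P1 P2 x, Tow L a σ h G P1 P2 x ⊆ Zr d N ∧
      (∀ u ∈ S2, ∀ v ∈ Tow L a σ h G P1 P2 x, Adj u v → v ∈ S2) ∧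
      (∀ u ∈ K1, ∀ v ∈ S2, ¬ Adj u v) ∧
      (∀ u ∈ K2, ∀ v ∈ Tow L a σ h G P1 P2 x, Adj u v → v ∈ S2) ∧
      p1 ∈ Tow L a σ h G P1 P2 x ∧ p2 ∈ S2 ∧ p1 ∉ S2 ∧
      Conn (Tow L a σ h G P1 P2 x ∪ {z | z - wpt L a σ ∈ E}) p1 p2 := by
  have hL := hG.hL
  have hdeep := tow_deep hσ hG hhN hN
  have hp1T : p1 ∈ P1 \ TT L a σ := by
    refine ⟨hp1, ?_⟩
    rintro ⟨h1, h2⟩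
    obtain ⟨i, hi⟩ := he1
    by_cases hia : i = a
    · subst hia
      have := s1.low _ hp1
      unfold ExtC at hi; rcases hσ with rfl | rfl <;> omega
    · have := h1 i hia; unfold ExtC at hi; omega
  have hsub : TowS L a σ h G P2 x ⊆ Tow L a σ h G P1 P2 x := by
    rintro z ((hz | hz) | hz)
    · exact Or.inl (Or.inl (Or.inr hz))
    · exact Or.inl (Or.inr hz)
    · have h9 : Conn G x (z - wpt L a σ) := hz
      exact Or.inr h9.right_mem
  have ndeep : ∀ u, u ∉ Zr d N → ∀ z, z ∈ Col a σ h x ∨ z - wpt L a σ ∈ G → ¬ Adj u z :=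
    fun u hu z hz ha => hu (deep_nbr (hdeep z hz) (adj_symm ha))
  refine ⟨TowS L a σ h G P2 x, hsub, ?_, tow_closed hσ hG hN hh s2 hsep, ?_, ?_,
    Or.inl (Or.inl (Or.inl hp1T)), Or.inl (Or.inl hp2), tow_disj hσ hG hN hsep p1 hp1T,
    tow_conn hσ hG hh hhN hN s1 s2 p1 hp1T p2 hp2⟩
  · have hd : ∀ z, z ∈ Col a σ h x ∨ z - wpt L a σ ∈ G → z ∈ Zr d N := by
      intro z hz
      have := hdeep z hz
      refine ⟨fun i => by have := this i; omega, fun i _ _ h1 => ?_⟩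
      have := this i; unfold ExtC at h1; omega
    rintro z (((hz | hz) | hz) | hz)
    · exact s1.sub hz.1
    · exact s2.sub hz
    · exact hd z (Or.inl hz)
    · exact hd z (Or.inr hz)
  · rintro u hu z ((hz | hz) | hz)
    · exact n1 u hu z hz
    · exact ndeep u (k1 u hu) z (Or.inl hz)
    · exact ndeep u (k1 u hu) z (Or.inr (Conn.right_mem hz))
  · rintro u hu z (((hz | hz) | hz) | hz) ha
    · exact absurd ha (n2 u hu z hz.1)
    · exact Or.inl (Or.inl hz)
    · exact absurd ha (ndeep u (k2 u hu) z (Or.inl hz))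
    · exact absurd ha (ndeep u (k2 u hu) z (Or.inr hz))

theorem asm {d : ℕ} {ω E : Set (Fin d → ℤ)} {r L N : ℤ} (hN : 2 * L + 5 ≤ N) (hrL : r ≤ L)
    (hgad : ∀ (a : Fin d) (σ : ℤ), (σ = 1 ∨ σ = -1) → ∃ G x y, Gadget ω E r L a σ G x y)
    {H X Y : Set (Fin d → ℤ)} {x0 y0 : Fin d → ℤ} (hX : X ⊆ H) (hY : Y ⊆ H)
    (hXH : ∀ u ∈ X, ∀ v ∈ H, Adj u v → v ∈ X) (hXY : ∀ u ∈ X, u ∉ Y)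
    (hx0 : x0 ∈ X) (hx0A : x0 ∉ Binf d (N + 2))
    {KX KY : Set (Fin d → ℤ)} {fX fY pX pY : Fin d → ℤ} {PX PY : Set (Fin d → ℤ)}
    (hg : Good N H X Y x0 y0 KX KY fX fY pX pY PX PY) :
    ∃ w ∈ Binf d (N + 2), ∃ K ⊆ Binf d (N + 2),
      (∀ t, t ∉ Binf d (N + 2) → t ∉ X → ¬ Conn ((H \ Binf d (N + 2)) ∪ K) x0 t) ∧
      Conn ((H \ Binf d (N + 2)) ∪ K ∪ {z | z - w ∈ E}) x0 y0 ∧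
      ∀ z, z - w ∈ Binf d r → (z ∈ (H \ Binf d (N + 2)) ∪ K ↔ z - w ∈ ω) := by
  have mainT : ∃ (a : Fin d) (σ h : ℤ) (G P1 P2 : Set (Fin d → ℤ)) (x y : Fin d → ℤ)
      (SX : Set (Fin d → ℤ)), (σ = 1 ∨ σ = -1) ∧ 0 ≤ h ∧ Gadget ω E r L a σ G x y ∧
      Side N a (-σ) (-h) P2 ∧
      SX ⊆ Tow L a σ h G P1 P2 x ∧ Tow L a σ h G P1 P2 x ⊆ Zr d N ∧
      (∀ u ∈ SX, ∀ v ∈ Tow L a σ h G P1 P2 x, Adj u v → v ∈ SX) ∧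
      (∀ u ∈ KX, ∀ v ∈ Tow L a σ h G P1 P2 x, Adj u v → v ∈ SX) ∧
      (∀ u ∈ KY, ∀ v ∈ SX, ¬ Adj u v) ∧
      Conn (Tow L a σ h G P1 P2 x ∪ {z | z - wpt L a σ ∈ E}) pX pY := by
    obtain ⟨b, s, h, hs, h1, h2, h3, h4, h5⟩ := hg.split
    by_cases hh : 0 ≤ h
    · obtain ⟨G, x, y, hG⟩ := hgad b s hs
      obtain ⟨S2, q1, q2, q3, q4, q5, q6, q7, q8, q9⟩ := asm_tow hs hG hh h2 hN h3 h4 h5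
        (fun u hu => (hg.kx u hu).2) (fun u hu => (hg.ky u hu).2) hg.nxp hg.nyp hg.px hg.py hg.ex
      refine ⟨b, s, h, G, PX, PY, x, y, Tow L b s h G PX PY x \ S2, hs, hh, hG, h4,
        Set.sdiff_subset, q2, ?_, ?_, ?_, q9⟩
      · intro u hu v hv ha
        exact ⟨hv, fun hv2 => hu.2 (q3 v hv2 u hu.1 (adj_symm ha))⟩
      · intro u hu v hv ha
        exact ⟨hv, fun hv2 => q4 u hu v hv2 ha⟩
      · intro u hu v hv ha
        exact hv.2 (q5 u hu v hv.1 ha)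
    · have hs' : -s = 1 ∨ -s = -1 := by omega
      obtain ⟨G, x, y, hG⟩ := hgad b (-s) hs'
      have h3' : Side N b (- -s) (- -h) PX := by simpa using h3
      obtain ⟨S2, q1, q2, q3, q4, q5, q6, q7, q8, q9⟩ := asm_tow hs' hG (by omega : 0 ≤ -h)
        (by omega) hN h4 h3'
        (fun u hu v hv => ⟨fun e => (h5 v hv u hu).1 e.symm, fun e => (h5 v hv u hu).2 (adj_symm e)⟩)
        (fun u hu => (hg.ky u hu).2) (fun u hu => (hg.kx u hu).2) hg.nyp hg.nxp hg.py hg.px hg.ey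
      exact ⟨b, -s, -h, G, PY, PX, x, y, S2, hs', by omega, hG, h3', q1, q2, q3, q5, q4, q9.symm⟩
  obtain ⟨a, σ, h, G, P1, P2, x, y, SX, hσ, hh, hG, s2, q1, q2, q3, q4, q5, q6⟩ := mainT
  have hL := hG.hL
  set Q := Tow L a σ h G P1 P2 x with hQ
  have hwB : ∀ z, z - wpt L a σ ∈ Binf d L → ∀ i, -N ≤ z i ∧ z i ≤ N := by
    intro z hz i
    have h1 := mem_Binf.1 hz
    by_cases hi : i = a
    · subst hi
      have h2 := h1 i
      have h3 := wpt_a L i σ hσ z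
      rcases hσ with rfl | rfl <;> omega
    · have h2 := h1 i; rw [wpt_i _ _ _ _ hi] at h2; omega
  have hcl := asm_closed hXH hXY hX hg.sepK hg.nx hg.ny q2 q3 q1 q4 q5
  refine ⟨wpt L a σ, ?_, KX ∪ KY ∪ Q, ?_, ?_, ?_, ?_⟩
  · rw [mem_Binf]; intro i
    have := hwB (wpt L a σ) (by rw [sub_self, mem_Binf]; intro i; simp; omega) i
    omega
  · rintro z ((hz | hz) | hz)
    · exact (hg.kx z hz).1
    · exact (hg.ky z hz).1
    · exact zr_in (q2 hz)
  · intro t ht htX hc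
    rcases hc.closed hcl (Or.inl (Or.inl ⟨hx0, hx0A⟩)) with (h1 | h1) | h1
    · exact htX h1.1
    · exact ht (hg.kx t h1).1
    · exact ht (zr_in (q2 (q1 h1)))
  · set W := (H \ Binf d (N + 2)) ∪ (KX ∪ KY ∪ Q) ∪ {z | z - wpt L a σ ∈ E}
    have c1 : Conn W x0 fX := hg.cx.mono (by
      rintro z (hz | hz)
      · exact Or.inl (Or.inl ⟨hX hz.1, hz.2⟩)
      · exact Or.inl (Or.inr (Or.inl (Or.inl hz))))
    have c2 : Conn W y0 fY := hg.cy.mono (by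
      rintro z (hz | hz)
      · exact Or.inl (Or.inl ⟨hY hz.1, hz.2⟩)
      · exact Or.inl (Or.inr (Or.inl (Or.inr hz))))
    have c3 : Conn W pX pY := q6.mono (by
      rintro z (hz | hz)
      · exact Or.inl (Or.inr (Or.inr hz))
      · exact Or.inr hz)
    exact (c1.tail hg.ax c3.left_mem).trans (c3.trans
      ((Conn.single c3.right_mem c2.right_mem (adj_symm hg.ay)).trans c2.symm))
  · intro z hz
    have hzL : z - wpt L a σ ∈ Binf d L := Binf_mono hrL hz
    have hzd := hwB z hzL
    have hzr : z ∈ Zr d N := by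
      refine ⟨fun i => by have := hzd i; omega, fun i _ _ h1 => ?_⟩
      have := hzd i; unfold ExtC at h1; omega
    have hl := tow_loc (P1 := P1) hσ hG hh hN s2 z hzL
    have hGω : z - wpt L a σ ∈ G ↔ z - wpt L a σ ∈ ω := by
      have := hG.loc
      constructor
      · intro h1
        have : z - wpt L a σ ∈ ω ∩ Binf d r := by rw [← this]; exact ⟨h1, hz⟩
        exact this.1
      · intro h1
        have : z - wpt L a σ ∈ G ∩ Binf d r := by rw [this]; exact ⟨h1, hz⟩
        exact this.1
    rw [← hGω, ← hl]
    constructor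
    · rintro (h1 | ((h1 | h1) | h1))
      · exact absurd (zr_in hzr) h1.2
      · exact absurd hzr (hg.kx z h1).2
      · exact absurd hzr (hg.ky z h1).2
      · exact h1
    · exact fun h1 => Or.inr (Or.inr h1)



/-! ### Entry points -/

def FaceP {d : ℕ} (N : ℤ) (a : Fin d) (s : ℤ) (f : Fin d → ℤ) : Prop :=
  (s = 1 ∨ s = -1) ∧ s * f a = N + 2 ∧ ∀ i, i ≠ a → -N ≤ f i ∧ f i ≤ N

def EdgeP {d : ℕ} (N : ℤ) (a b : Fin d) (s t : ℤ) (f : Fin d → ℤ) : Prop :=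
  (s = 1 ∨ s = -1) ∧ (t = 1 ∨ t = -1) ∧ a ≠ b ∧ s * f a = N + 1 ∧ t * f b = N + 1 ∧
    ∀ i, i ≠ a → i ≠ b → -N ≤ f i ∧ f i ≤ N

theorem EdgeP.symm {d : ℕ} {N : ℤ} {a b : Fin d} {s t : ℤ} {f : Fin d → ℤ}
    (h : EdgeP N a b s t f) : EdgeP N b a t s f :=
  ⟨h.2.1, h.1, h.2.2.1.symm, h.2.2.2.2.1, h.2.2.2.1, fun i h1 h2 => h.2.2.2.2.2 i h2 h1⟩

def Fr {d : ℕ} (N : ℤ) (z : Fin d → ℤ) : Prop :=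
  z ∈ Zr d N ∨ (∃ a s, FaceP N a s z) ∨ ∃ a b s t, EdgeP N a b s t z

def NF {d : ℕ} (N : ℤ) (f : Fin d → ℤ) : Set (Fin d → ℤ) := {z | z ∈ Zr d N ∧ Adj f z}

theorem ext_sign {d : ℕ} {N : ℤ} {z : Fin d → ℤ} {i : Fin d} (h : ExtC N z i) :
    ∃ s : ℤ, (s = 1 ∨ s = -1) ∧ s * z i = N + 1 := by
  rcases h with h | h
  · exact ⟨1, Or.inl rfl, by omega⟩
  · exact ⟨-1, Or.inr rfl, by omega⟩

theorem zr_nbr_fr {d : ℕ} {N : ℤ} (hN : 1 ≤ N) {z v : Fin d → ℤ} (hz : z ∈ Zr d N)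
    (ha : Adj z v) : Fr N v := by
  by_cases hv : v ∈ Zr d N
  · exact Or.inl hv
  obtain ⟨i, hi1, hi2⟩ := adj_coord ha
  by_cases hext : ∃ k, ExtC N z k
  · obtain ⟨k, hk⟩ := hext
    obtain ⟨s, hs, hsk⟩ := ext_sign hk
    have hoth : ∀ j, j ≠ k → -N ≤ z j ∧ z j ≤ N := by
      intro j hj
      have h1 := hz.2 k j hj.symm hk
      have h2 := hz.1 j
      unfold ExtC at h1; omega
    by_cases hik : i = k
    · subst hik
      by_cases hout : s * v i = N + 2
      · right; left
        exact ⟨i, s, hs, hout, fun j hj => by rw [hi2 j hj]; exact hoth j hj⟩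
      · exfalso; apply hv
        have hvi : s * v i = N := by rcases hs with rfl | rfl <;> omega
        refine ⟨fun j => ?_, fun j l hjl h1 h2 => ?_⟩
        · by_cases hj : j = i
          · subst hj; rcases hs with rfl | rfl <;> omega
          · rw [hi2 j hj]; have := hoth j hj; omega
        · unfold ExtC at h1
          by_cases hj : j = i
          · subst hj; rcases hs with rfl | rfl <;> omega
          · rw [hi2 j hj] at h1; have := hoth j hj; omega
    · have hvk : v k = z k := hi2 k (fun e => hik e.symm)
      have hzi := hoth i hik
      by_cases hvi : ExtC N v i
      · obtain ⟨t, ht, hti⟩ := ext_sign hvi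
        right; right
        refine ⟨k, i, s, t, hs, ht, fun e => hik e.symm, by rw [hvk]; exact hsk, hti, ?_⟩
        intro j h1 h2
        rw [hi2 j h2]; exact hoth j h1
      · exfalso; apply hv
        have key : ∀ j, j ≠ k → -N ≤ v j ∧ v j ≤ N := by
          intro j hj
          by_cases hji : j = i
          · subst hji; unfold ExtC at hvi; omega
          · rw [hi2 j hji]; exact hoth j hj
        refine ⟨fun j => ?_, fun j l hjl h1 h2 => ?_⟩
        · by_cases hj : j = k
          · subst hj; rw [hvk]; exact hz.1 j
          · have := key j hj; omega
        · unfold ExtC at h1 h2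
          by_cases hj : j = k
          · have := key l (fun e => hjl (hj.trans e.symm)); omega
          · have := key j hj; omega
  · exfalso; apply hv
    apply deep_nbr _ ha
    intro j
    have h1 : ¬ ExtC N z j := fun e => hext ⟨j, e⟩
    have := hz.1 j
    unfold ExtC at h1; omega

theorem face_nf {d : ℕ} {N : ℤ} (hN : 1 ≤ N) {a : Fin d} {s : ℤ} {f z : Fin d → ℤ}
    (hf : FaceP N a s f) (hz : z ∈ NF N f) : s * z a = N + 1 ∧ ∀ i, i ≠ a → z i = f i := by
  obtain ⟨hs, h1, h2⟩ := hf
  obtain ⟨k, hk1, hk2⟩ := adj_coord hz.2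
  have h3 := hz.1.1 a
  have hka : k = a := by
    by_contra hne
    have := hk2 a (fun e => hne e.symm)
    rcases hs with rfl | rfl <;> omega
  subst hka
  exact ⟨by rcases hs with rfl | rfl <;> omega, hk2⟩

theorem face_mem {d : ℕ} {N : ℤ} (hN : 1 ≤ N) {a : Fin d} {s : ℤ} {f : Fin d → ℤ}
    (hf : FaceP N a s f) : mv f a (-s) ∈ NF N f ∧ ExtC N (mv f a (-s)) a := by
  obtain ⟨hs, h1, h2⟩ := hf
  have h3 : s * mv f a (-s) a = N + 1 := by rw [mv_self]; rcases hs with rfl | rfl <;> omega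
  have h4 : ∀ i, i ≠ a → mv f a (-s) i = f i := fun i hi => mv_ne _ hi _
  refine ⟨⟨⟨fun i => ?_, fun i j hij h5 h6 => ?_⟩, adj_mv _ _ (by omega)⟩, ?_⟩
  · by_cases hi : i = a
    · subst hi; rcases hs with rfl | rfl <;> omega
    · rw [h4 i hi]; have := h2 i hi; omega
  · unfold ExtC at h5 h6
    by_cases hi : i = a
    · have hj : j ≠ a := fun e => hij (hi.trans e.symm)
      rw [h4 j hj] at h6; have := h2 j hj; omega
    · rw [h4 i hi] at h5; have := h2 i hi; omega
  · unfold ExtC; rcases hs with rfl | rfl <;> omega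

theorem edge_nf {d : ℕ} {N : ℤ} (hN : 1 ≤ N) {a b : Fin d} {s t : ℤ} {f z : Fin d → ℤ}
    (hf : EdgeP N a b s t f) (hz : z ∈ NF N f) : (s * z a = N ∧ ∀ i, i ≠ a → z i = f i) ∨
      (t * z b = N ∧ ∀ i, i ≠ b → z i = f i) := by
  obtain ⟨hs, ht, hab, h1, h2, h3⟩ := hf
  obtain ⟨k, hk1, hk2⟩ := adj_coord hz.2
  have h4 := hz.1.1 a
  have h5 := hz.1.1 b
  by_cases hka : k = a
  · subst hka
    exact Or.inl ⟨by rcases hs with rfl | rfl <;> omega, hk2⟩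
  by_cases hkb : k = b
  · subst hkb
    exact Or.inr ⟨by rcases ht with rfl | rfl <;> omega, hk2⟩
  exfalso
  have h6 := hk2 a (fun e => hka e.symm)
  have h7 := hk2 b (fun e => hkb e.symm)
  refine hz.1.2 a b hab ?_ ?_ <;> unfold ExtC
  · rcases hs with rfl | rfl <;> omega
  · rcases ht with rfl | rfl <;> omega

theorem edge_mem {d : ℕ} {N : ℤ} (hN : 1 ≤ N) {a b : Fin d} {s t : ℤ} {f : Fin d → ℤ}
    (hf : EdgeP N a b s t f) : mv f a (-s) ∈ NF N f ∧ ExtC N (mv f a (-s)) b := by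
  obtain ⟨hs, ht, hab, h1, h2, h3⟩ := hf
  have h5 : s * mv f a (-s) a = N := by rw [mv_self]; rcases hs with rfl | rfl <;> omega
  have h4 : ∀ i, i ≠ a → mv f a (-s) i = f i := fun i hi => mv_ne _ hi _
  have h4b := h4 b hab.symm
  have key : ∀ i, i ≠ b → -N ≤ mv f a (-s) i ∧ mv f a (-s) i ≤ N := by
    intro i hi
    by_cases hia : i = a
    · subst hia; rcases hs with rfl | rfl <;> omega
    · rw [h4 i hia]; exact h3 i hia hi
  refine ⟨⟨⟨fun i => ?_, fun i j hij h5 h6 => ?_⟩, adj_mv _ _ (by omega)⟩, ?_⟩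
  · by_cases hi : i = b
    · subst hi; rcases ht with rfl | rfl <;> omega
    · have := key i hi; omega
  · unfold ExtC at h5 h6
    by_cases hi : i = b
    · have := key j (fun e => hij (hi.trans e.symm)); omega
    · have := key i hi; omega
  · unfold ExtC; rcases ht with rfl | rfl <;> omega

theorem face_not_zr {d : ℕ} {N : ℤ} {a : Fin d} {s : ℤ} {f : Fin d → ℤ}
    (hf : FaceP N a s f) : f ∉ Zr d N := by
  intro h
  have h1 := h.1 a
  obtain ⟨hs, h2, -⟩ := hf
  rcases hs with rfl | rfl <;> omega

theorem fr_in {d : ℕ} {N : ℤ} (hN : 1 ≤ N) {z : Fin d → ℤ} (h : Fr N z) : z ∈ Binf d (N + 2) := by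
  rcases h with h | ⟨a, s, hs, h1, h2⟩ | ⟨a, b, s, t, hs, ht, hab, h1, h2, h3⟩
  · exact zr_in h
  · rw [mem_Binf]; intro i
    by_cases hi : i = a
    · subst hi; rcases hs with rfl | rfl <;> omega
    · have := h2 i hi; omega
  · rw [mem_Binf]; intro i
    by_cases hi : i = a
    · subst hi; rcases hs with rfl | rfl <;> omega
    · by_cases hi2 : i = b
      · subst hi2; rcases ht with rfl | rfl <;> omega
      · have := h3 i hi hi2; omega

structure Ent {d : ℕ} (N : ℤ) (X : Set (Fin d → ℤ)) (x0 f p q : Fin d → ℤ)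
    (K : Set (Fin d → ℤ)) : Prop where
  fX : f ∈ X
  fF : Fr N f
  fZ : f ∉ Zr d N
  pX : p ∈ X
  pF : ¬ Fr N p
  qX : q ∈ X
  pq : p ≠ q
  fp : Adj f p
  fq : Adj f q
  kX : ∀ u ∈ K, u ∈ X ∧ u ∈ Binf d (N + 2) ∧ ¬ Fr N u
  conn : Conn ((X \ Binf d (N + 2)) ∪ (K ∪ {f})) x0 f

theorem ent_exists {d : ℕ} {N : ℤ} (hN : 1 ≤ N) {X : Set (Fin d → ℤ)} {x0 e : Fin d → ℤ}
    (hc : Conn X x0 e) (hx0 : x0 ∉ Binf d (N + 2)) (he : e ∈ Zr d N) :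
    ∃ f p q K, Ent N X x0 f p q K := by
  obtain ⟨n, g, hg, hg0, hgn, hinj⟩ := hc.exists_path
  obtain ⟨m, hmn, hm, hmin⟩ := exists_first (P := fun i => Fr N (g i)) (n := n)
    (by show Fr N (g n); rw [hgn]; exact Or.inl he)
  have hm0 : m ≠ 0 := by
    rintro rfl
    rw [hg0] at hm; exact hx0 (fr_in hN hm)
  have hmZ : g m ∉ Zr d N := by
    intro h
    have h1 := hg.2 (m-1) (by omega)
    rw [show m - 1 + 1 = m by omega] at h1
    exact hmin (m-1) (by omega) (zr_nbr_fr hN h (adj_symm h1))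
  have hmn' : m < n := by
    rcases Nat.lt_or_ge m n with h | h
    · exact h
    · exfalso; apply hmZ; rw [show m = n by omega, hgn]; exact he
  refine ⟨g m, g (m-1), g (m+1), {z | ∃ i < m, z = g i ∧ z ∈ Binf d (N+2)}, ?_⟩
  refine ⟨hg.1 m hmn, hm, hmZ, hg.1 _ (by omega), hmin _ (by omega), hg.1 _ (by omega), ?_, ?_,
    hg.2 m hmn', ?_, ?_⟩
  · intro h
    have := hinj _ (by omega) _ (by omega) h
    omega
  · have h1 := hg.2 (m-1) (by omega)
    rw [show m - 1 + 1 = m by omega] at h1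
    exact adj_symm h1
  · rintro u ⟨i, hi, rfl, h2⟩
    exact ⟨hg.1 i (by omega), h2, hmin i hi⟩
  · have hw : IsWalk ((X \ Binf d (N + 2)) ∪ ({z | ∃ i < m, z = g i ∧ z ∈ Binf d (N+2)} ∪ {g m}))
        g m := by
      refine ⟨fun i hi => ?_, fun i hi => hg.2 i (by omega)⟩
      by_cases him : i = m
      · subst him; exact Or.inr (Or.inr rfl)
      · by_cases hA : g i ∈ Binf d (N+2)
        · exact Or.inr (Or.inl ⟨i, by omega, rfl, hA⟩)
        · exact Or.inl ⟨hg.1 i (by omega), hA⟩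
    have := hw.conn m le_rfl 0 (by omega)
    rwa [hg0] at this

theorem fin3 {d : ℕ} (hd : d = 2 ∨ d = 3) {a b c c' : Fin d} (hab : a ≠ b) (h1 : c ≠ a)
    (h2 : c ≠ b) (h3 : c' ≠ a) (h4 : c' ≠ b) : c = c' := by
  have := a.2; have := b.2; have := c.2; have := c'.2
  rw [Ne, Fin.ext_iff] at *
  omega

theorem Good.symm {d : ℕ} {N : ℤ} {H X Y : Set (Fin d → ℤ)} {x0 y0 : Fin d → ℤ}
    {KX KY : Set (Fin d → ℤ)} {fX fY pX pY : Fin d → ℤ} {PX PY : Set (Fin d → ℤ)}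
    (h : Good N H X Y x0 y0 KX KY fX fY pX pY PX PY) :
    Good N H Y X y0 x0 KY KX fY fX pY pX PY PX :=
  ⟨h.ky, h.kx, fun u hu v hv => ⟨fun e => (h.sepK v hv u hu).1 e.symm,
    fun e => (h.sepK v hv u hu).2 (adj_symm e)⟩, h.ny, h.nx, h.cy, h.cx, h.ay, h.ax, h.py, h.px,
    h.ey, h.ex, h.split.symm, h.nyp, h.nxp⟩

theorem good_of {d : ℕ} {N : ℤ} (hN : 1 ≤ N) {H X Y : Set (Fin d → ℤ)} (hY : Y ⊆ H)
    (hXH : ∀ u ∈ X, ∀ v ∈ H, Adj u v → v ∈ X) (hYH : ∀ u ∈ Y, ∀ v ∈ H, Adj u v → v ∈ Y)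
    (hXY : ∀ u ∈ X, u ∉ Y)
    {x0 y0 f p q g p' q' : Fin d → ℤ} {K K' F' : Set (Fin d → ℤ)}
    (eX : Ent N X x0 f p q K) (eY : Ent N Y y0 g p' q' K')
    (hF1 : ∀ u ∈ F', u ∈ Binf d (N + 2) ∧ u ∉ Zr d N)
    (hF2 : ∀ u ∈ F', ∀ v, v ∈ K' ∪ {g} → u ≠ v ∧ ¬ Adj u v)
    (hF3 : ∀ u ∈ F', ∀ v ∈ H, v ∉ Binf d (N + 2) → Adj u v → v ∈ X)
    {fX pX pY : Fin d → ℤ}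
    (hc : Conn ((X \ Binf d (N + 2)) ∪ (K ∪ F')) x0 fX)
    (ax : Adj fX pX) (ay : Adj g pY) (ex : ∃ i, ExtC N pX i) (ey : ∃ i, ExtC N pY i)
    (hreg : Reg N {z | ∃ u ∈ F', z ∈ NF N u} (NF N g) pX pY) :
    ∃ KX KY fX fY pX pY PX PY, Good N H X Y x0 y0 KX KY fX fY pX pY PX PY := by
  obtain ⟨PX, PY, hs, h1, h2, h3, h4⟩ := hreg
  have hsub : PX ⊆ Zr d N ∧ PY ⊆ Zr d N := by
    obtain ⟨b, s, h, hs, -, -, h3, h4, -⟩ := hs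
    exact ⟨h3.sub, h4.sub⟩
  have hYsub : ∀ u, u ∈ K' ∪ {g} → u ∈ Y := by
    rintro u (hu | rfl)
    · exact (eY.kX u hu).1
    · exact eY.fX
  refine ⟨K ∪ F', K' ∪ {g}, fX, g, pX, pY, PX, PY, ?_⟩
  refine ⟨?_, ?_, ?_, ?_, ?_, hc, eY.conn, ax, ay, h1, h2, ex, ey, hs, ?_, ?_⟩
  · rintro u (hu | hu)
    · exact ⟨(eX.kX u hu).2.1, fun h => (eX.kX u hu).2.2 (Or.inl h)⟩
    · exact hF1 u hu
  · rintro u (hu | rfl)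
    · exact ⟨(eY.kX u hu).2.1, fun h => (eY.kX u hu).2.2 (Or.inl h)⟩
    · exact ⟨fr_in hN eY.fF, eY.fZ⟩
  · rintro u (hu | hu) v hv
    · have hu' := (eX.kX u hu).1
      have hv' := hYsub v hv
      refine ⟨?_, fun ha => hXY v (hXH u hu' v (hY hv') ha) hv'⟩
      rintro rfl; exact hXY u hu' hv'
    · exact hF2 u hu v hv
  · rintro u (hu | hu) v hv hvA ha
    · exact hXH u (eX.kX u hu).1 v hv ha
    · exact hF3 u hu v hv hvA ha
  · intro u hu v hv _ ha
    exact hYH u (hYsub u hu) v hv ha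
  · rintro u (hu | hu) z hz ha
    · exact (eX.kX u hu).2.2 (zr_nbr_fr hN (hsub.2 hz) (adj_symm ha))
    · exact h3 z ⟨u, hu, hsub.2 hz, ha⟩ hz
  · rintro u (hu | rfl) z hz ha
    · exact (eY.kX u hu).2.2 (zr_nbr_fr hN (hsub.1 hz) (adj_symm ha))
    · exact h4 z ⟨hsub.1 hz, ha⟩ hz



/-! ### Geometry of the entry points -/

theorem reg_ff {d : ℕ} {N : ℤ} (hN : 1 ≤ N) {a a' : Fin d}
    {s s' : ℤ} {f g : Fin d → ℤ} (hf : FaceP N a s f) (hg : FaceP N a' s' g) (hne : f ≠ g)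
    (hna : ¬ Adj f g) : Reg N (NF N f) (NF N g) (mv f a (-s)) (mv g a' (-s')) := by
  obtain ⟨mf, ef⟩ := face_mem hN hf
  obtain ⟨mg, eg⟩ := face_mem hN hg
  have nf := fun z (hz : z ∈ NF N f) => face_nf hN hf hz
  have ng := fun z (hz : z ∈ NF N g) => face_nf hN hg hz
  obtain ⟨hs, f1, f2⟩ := hf
  obtain ⟨hs', g1, g2⟩ := hg
  by_cases hsame : a = a' ∧ s = s'
  · obtain ⟨rfl, rfl⟩ := hsame
    have hfa : f a = g a := by rcases hs with rfl | rfl <;> omega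
    by_cases hbig : ∃ y, y ≠ a ∧ (f y + 2 ≤ g y ∨ g y + 2 ≤ f y)
    · obtain ⟨y, hy, h⟩ := hbig
      have hfy := f2 y hy
      have hgy := g2 y hy
      have e1 : mv f a (-s) y = f y := mv_ne _ hy _
      have e2 : mv g a (-s) y = g y := mv_ne _ hy _
      rcases h with h | h
      · refine reg_plain y 1 (f y + 1) (Or.inl rfl) hN (by omega) (by omega) mf.1 mg.1 (by omega)
          (by omega) ?_ ?_
        · intro z hz; have := (nf z hz).2 y hy; omega
        · intro z hz; have := (ng z hz).2 y hy; omega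
      · refine reg_plain y (-1) (-(f y) + 1) (Or.inr rfl) hN (by omega) (by omega) mf.1 mg.1
          (by omega) (by omega) ?_ ?_
        · intro z hz; have := (nf z hz).2 y hy; omega
        · intro z hz; have := (ng z hz).2 y hy; omega
    · have hsm : ∀ y, y ≠ a → g y ≤ f y + 1 ∧ f y ≤ g y + 1 := by
        intro y hy
        by_contra hc
        exact hbig ⟨y, hy, by omega⟩
      have hy : ∃ y, f y ≠ g y := by
        by_contra hc; push Not at hc; exact hne (funext hc)
      obtain ⟨y, hy⟩ := hy
      have hya : y ≠ a := by rintro rfl; exact hy hfa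
      have hy' : ∃ y', y' ≠ y ∧ f y' ≠ g y' := by
        by_contra hc; push Not at hc
        have := hsm y hya
        exact hna (adj_of_coord y (by omega) (fun j hj => (hc j hj).symm))
      obtain ⟨y', hyy, hy'⟩ := hy'
      have hya' : y' ≠ a := by rintro rfl; exact hy' hfa
      have e1 : mv f a (-s) y = f y := mv_ne _ hya _
      have e2 : mv g a (-s) y = g y := mv_ne _ hya _
      have e3 : mv f a (-s) y' = f y' := mv_ne _ hya' _
      have e4 : mv g a (-s) y' = g y' := mv_ne _ hya' _
      have hfy := f2 y hya
      have hgy := g2 y hya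
      have hsy := hsm y hya
      have na1 : ¬ Adj (mv g a (-s)) (mv f a (-s)) := by
        intro h; rcases adj_two h hyy with h | h <;> omega
      have m1 : mv f a (-s) ∉ NF N g := by
        intro h; have := (ng _ h).2 y hya; omega
      have m2 : mv g a (-s) ∉ NF N f := by
        intro h; have := (nf _ h).2 y hya; omega
      -- signed version
      obtain ⟨t, ht, hty⟩ : ∃ t : ℤ, (t = 1 ∨ t = -1) ∧ t * g y = t * f y + 1 := by
        rcases lt_or_gt_of_ne hy with h | h
        · exact ⟨1, Or.inl rfl, by omega⟩
        · exact ⟨-1, Or.inr rfl, by omega⟩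
      by_cases hlow : -N < t * f y
      · refine reg_bump y t (t * f y) ht hN hlow (by rcases ht with rfl | rfl <;> omega) mf.1 mg.1
          (by rw [e1]) (by rw [e2]; omega) ⟨a, hya.symm, ef⟩ na1 ?_ ?_ m1
        · intro z hz; rw [(nf z hz).2 y hya]
        · intro z hz; rw [(ng z hz).2 y hya]; omega
      · apply Reg.symm
        refine reg_bump y (-t) (-t * g y) (by omega) hN ?_ ?_ mg.1 mf.1
          (by rw [e2]) ?_ ⟨a, hya.symm, eg⟩ (fun h => na1 (adj_symm h)) ?_ ?_ m2
        · rcases ht with rfl | rfl <;> omega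
        · rcases ht with rfl | rfl <;> omega
        · rw [e1]; rcases ht with rfl | rfl <;> omega
        · intro z hz; rw [(ng z hz).2 y hya]
        · intro z hz; rw [(nf z hz).2 y hya]; rcases ht with rfl | rfl <;> omega
  · have hlev : ∀ z ∈ NF N f, s' * z a' ≤ N := by
      intro z hz
      obtain ⟨h1, h2⟩ := nf z hz
      by_cases haa : a' = a
      · subst haa
        have : s ≠ s' := fun e => hsame ⟨rfl, e⟩
        rcases hs with rfl | rfl <;> rcases hs' with rfl | rfl <;> omega
      · rw [h2 a' haa]; have := f2 a' haa
        rcases hs' with rfl | rfl <;> omega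
    refine reg_cap a' s' hs' hN mf.1 mg.1 (ng _ mg).1 ⟨a, ef⟩ mf hlev ?_ ?_
    · intro z hz; rw [(ng z hz).1]; omega
    · intro h; have h1 := hlev _ mf; have h2 := (ng _ h).1; omega

theorem reg_ee {d : ℕ} (hd : d = 2 ∨ d = 3) {N : ℤ} (hN : 1 ≤ N) {a b a' b' : Fin d}
    {s t s' t' : ℤ} {f g : Fin d → ℤ} (hf : EdgeP N a b s t f) (hg : EdgeP N a' b' s' t' g)
    (hne : f ≠ g)
    (hna : ¬ Adj f g) : ∃ pC ∈ NF N f, ∃ pD ∈ NF N g, (∃ i, ExtC N pC i) ∧ (∃ i, ExtC N pD i) ∧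
      Reg N (NF N f) (NF N g) pC pD := by
  obtain ⟨mf, ef⟩ := edge_mem hN hf
  obtain ⟨mf', ef'⟩ := edge_mem hN hf.symm
  have nf := fun z (hz : z ∈ NF N f) => edge_nf hN hf hz
  have cap : ∀ (a' b' : Fin d) (s' t' : ℤ), EdgeP N a' b' s' t' g → s' * f a' ≤ N →
      ∃ pC ∈ NF N f, ∃ pD ∈ NF N g, (∃ i, ExtC N pC i) ∧ (∃ i, ExtC N pD i) ∧
      Reg N (NF N f) (NF N g) pC pD := by
    intro a' b' s' t' hg hle
    obtain ⟨mg, eg⟩ := edge_mem hN hg.symm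
    have ng := fun z (hz : z ∈ NF N g) => edge_nf hN hg hz
    have hlevf : ∀ z ∈ NF N f, s' * z a' ≤ N := by
      intro z hz
      obtain ⟨hs, ht, hab, f1, f2, f3⟩ := hf
      have hs' := hg.1
      rcases nf z hz with ⟨h1, h2⟩ | ⟨h1, h2⟩
      · by_cases haa : a' = a
        · subst haa; rcases hs with rfl | rfl <;> rcases hs' with rfl | rfl <;> omega
        · rw [h2 a' haa]; exact hle
      · by_cases haa : a' = b
        · subst haa; rcases ht with rfl | rfl <;> rcases hs' with rfl | rfl <;> omega
        · rw [h2 a' haa]; exact hle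
    have hlevg : ∀ z ∈ NF N g, (s' * z a' = N ∧ ∀ i, i ≠ a' → z i = g i) ∨ s' * z a' = N + 1 := by
      intro z hz
      rcases ng z hz with h | ⟨h1, h2⟩
      · exact Or.inl h
      · right; rw [h2 a' hg.2.2.1]; exact hg.2.2.2.1
    have hpDl : s' * mv g b' (-t') a' = N + 1 := by
      rw [mv_ne _ hg.2.2.1]; exact hg.2.2.2.1
    have fin : ∀ pC ∈ NF N f, (∃ i, ExtC N pC i) → pC ∉ NF N g →
        ∃ pC ∈ NF N f, ∃ pD ∈ NF N g, (∃ i, ExtC N pC i) ∧ (∃ i, ExtC N pD i) ∧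
      Reg N (NF N f) (NF N g) pC pD := by
      intro pC h1 h2 h3
      refine ⟨pC, h1, _, mg, h2, ⟨_, eg⟩, reg_cap a' s' hg.1 hN h1.1 mg.1 hpDl h2 h1 hlevf ?_ h3⟩
      intro z hz; rcases hlevg z hz with h | h <;> omega
    by_cases h1 : mv f a (-s) ∈ NF N g
    · by_cases h2 : mv f b (-t) ∈ NF N g
      · exfalso
        have l1 := hlevf _ mf
        have l2 := hlevf _ mf'
        rcases hlevg _ h1 with ⟨q1, q2⟩ | q1
        · rcases hlevg _ h2 with ⟨q3, q4⟩ | q3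
          · have : mv f a (-s) a = mv f b (-t) a := by
              by_cases haa : a = a'
              · subst haa; rcases hg.1 with rfl | rfl <;> omega
              · rw [q2 a haa, q4 a haa]
            rw [mv_self, mv_ne _ hf.2.2.1] at this
            rcases hf.1 with h | h <;> omega
          · omega
        · omega
      · exact fin _ mf' ⟨_, ef'⟩ h2
    · exact fin _ mf ⟨_, ef⟩ h1
  by_cases c1 : s' * f a' ≤ N
  · exact cap a' b' s' t' hg c1
  by_cases c2 : t' * f b' ≤ N
  · exact cap b' a' t' s' hg.symm c2
  obtain ⟨mg, eg⟩ := edge_mem hN hg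
  have ng := fun z (hz : z ∈ NF N g) => edge_nf hN hg hz
  obtain ⟨hs, ht, hab, f1, f2, f3⟩ := hf
  obtain ⟨hs', ht', hab', g1, g2, g3⟩ := hg
  have hin : ∀ i, (f i > N ∨ f i < -N) → i = a ∨ i = b := by
    intro i hi
    by_contra hc; push Not at hc
    have := f3 i hc.1 hc.2; omega
  have ha' := hin a' (by rcases hs' with rfl | rfl <;> omega)
  have hb' := hin b' (by rcases ht' with rfl | rfl <;> omega)
  have hset : (a' = a ∧ b' = b) ∨ (a' = b ∧ b' = a) := by
    rcases ha' with h | h <;> rcases hb' with h' | h'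
    · exact absurd (h.trans h'.symm) hab'
    · exact Or.inl ⟨h, h'⟩
    · exact Or.inr ⟨h, h'⟩
    · exact absurd (h.trans h'.symm) hab'
  have hfg : f a = g a ∧ f b = g b := by
    rcases hset with ⟨rfl, rfl⟩ | ⟨rfl, rfl⟩
    · constructor
      · rcases hs with rfl | rfl <;> rcases hs' with rfl | rfl <;> omega
      · rcases ht with rfl | rfl <;> rcases ht' with rfl | rfl <;> omega
    · constructor
      · rcases hs with rfl | rfl <;> rcases ht' with rfl | rfl <;> omega
      · rcases ht with rfl | rfl <;> rcases hs' with rfl | rfl <;> omega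
  have hy : ∃ y, f y ≠ g y := by
    by_contra hc; push Not at hc; exact hne (funext hc)
  obtain ⟨y, hy⟩ := hy
  have hya : y ≠ a := by rintro rfl; exact hy hfg.1
  have hyb : y ≠ b := by rintro rfl; exact hy hfg.2
  have hya' : y ≠ a' := by rcases hset with ⟨rfl, rfl⟩ | ⟨rfl, rfl⟩ <;> assumption
  have hyb' : y ≠ b' := by rcases hset with ⟨rfl, rfl⟩ | ⟨rfl, rfl⟩ <;> assumption
  have hfar : f y + 2 ≤ g y ∨ g y + 2 ≤ f y := by
    by_contra hc
    apply hna
    refine adj_of_coord y (by omega) (fun j hj => ?_)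
    by_cases hja : j = a
    · rw [hja]; exact hfg.1.symm
    · by_cases hjb : j = b
      · rw [hjb]; exact hfg.2.symm
      · exact absurd (fin3 hd hab hja hjb hya hyb) hj
  have lf : ∀ z ∈ NF N f, z y = f y := by
    intro z hz
    rcases nf z hz with ⟨-, h⟩ | ⟨-, h⟩
    · exact h y hya
    · exact h y hyb
  have lg : ∀ z ∈ NF N g, z y = g y := by
    intro z hz
    rcases ng z hz with ⟨-, h⟩ | ⟨-, h⟩
    · exact h y hya'
    · exact h y hyb'
  have b1 := f3 y hya hyb
  have b2 := g3 y hya' hyb'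
  refine ⟨_, mf, _, mg, ⟨_, ef⟩, ⟨_, eg⟩, ?_⟩
  have l1 := lf _ mf
  have l2 := lg _ mg
  rcases hfar with h | h
  · refine reg_plain y 1 (f y + 1) (Or.inl rfl) hN (by omega) (by omega) mf.1 mg.1 (by omega)
      (by omega) ?_ ?_
    · intro z hz; have := lf z hz; omega
    · intro z hz; have := lg z hz; omega
  · refine reg_plain y (-1) (-(f y) + 1) (Or.inr rfl) hN (by omega) (by omega) mf.1 mg.1
      (by omega) (by omega) ?_ ?_
    · intro z hz; have := lf z hz; omega
    · intro z hz; have := lg z hz; omega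

/-- Face/edge, the generic capping: a set of face points on side `a` attaches. -/
theorem reg_fe {d : ℕ} {N : ℤ} (hN : 1 ≤ N) {a a' b' : Fin d}
    {s s' t' : ℤ} {g : Fin d → ℤ} {F' : Set (Fin d → ℤ)} (hF : ∀ u ∈ F', FaceP N a s u)
    (hg : EdgeP N a' b' s' t' g) (hdiff : ¬ (a = b' ∧ s = t')) {f : Fin d → ℤ} (hf : f ∈ F')
    (hnot : mv f a (-s) ∉ NF N g) :
    Reg N {z | ∃ u ∈ F', z ∈ NF N u} (NF N g) (mv f a (-s)) (mv g a' (-s')) := by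
  obtain ⟨mf, ef⟩ := face_mem hN (hF f hf)
  obtain ⟨mg, eg⟩ := edge_mem hN hg
  have hl : t' * mv g a' (-s') b' = N + 1 := by
    rw [mv_ne _ hg.2.2.1.symm]; exact hg.2.2.2.2.1
  refine reg_cap b' t' hg.2.1 hN mf.1 mg.1 hl ⟨a, ef⟩ ⟨f, hf, mf⟩ ?_ ?_ hnot
  · rintro z ⟨u, hu, hz⟩
    obtain ⟨h1, h2⟩ := face_nf hN (hF u hu) hz
    obtain ⟨hs, f1, f2⟩ := hF u hu
    have ht := hg.2.1
    by_cases hab : b' = a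
    · subst hab
      have : s ≠ t' := fun e => hdiff ⟨rfl, e⟩
      rcases hs with rfl | rfl <;> rcases ht with rfl | rfl <;> omega
    · rw [h2 b' hab]; have := f2 b' hab; rcases ht with rfl | rfl <;> omega
  · intro z hz
    rcases edge_nf hN hg hz with ⟨h1, h2⟩ | ⟨h1, h2⟩
    · rw [h2 b' hg.2.2.1.symm, hg.2.2.2.2.1]; omega
    · omega



theorem good_fe {d : ℕ} (hd : d = 2 ∨ d = 3) {N : ℤ} (hN : 2 ≤ N) {H X Y : Set (Fin d → ℤ)}
    (hX : X ⊆ H) (hY : Y ⊆ H)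
    (hXH : ∀ u ∈ X, ∀ v ∈ H, Adj u v → v ∈ X) (hYH : ∀ u ∈ Y, ∀ v ∈ H, Adj u v → v ∈ Y)
    (hXY : ∀ u ∈ X, u ∉ Y)
    {x0 y0 f p q g p' q' : Fin d → ℤ} {K K' : Set (Fin d → ℤ)}
    (eX : Ent N X x0 f p q K) (eY : Ent N Y y0 g p' q' K') {a a' b' : Fin d} {s s' t' : ℤ}
    (hf : FaceP N a s f) (hg : EdgeP N a' b' s' t' g) (hdiff : ¬ (a = b' ∧ s = t')) :
    ∃ KX KY fX fY pX pY PX PY, Good N H X Y x0 y0 KX KY fX fY pX pY PX PY := by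
  have hN1 : 1 ≤ N := by omega
  obtain ⟨mg, eg⟩ := edge_mem hN1 hg
  have nadj : ∀ u ∈ X, ∀ v ∈ Y, u ≠ v ∧ ¬ Adj u v := by
    intro u hu v hv
    refine ⟨fun e => hXY u hu (e ▸ hv), fun ha => hXY v (hXH u hu v (hY hv) ha) hv⟩
  have hYsub : ∀ u, u ∈ K' ∪ {g} → u ∈ Y := by
    rintro u (hu | rfl)
    · exact (eY.kX u hu).1
    · exact eY.fX
  -- all-in-X version
  have inX : ∀ F' : Set (Fin d → ℤ), f ∈ F' → F' ⊆ X → (∀ u ∈ F', FaceP N a s u) → ∀ f' ∈ F',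
      (f' = f ∨ Adj f f') → mv f' a (-s) ∉ NF N g →
      ∃ KX KY fX fY pX pY PX PY, Good N H X Y x0 y0 KX KY fX fY pX pY PX PY := by
    intro F' hfF hFX hF f' hf' hff hnot
    obtain ⟨mf, ef⟩ := face_mem hN1 (hF f' hf')
    have hc0 : Conn ((X \ Binf d (N + 2)) ∪ (K ∪ F')) x0 f := eX.conn.mono (by
      rintro z (hz | hz | rfl)
      · exact Or.inl hz
      · exact Or.inr (Or.inl hz)
      · exact Or.inr (Or.inr hfF))
    refine good_of hN1 hY hXH hYH hXY eX eY (F' := F') (fX := f') ?_ ?_ ?_ ?_ mf.2 mg.2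
      ⟨_, ef⟩ ⟨_, eg⟩ (reg_fe hN1 hF hg hdiff hf' hnot)
    · intro u hu
      exact ⟨fr_in hN1 (Or.inr (Or.inl ⟨a, s, hF u hu⟩)), face_not_zr (hF u hu)⟩
    · intro u hu v hv; exact nadj u (hFX hu) v (hYsub v hv)
    · intro u hu v hv _ ha; exact hXH u (hFX hu) v hv ha
    · rcases hff with rfl | hff
      · exact hc0
      · exact hc0.tail hff (Or.inr (Or.inr hf'))
  by_cases hT : mv f a (-s) ∉ NF N g
  · refine inX {f} rfl ?_ ?_ f rfl (Or.inl rfl) hT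
    · rintro u rfl; exact eX.fX
    · rintro u rfl; exact hf
  rw [not_not] at hT
  -- the exceptional case
  have fz : ∀ i, i ≠ a → mv f a (-s) i = f i := fun i hi => mv_ne _ hi _
  have fza : mv f a (-s) a = f a - s := by rw [mv_self]; ring
  obtain ⟨hs, f1, f2⟩ := id hf
  obtain ⟨hs', ht', hab', g1, g2, g3⟩ := id hg
  have hzg : t' * mv f a (-s) b' = N ∧ ∀ i, i ≠ b' → mv f a (-s) i = g i := by
    rcases edge_nf hN1 hg hT with ⟨h1, h2⟩ | h
    · exfalso
      have h3 := h2 b' hab'.symm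
      by_cases hba : b' = a
      · subst hba
        have : s ≠ t' := fun e => hdiff ⟨rfl, e⟩
        rcases hs with rfl | rfl <;> rcases ht' with rfl | rfl <;> omega
      · rw [fz b' hba] at h3
        have := f2 b' hba
        rcases ht' with rfl | rfl <;> omega
    · exact h
  obtain ⟨z1, z2⟩ := hzg
  have haa : a' = a := by
    by_contra hne
    have h1 := z2 a' hab'
    rw [fz a' hne] at h1
    have := f2 a' hne
    rcases hs' with rfl | rfl <;> omega
  subst haa
  have hb'a : b' ≠ a' := hab'.symm
  rw [fz b' hb'a] at z1
  have hga := z2 a' hab'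
  rw [fza] at hga
  have hss : s' = s := by
    rcases hs with rfl | rfl <;> rcases hs' with rfl | rfl <;> omega
  subst hss
  have hoth : ∀ i, i ≠ a' → i ≠ b' → f i = g i := fun i h1 h2 => by rw [← z2 i h2, fz i h1]
  have nX1 : mv f b' t' ∉ X := by
    intro h
    refine (nadj _ h g eY.fX).2 (adj_of_coord a' ?_ ?_)
    · rw [mv_ne _ hab']; omega
    · intro j hj
      by_cases hjb : j = b'
      · subst hjb; rw [mv_self]; rcases ht' with rfl | rfl <;> omega
      · rw [mv_ne _ hjb]; exact (hoth j hj hjb).symm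
  have nX2 : mv f a' (-s') ∉ X := fun h => (nadj _ h g eY.fX).2 (adj_symm hT.2)
  -- faces near f
  have faceOf : ∀ i e, i ≠ a' → -N ≤ f i + e → f i + e ≤ N → FaceP N a' s' (mv f i e) := by
    intro i e hi h1 h2
    refine ⟨hs, by rw [mv_ne _ hi.symm]; exact f1, fun j hj => ?_⟩
    by_cases hji : j = i
    · subst hji; rw [mv_self]; exact ⟨h1, h2⟩
    · rw [mv_ne _ hji]; exact f2 j hj
  have cls : ∀ v ∈ X, Adj f v → FaceP N a' s' v ∨ v = mv f a' s' ∨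
      ∃ c e, c ≠ a' ∧ c ≠ b' ∧ (e = 1 ∨ e = -1) ∧ e * f c = N ∧ v = mv f c e := by
    intro v hv ha
    obtain ⟨i, e, he, rfl⟩ := (adj_iff _ _).1 ha
    by_cases hia : i = a'
    · subst hia
      by_cases hes : e = s'
      · subst hes; exact Or.inr (Or.inl rfl)
      · have : e = -s' := by omega
        subst this; exact absurd hv nX2
    by_cases hib : i = b'
    · subst hib
      by_cases het : e = t'
      · subst het; exact absurd hv nX1
      · left; apply faceOf i e hia <;> rcases ht' with rfl | rfl <;> omega
    by_cases hE : e * f i = N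
    · exact Or.inr (Or.inr ⟨i, e, hia, hib, he, hE, rfl⟩)
    · left
      have := f2 i hia
      apply faceOf i e hia <;> rcases he with rfl | rfl <;> omega
  have notND : ∀ u, FaceP N a' s' u → u ≠ f → mv u a' (-s') ∉ NF N g := by
    intro u hu hne hmem
    have hlev : mv u a' (-s') b' = u b' := mv_ne _ hb'a _
    have hub := hu.2.2 b' hb'a
    rcases edge_nf hN1 hg hmem with ⟨h1, h2⟩ | ⟨h1, h2⟩
    · have := h2 b' hb'a
      rw [hlev] at this; rcases ht' with rfl | rfl <;> omega
    · apply hne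
      funext i
      by_cases hib : i = b'
      · subst hib
        rw [hlev] at h1
        rcases ht' with rfl | rfl <;> omega
      · have h3 := h2 i hib
        have h4 := z2 i hib
        by_cases hia : i = a'
        · subst hia; rw [mv_self] at h3 h4; omega
        · rw [mv_ne _ hia] at h3 h4; omega
  have pcl := cls p eX.pX eX.fp
  have qcl := cls q eX.qX eX.fq
  have pnf : ¬ FaceP N a' s' p := fun h => eX.pF (Or.inr (Or.inl ⟨a', s', h⟩))
  by_cases hqF : FaceP N a' s' q
  · have hqf : q ≠ f := (adj_ne eX.fq).symm
    refine inX {f, q} (Or.inl rfl) ?_ ?_ q (Or.inr rfl) (Or.inr eX.fq) (notND q hqF hqf)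
    · rintro u (rfl | rfl)
      · exact eX.fX
      · exact eX.qX
    · rintro u (rfl | rfl)
      · exact hf
      · exact hqF
  have both : mv f a' s' ∈ X ∧ ∃ c e, c ≠ a' ∧ c ≠ b' ∧ (e = 1 ∨ e = -1) ∧ e * f c = N ∧
      mv f c e ∈ X := by
    rcases pcl with h | h | ⟨c, e, h1, h2, h3, h4, h5⟩
    · exact absurd h pnf
    · rcases qcl with h' | h' | ⟨c, e, h1, h2, h3, h4, h5⟩
      · exact absurd h' hqF
      · exact absurd (h.trans h'.symm) eX.pq
      · exact ⟨h ▸ eX.pX, c, e, h1, h2, h3, h4, h5 ▸ eX.qX⟩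
    · rcases qcl with h' | h' | ⟨c', e', k1, k2, k3, k4, k5⟩
      · exact absurd h' hqF
      · exact ⟨h' ▸ eX.qX, c, e, h1, h2, h3, h4, h5 ▸ eX.pX⟩
      · exfalso
        obtain rfl : c = c' := fin3 hd hab' h1 h2 k1 k2
        have : e = e' := by rcases h3 with rfl | rfl <;> rcases k3 with rfl | rfl <;> omega
        subst this
        exact eX.pq (h5.trans k5.symm)
  obtain ⟨oX, c, ec, hca, hcb, hec, hfc, cX⟩ := both
  have hq0F : FaceP N a' s' (mv f b' (-t')) := by
    apply faceOf b' (-t') hb'a <;> rcases ht' with rfl | rfl <;> omega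
  set q0 := mv f b' (-t') with hq0
  have hfq0 : Adj f q0 := adj_mv _ _ (by omega)
  have hF : ∀ u ∈ ({f, q0} : Set (Fin d → ℤ)), FaceP N a' s' u := by
    rintro u (rfl | rfl)
    · exact hf
    · exact hq0F
  obtain ⟨mq, eq⟩ := face_mem hN1 hq0F
  have hq0b : q0 b' = f b' - t' := by rw [hq0, mv_self]; ring
  have hq0i : ∀ i, i ≠ b' → q0 i = f i := fun i hi => mv_ne _ hi _
  refine good_of hN1 hY hXH hYH hXY eX eY (F' := {f, q0}) (fX := q0) ?_ ?_ ?_ ?_ mq.2 mg.2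
      ⟨_, eq⟩ ⟨_, eg⟩ (reg_fe hN1 hF hg hdiff (Or.inr rfl) (notND q0 hq0F (adj_ne hfq0).symm))
  · intro u hu
    exact ⟨fr_in hN1 (Or.inr (Or.inl ⟨_, _, hF u hu⟩)), face_not_zr (hF u hu)⟩
  · rintro u (rfl | rfl) v hv
    · exact nadj u eX.fX v (hYsub v hv)
    · have hvA : v ∈ Binf d (N + 2) ∧ v ∉ Zr d N ∧ ¬ FaceP N a' s' v := by
        rcases hv with hv | rfl
        · exact ⟨(eY.kX v hv).2.1, fun h => (eY.kX v hv).2.2 (Or.inl h),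
            fun h => (eY.kX v hv).2.2 (Or.inr (Or.inl ⟨_, _, h⟩))⟩
        · refine ⟨fr_in hN1 eY.fF, eY.fZ, fun h => ?_⟩
          have := h.2.1; omega
      have hvY := hYsub v hv
      refine ⟨fun e => hvA.2.2 (e ▸ hq0F), fun ha => ?_⟩
      obtain ⟨i, e, he, rfl⟩ := (adj_iff _ _).1 ha
      by_cases hia : i = a'
      · subst hia
        by_cases hes : e = s'
        · subst hes
          have h1 := mem_Binf.1 hvA.1 i
          rw [mv_self, hq0i i hab'] at h1
          rcases hs with rfl | rfl <;> omega
        · have : e = -s' := by omega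
          subst this; exact hvA.2.1 mq.1
      by_cases hib : i = b'
      · subst hib
        by_cases het : e = t'
        · subst het
          have : mv q0 i e = f := by rw [hq0, mv_mv]; simp [mv_zero]
          rw [this] at hvY; exact hXY f eX.fX hvY
        · apply hvA.2.2
          have : mv q0 i e = mv f i (-t' + e) := by rw [hq0, mv_mv]
          rw [this]
          apply faceOf i _ hia <;> rcases ht' with rfl | rfl <;> omega
      obtain rfl : i = c := fin3 hd hab' hia hib hca hcb
      by_cases hee : e = ec
      · subst hee
        refine (nadj _ cX _ hvY).2 (adj_of_coord b' ?_ ?_)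
        · rw [mv_ne _ hcb.symm, mv_ne _ hcb.symm, hq0b]; omega
        · intro j hj
          by_cases hji : j = i
          · subst hji; rw [mv_self, mv_self, hq0i j hj]
          · rw [mv_ne _ hji, mv_ne _ hji, hq0i j hj]
      · apply hvA.2.2
        refine ⟨hs, by rw [mv_ne _ (fun h => hia h.symm)]; exact hq0F.2.1, fun j hj => ?_⟩
        by_cases hji : j = i
        · subst hji; rw [mv_self, hq0i j hib]
          rcases he with rfl | rfl <;> rcases hec with rfl | rfl <;> omega
        · rw [mv_ne _ hji]; exact hq0F.2.2 j hj
  · rintro u (rfl | rfl) v hv hvA ha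
    · exact hXH u eX.fX v hv ha
    · have hvA' := not_mem_Binf.1 hvA
      obtain ⟨i, e, he, rfl⟩ := (adj_iff _ _).1 ha
      obtain ⟨k, hk⟩ := hvA'
      have hka : k = a' ∧ i = a' := by
        by_cases hki : k = i
        · refine ⟨?_, ?_⟩ <;> by_contra hne
          · rw [hki, mv_self] at hk
            have := hq0F.2.2 i (hki ▸ hne); omega
          · rw [hki, mv_self] at hk
            have := hq0F.2.2 i hne; omega
        · exfalso
          rw [mv_ne _ hki] at hk
          by_cases hka : k = a'
          · have h9 := hq0F.2.1; rw [← hka] at h9; rcases hs with rfl | rfl <;> omega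
          · have := hq0F.2.2 k hka; omega
      obtain ⟨rfl, rfl⟩ := hka
      have hes : e = s' := by
        rw [mv_self] at hk
        have := hq0F.2.1
        rcases hs with rfl | rfl <;> omega
      subst hes
      refine hXH _ oX _ hv (adj_of_coord b' ?_ ?_)
      · rw [mv_ne _ hb'a, mv_ne _ hb'a, hq0b]; omega
      · intro j hj
        by_cases hji : j = i
        · subst hji; rw [mv_self, mv_self, hq0i j hj]
        · rw [mv_ne _ hji, mv_ne _ hji, hq0i j hj]
  · have hc0 : Conn ((X \ Binf d (N + 2)) ∪ (K ∪ {f, q0})) x0 f := eX.conn.mono (by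
      rintro z (hz | hz | rfl)
      · exact Or.inl hz
      · exact Or.inr (Or.inl hz)
      · exact Or.inr (Or.inr (Or.inl rfl)))
    exact hc0.tail hfq0 (Or.inr (Or.inr (Or.inr rfl)))

theorem good_fe' {d : ℕ} (hd : d = 2 ∨ d = 3) {N : ℤ} (hN : 2 ≤ N) {H X Y : Set (Fin d → ℤ)}
    (hX : X ⊆ H) (hY : Y ⊆ H)
    (hXH : ∀ u ∈ X, ∀ v ∈ H, Adj u v → v ∈ X) (hYH : ∀ u ∈ Y, ∀ v ∈ H, Adj u v → v ∈ Y)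
    (hXY : ∀ u ∈ X, u ∉ Y)
    {x0 y0 f p q g p' q' : Fin d → ℤ} {K K' : Set (Fin d → ℤ)}
    (eX : Ent N X x0 f p q K) (eY : Ent N Y y0 g p' q' K') {a a' b' : Fin d} {s s' t' : ℤ}
    (hf : FaceP N a s f) (hg : EdgeP N a' b' s' t' g) :
    ∃ KX KY fX fY pX pY PX PY, Good N H X Y x0 y0 KX KY fX fY pX pY PX PY := by
  by_cases h : a = b' ∧ s = t'
  · refine good_fe hd hN hX hY hXH hYH hXY eX eY hf hg.symm ?_
    rintro ⟨h1, -⟩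
    exact hg.2.2.1 (h1.symm.trans h.1)
  · exact good_fe hd hN hX hY hXH hYH hXY eX eY hf hg h

theorem geo {d : ℕ} (hd : d = 2 ∨ d = 3) {N : ℤ} (hN : 2 ≤ N) {H X Y : Set (Fin d → ℤ)}
    (hX : X ⊆ H) (hY : Y ⊆ H)
    (hXH : ∀ u ∈ X, ∀ v ∈ H, Adj u v → v ∈ X) (hYH : ∀ u ∈ Y, ∀ v ∈ H, Adj u v → v ∈ Y)
    (hXY : ∀ u ∈ X, u ∉ Y)
    {x0 y0 f p q g p' q' : Fin d → ℤ} {K K' : Set (Fin d → ℤ)}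
    (eX : Ent N X x0 f p q K) (eY : Ent N Y y0 g p' q' K') :
    ∃ KX KY fX fY pX pY PX PY, Good N H X Y x0 y0 KX KY fX fY pX pY PX PY := by
  have hN1 : 1 ≤ N := by omega
  have nadj : ∀ u ∈ X, ∀ v ∈ Y, u ≠ v ∧ ¬ Adj u v := by
    intro u hu v hv
    refine ⟨fun e => hXY u hu (e ▸ hv), fun ha => hXY v (hXH u hu v (hY hv) ha) hv⟩
  have hfg := nadj f eX.fX g eY.fX
  have std : ∀ pC ∈ NF N f, ∀ pD ∈ NF N g, (∃ i, ExtC N pC i) → (∃ i, ExtC N pD i) →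
      Reg N (NF N f) (NF N g) pC pD →
      ∃ KX KY fX fY pX pY PX PY, Good N H X Y x0 y0 KX KY fX fY pX pY PX PY := by
    intro pC hC pD hD e1 e2 hreg
    refine good_of hN1 hY hXH hYH hXY eX eY (F' := {f}) (fX := f) ?_ ?_ ?_ eX.conn hC.2 hD.2 e1 e2 ?_
    · rintro u rfl; exact ⟨fr_in hN1 eX.fF, eX.fZ⟩
    · rintro u rfl v hv
      refine nadj u eX.fX v ?_
      rcases hv with hv | rfl
      · exact (eY.kX v hv).1
      · exact eY.fX
    · rintro u rfl v hv _ ha; exact hXH u eX.fX v hv ha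
    · have : {z | ∃ u ∈ ({f} : Set (Fin d → ℤ)), z ∈ NF N u} = NF N f := by ext z; simp
      rw [this]; exact hreg
  rcases eX.fF with h | ⟨a, s, hf⟩ | ⟨a, b, s, t, hf⟩
  · exact absurd h eX.fZ
  · rcases eY.fF with h | ⟨a', s', hg⟩ | ⟨a', b', s', t', hg⟩
    · exact absurd h eY.fZ
    · obtain ⟨mf, ef⟩ := face_mem hN1 hf
      obtain ⟨mg, eg⟩ := face_mem hN1 hg
      exact std _ mf _ mg ⟨_, ef⟩ ⟨_, eg⟩ (reg_ff hN1 hf hg hfg.1 hfg.2)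
    · exact good_fe' hd hN hX hY hXH hYH hXY eX eY hf hg
  · rcases eY.fF with h | ⟨a', s', hg⟩ | ⟨a', b', s', t', hg⟩
    · exact absurd h eY.fZ
    · obtain ⟨KX, KY, fX, fY, pX, pY, PX, PY, hgood⟩ :=
        good_fe' hd hN hY hX hYH hXH (fun u h1 h2 => hXY u h2 h1) eY eX hg hf
      exact ⟨_, _, _, _, _, _, _, _, hgood.symm⟩
    · obtain ⟨pC, h1, pD, h2, h3, h4, h5⟩ := reg_ee hd hN1 hf hg hfg.1 hfg.2
      exact std pC h1 pD h2 h3 h4 h5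

/-- The combinatorial lemma. -/
theorem comb {d : ℕ} (hd : d = 2 ∨ d = 3) {ω E : Set (Fin d → ℤ)} {r : ℤ}
    (hr : 1 ≤ r) (hE : E ⊆ Binf d r)
    (h1 : ¬ HasDoublyInfinitePath ω) (h2 : HasDoublyInfinitePath (ω ∪ E)) :
    ∃ R : ℤ, 1 ≤ R ∧ ∀ (H : Set (Fin d → ℤ)) (o : Fin d → ℤ) (Tgt : Set (Fin d → ℤ)),
      o ∉ Binf d R → (∀ t ∈ Tgt, t ∉ Binf d R) → (0 : Fin d → ℤ) ∉ H →
      (∃ t ∈ Tgt, Conn (insert 0 H) o t) → (¬ ∃ t ∈ Tgt, Conn H o t) →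
      ∃ w ∈ Binf d R, ∃ K ⊆ Binf d R,
        (¬ ∃ t ∈ Tgt, Conn ((H \ Binf d R) ∪ K) o t) ∧
        (∃ t ∈ Tgt, Conn ((H \ Binf d R) ∪ K ∪ {z | z - w ∈ E}) o t) ∧
        ∀ z, z - w ∈ Binf d r → (z ∈ (H \ Binf d R) ∪ K ↔ z - w ∈ ω) := by
  obtain ⟨L, hgad⟩ := gadget_exists hE h1 h2
  have hd0 : 0 < d := by omega
  have hLr : 1 ≤ L ∧ r ≤ L := by
    obtain ⟨G, x, y, hG⟩ := hgad ⟨0, hd0⟩ 1 (Or.inl rfl)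
    exact ⟨hG.hL, hG.hrL⟩
  refine ⟨2 * L + 5 + 2, by omega, ?_⟩
  set N := 2 * L + 5 with hNdef
  have hN : 2 ≤ N := by omega
  intro H o Tgt ho hTgt h0 hcon hncon
  obtain ⟨t, ht, hct⟩ := hcon
  have h0A : (0 : Fin d → ℤ) ∈ Binf d (N + 2) := by rw [mem_Binf]; intro i; simp; omega
  have h0Z : (0 : Fin d → ℤ) ∈ Zr d N := by
    refine ⟨fun i => by simp; omega, fun i _ _ h => ?_⟩
    unfold ExtC at h; simp at h; omega
  have hne : ∀ z, z ∉ Binf d (N + 2) → z ≠ 0 := by rintro z hz rfl; exact hz h0A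
  -- a connection to a point outside reaches a neighbour of 0
  have key : ∀ u v : Fin d → ℤ, u ∉ Binf d (N + 2) → v ∉ Binf d (N + 2) →
      Conn (insert 0 H) u v → ¬ Conn H u v → ∃ e, Conn H u e ∧ Adj e 0 := by
    intro u v hu hv hc hnc
    by_contra hcc
    push Not at hcc
    have huH : u ∈ H := by
      rcases hc.left_mem with h | h
      · exact absurd h (hne u hu)
      · exact h
    apply hnc
    refine hc.closed (S := {z | Conn H u z}) ?_ (Conn.refl huH)
    intro a ha b hb hab
    have ha' : Conn H u a := ha
    rcases hb with rfl | hb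
    · exact absurd hab (hcc a ha')
    · exact ha'.tail hab hb
  have hnt : ¬ Conn H o t := fun h => hncon ⟨t, ht, h⟩
  obtain ⟨e, hoe, hea⟩ := key o t ho (hTgt t ht) hct hnt
  obtain ⟨e', hte, hea'⟩ := key t o (hTgt t ht) ho hct.symm (fun h => hnt h.symm)
  let X := {z | Conn H o z}
  let Y := {z | Conn H t z}
  have hX : X ⊆ H := fun z (hz : Conn H o z) => hz.right_mem
  have hY : Y ⊆ H := fun z (hz : Conn H t z) => hz.right_mem
  have hXH : ∀ u ∈ X, ∀ v ∈ H, Adj u v → v ∈ X := fun u (hu : Conn H o u) v hv ha => hu.tail ha hv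
  have hYH : ∀ u ∈ Y, ∀ v ∈ H, Adj u v → v ∈ Y := fun u (hu : Conn H t u) v hv ha => hu.tail ha hv
  have hXY : ∀ u ∈ X, u ∉ Y := fun u (hu : Conn H o u) (hu' : Conn H t u) =>
    hnt (hu.trans hu'.symm)
  have hoX : o ∈ X := Conn.refl hoe.left_mem
  have htY : t ∈ Y := Conn.refl hte.left_mem
  have ez : ∀ e : Fin d → ℤ, Adj e 0 → e ∈ Zr d N := fun e he =>
    deep_nbr (fun i => by simp; omega) (adj_symm he)
  obtain ⟨f, p, q, K, eX⟩ := ent_exists (N := N) (by omega)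
    ((hoe.restrict hXH hoX).mono Set.inter_subset_right) ho (ez e hea)
  obtain ⟨f', p', q', K', eY⟩ := ent_exists (N := N) (by omega)
    ((hte.restrict hYH htY).mono Set.inter_subset_right) (hTgt t ht) (ez e' hea')
  obtain ⟨KX, KY, fX, fY, pX, pY, PX, PY, hgood⟩ := geo hd hN hX hY hXH hYH hXY eX eY
  obtain ⟨w, hw, K, hK, c1, c2, c3⟩ := asm (le_refl _) hLr.2 hgad hX hY hXH hXY hoX ho hgood
  refine ⟨w, hw, K, hK, ?_, ⟨t, ht, c2⟩, c3⟩
  rintro ⟨t', ht', hc⟩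
  exact c1 t' (hTgt t' ht') (fun h : Conn H o t' => hncon ⟨t', ht', h⟩) hc



/-! ### Finite Bernoulli products -/

noncomputable def bW {ι : Type} [DecidableEq ι] (I : Finset ι) (q : ι → ℝ) (S : Finset ι) : ℝ :=
  ∏ i ∈ I, if i ∈ S then q i else 1 - q i

open Classical in
noncomputable def bPr {ι : Type} [DecidableEq ι] (I : Finset ι) (q : ι → ℝ)
    (F : Finset ι → Prop) : ℝ :=
  ∑ S ∈ I.powerset, if F S then bW I q S else 0

theorem bW_nonneg {ι : Type} [DecidableEq ι] {I : Finset ι} {q : ι → ℝ}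
    (hq : ∀ i ∈ I, 0 ≤ q i ∧ q i ≤ 1) (S : Finset ι) : 0 ≤ bW I q S := by
  refine Finset.prod_nonneg fun i hi => ?_
  have := hq i hi
  split_ifs <;> linarith

theorem bW_congr {ι : Type} [DecidableEq ι] {I : Finset ι} {q q' : ι → ℝ} {S S' : Finset ι}
    (hq : ∀ i ∈ I, q i = q' i) (hS : ∀ i ∈ I, i ∈ S ↔ i ∈ S') : bW I q S = bW I q' S' := by
  refine Finset.prod_congr rfl fun i hi => ?_
  rw [hq i hi]; simp only [hS i hi]

theorem bPr_nonneg {ι : Type} [DecidableEq ι] {I : Finset ι} {q : ι → ℝ}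
    (hq : ∀ i ∈ I, 0 ≤ q i ∧ q i ≤ 1) (F : Finset ι → Prop) : 0 ≤ bPr I q F := by
  refine Finset.sum_nonneg fun S _ => ?_
  split_ifs
  · exact bW_nonneg hq S
  · exact le_rfl

theorem bPr_mono {ι : Type} [DecidableEq ι] {I : Finset ι} {q : ι → ℝ}
    (hq : ∀ i ∈ I, 0 ≤ q i ∧ q i ≤ 1) {F G : Finset ι → Prop} (h : ∀ S ⊆ I, F S → G S) :
    bPr I q F ≤ bPr I q G := by
  refine Finset.sum_le_sum fun S hS => ?_
  have h1 := bW_nonneg hq S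
  have h2 := h S (Finset.mem_powerset.1 hS)
  split_ifs <;> first | linarith | tauto

theorem bPr_congr {ι : Type} [DecidableEq ι] {I : Finset ι} {q q' : ι → ℝ}
    (hq : ∀ i ∈ I, q i = q' i) {F G : Finset ι → Prop} (h : ∀ S ⊆ I, F S ↔ G S) :
    bPr I q F = bPr I q' G := by
  refine Finset.sum_congr rfl fun S hS => ?_
  have h1 := h S (Finset.mem_powerset.1 hS)
  rw [bW_congr hq (fun i _ => Iff.rfl : ∀ i ∈ I, i ∈ S ↔ i ∈ S)]
  by_cases h2 : G S
  · rw [if_pos h2, if_pos (h1.2 h2)]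
  · rw [if_neg h2, if_neg (fun h => h2 (h1.1 h))]

theorem bPr_union {ι κ : Type} [DecidableEq ι] {I : Finset ι} {q : ι → ℝ}
    (hq : ∀ i ∈ I, 0 ≤ q i ∧ q i ≤ 1) (K : Finset κ) (F : κ → Finset ι → Prop) :
    bPr I q (fun S => ∃ k ∈ K, F k S) ≤ ∑ k ∈ K, bPr I q (F k) := by
  classical
  unfold bPr
  rw [Finset.sum_comm]
  refine Finset.sum_le_sum fun S hS => ?_
  have h1 := bW_nonneg hq S
  have h2 : ∀ k ∈ K, (0:ℝ) ≤ (if F k S then bW I q S else 0) := fun k _ => by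
    split_ifs <;> [exact h1; exact le_rfl]
  split_ifs with h
  · obtain ⟨k, hk, hF⟩ := h
    have h3 := Finset.single_le_sum h2 hk
    simpa [hF] using h3
  · exact Finset.sum_nonneg h2

theorem bW_insert {ι : Type} [DecidableEq ι] {I : Finset ι} {i : ι} (hi : i ∉ I) (q : ι → ℝ)
    (S : Finset ι) : bW (insert i I) q S = (if i ∈ S then q i else 1 - q i) * bW I q S :=
  Finset.prod_insert hi

theorem bPr_insert {ι : Type} [DecidableEq ι] {I : Finset ι} {i : ι} (hi : i ∉ I) (q : ι → ℝ)
    (F : Finset ι → Prop) :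
    bPr (insert i I) q F = q i * bPr I q (fun S => F (insert i S)) + (1 - q i) * bPr I q F := by
  classical
  unfold bPr
  rw [Finset.sum_powerset_insert hi, add_comm, Finset.mul_sum, Finset.mul_sum]
  congr 1
  · refine Finset.sum_congr rfl fun S hS => ?_
    rw [bW_insert hi, if_pos (Finset.mem_insert_self _ _),
      bW_congr (q' := q) (S' := S) (fun _ _ => rfl)]
    · split_ifs <;> simp
    · intro j hj
      rw [Finset.mem_insert]
      exact ⟨fun h => h.resolve_left (by rintro rfl; exact hi hj), Or.inr⟩
  · refine Finset.sum_congr rfl fun S hS => ?_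
    rw [bW_insert hi, if_neg (fun h => hi (Finset.mem_powerset.1 hS h))]
    split_ifs <;> simp

theorem bPr_marg {ι : Type} [DecidableEq ι] (J K : Finset ι) (hd : Disjoint J K) (q : ι → ℝ)
    (F : Finset ι → Prop) (hF : ∀ S S' : Finset ι, (∀ i ∈ J, i ∈ S ↔ i ∈ S') → (F S ↔ F S')) :
    bPr (J ∪ K) q F = bPr J q F := by
  induction K using Finset.induction_on with
  | empty => simp
  | insert i K hi ih =>
    have h1 : Disjoint J K := hd.mono_right (Finset.subset_insert _ _)
    have h2 : i ∉ J := fun h => (Finset.disjoint_left.1 hd h) (Finset.mem_insert_self _ _)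
    have h3 : J ∪ insert i K = insert i (J ∪ K) := by ext; simp
    have h4 : i ∉ J ∪ K := by simp [h2, hi]
    rw [h3, bPr_insert h4]
    have h5 : bPr (J ∪ K) q (fun S => F (insert i S)) = bPr (J ∪ K) q F := by
      refine bPr_congr (fun _ _ => rfl) fun S _ => hF _ _ fun j hj => ?_
      rw [Finset.mem_insert]
      exact ⟨fun h => h.resolve_left (by rintro rfl; exact h2 hj), Or.inr⟩
    rw [h5, ih h1]; ring

theorem bPr_marg' {ι : Type} [DecidableEq ι] {J I : Finset ι} (hJI : J ⊆ I) (q : ι → ℝ)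
    (F : Finset ι → Prop) (hF : ∀ S S' : Finset ι, (∀ i ∈ J, i ∈ S ↔ i ∈ S') → (F S ↔ F S')) :
    bPr I q F = bPr J q F := by
  have := bPr_marg J (I \ J) Finset.disjoint_sdiff q F hF
  rwa [Finset.union_sdiff_of_subset hJI] at this

/-- pivotality -/
def pivP {ι : Type} [DecidableEq ι] (F : Finset ι → Prop) (i : ι) (S : Finset ι) : Prop :=
  F (insert i S) ∧ ¬ F (S.erase i)
def pivM {ι : Type} [DecidableEq ι] (F : Finset ι → Prop) (i : ι) (S : Finset ι) : Prop :=
  ¬ F (insert i S) ∧ F (S.erase i)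

theorem bPr_erase {ι : Type} [DecidableEq ι] {I : Finset ι} {i : ι} (hi : i ∈ I) (q : ι → ℝ)
    (F : Finset ι → Prop) (hF : ∀ S, F (insert i S) ↔ F (S.erase i)) :
    bPr I q F = bPr (I.erase i) q F := by
  rw [← Finset.insert_erase hi, bPr_insert (Finset.notMem_erase i I),
    Finset.erase_insert (Finset.notMem_erase i I)]
  have : bPr (I.erase i) q (fun S => F (insert i S)) = bPr (I.erase i) q F := by
    refine bPr_congr (fun _ _ => rfl) fun S hS => ?_
    rw [hF, Finset.erase_eq_of_notMem (fun h => Finset.notMem_erase i I (hS h))]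
  rw [this]; ring

theorem ins_er {ι : Type} [DecidableEq ι] (i : ι) (S : Finset ι) :
    insert i (S.erase i) = insert i S := by
  ext j; simp; tauto

theorem piv_diff {ι : Type} [DecidableEq ι] {I : Finset ι} {i : ι} (hi : i ∈ I) (q : ι → ℝ)
    (F : Finset ι → Prop) :
    bPr (I.erase i) q (fun S => F (insert i S)) - bPr (I.erase i) q F
      = bPr I q (pivP F i) - bPr I q (pivM F i) := by
  classical
  rw [bPr_erase hi q (pivP F i) (by intro S; simp [pivP, ins_er]),
    bPr_erase hi q (pivM F i) (by intro S; simp [pivM, ins_er])]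
  unfold bPr
  rw [← Finset.sum_sub_distrib, ← Finset.sum_sub_distrib]
  refine Finset.sum_congr rfl fun S hS => ?_
  have h1 : S.erase i = S := Finset.erase_eq_of_notMem
    (fun h => Finset.notMem_erase i I (Finset.mem_powerset.1 hS h))
  simp only [pivP, pivM, h1]
  by_cases a : F (insert i S) <;> by_cases b : F S <;> simp [a, b]

theorem bW_deriv {ι : Type} [DecidableEq ι] (I : Finset ι) (q : ℝ → ι → ℝ) (q' : ι → ℝ) (t : ℝ)
    (h : ∀ i ∈ I, HasDerivAt (fun t => q t i) (q' i) t) (S : Finset ι) :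
    HasDerivAt (fun t => bW I (q t) S)
      (∑ i ∈ I, q' i * ((if i ∈ S then 1 else -1) * bW (I.erase i) (q t) S)) t := by
  have h1 : ∀ i ∈ I, HasDerivAt (fun t => if i ∈ S then q t i else 1 - q t i)
      (q' i * (if i ∈ S then 1 else -1)) t := by
    intro i hi
    split_ifs
    · simpa using h i hi
    · simpa using (h i hi).const_sub 1
  have h2 := HasDerivAt.fun_finsetProd h1
  unfold bW
  refine h2.congr_deriv ?_
  refine Finset.sum_congr rfl fun i _ => ?_
  rw [smul_eq_mul]; ring

theorem bPr_deriv {ι : Type} [DecidableEq ι] (I : Finset ι) (q : ℝ → ι → ℝ) (q' : ι → ℝ) (t : ℝ)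
    (h : ∀ i ∈ I, HasDerivAt (fun t => q t i) (q' i) t) (F : Finset ι → Prop) :
    HasDerivAt (fun t => bPr I (q t) F)
      (∑ i ∈ I, q' i * (bPr I (q t) (pivP F i) - bPr I (q t) (pivM F i))) t := by
  classical
  have h1 : ∀ S ∈ I.powerset, HasDerivAt (fun t => if F S then bW I (q t) S else 0)
      (if F S then (∑ i ∈ I, q' i * ((if i ∈ S then 1 else -1) * bW (I.erase i) (q t) S))
        else 0) t := by
    intro S _
    split_ifs
    · exact bW_deriv I q q' t h S
    · exact hasDerivAt_const _ _
  have h2 := HasDerivAt.fun_sum h1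
  unfold bPr at h2 ⊢
  refine h2.congr_deriv (Eq.symm ?_)
  have h3 : ∀ S ∈ I.powerset,
      (if F S then (∑ i ∈ I, q' i * ((if i ∈ S then 1 else -1) * bW (I.erase i) (q t) S)) else 0)
      = ∑ i ∈ I, (if F S then q' i * ((if i ∈ S then 1 else -1) * bW (I.erase i) (q t) S) else 0) := by
    intro S _
    split_ifs <;> simp
  rw [Finset.sum_congr rfl h3, Finset.sum_comm]
  refine Finset.sum_congr rfl fun i hi => ?_
  have h4 := piv_diff hi (q t) F
  unfold bPr at h4
  rw [← h4]
  conv_rhs => rw [← Finset.insert_erase hi]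
  rw [Finset.sum_powerset_insert (Finset.notMem_erase i I), Finset.erase_insert (Finset.notMem_erase i I),
    mul_sub, Finset.mul_sum, Finset.mul_sum, add_comm, sub_eq_add_neg, ← Finset.sum_neg_distrib]
  congr 1
  · refine Finset.sum_congr rfl fun S hS => ?_
    rw [bW_congr (I := I.erase i) (q := q t) (q' := q t) (S := insert i S) (S' := S) (fun _ _ => rfl)]
    · simp
    · intro j hj
      rw [Finset.mem_insert]
      exact ⟨fun h => h.resolve_left (by rintro rfl; exact Finset.notMem_erase _ _ hj), Or.inr⟩
  · refine Finset.sum_congr rfl fun S hS => ?_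
    rw [if_neg (fun h => Finset.notMem_erase i I (Finset.mem_powerset.1 hS h))]
    split_ifs <;> simp

/-- comparing weights of configurations agreeing off `N`, and of parameters agreeing off `N` -/
theorem bW_compare {ι : Type} [DecidableEq ι] {I : Finset ι} {q q' : ι → ℝ} {c : ℝ} (hc : 1 ≤ c)
    (N : Finset ι) (S S' : Finset ι)
    (hq : ∀ i ∈ I, 0 ≤ q i ∧ q i ≤ 1) (hq' : ∀ i ∈ I, 1 ≤ c * q' i ∧ 1 ≤ c * (1 - q' i))
    (hN : ∀ i ∈ I, i ∉ N → q i = q' i ∧ (i ∈ S ↔ i ∈ S')) :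
    bW I q S ≤ c ^ N.card * bW I q' S' := by
  have hc0 : (0:ℝ) < c := by linarith
  have hq'0 : ∀ i ∈ I, 0 ≤ q' i ∧ q' i ≤ 1 := by
    intro i hi
    have := hq' i hi
    constructor
    · by_contra hh; push Not at hh; nlinarith
    · by_contra hh; push Not at hh; nlinarith
  have h1 : bW I q S ≤ ∏ i ∈ I, ((if i ∈ N then c else 1) * (if i ∈ S' then q' i else 1 - q' i)) := by
    refine Finset.prod_le_prod ?_ ?_
    · intro i hi; have := hq i hi; split_ifs <;> linarith
    · intro i hi
      have a1 := hq i hi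
      have a2 := hq' i hi
      by_cases hiN : i ∈ N
      · rw [if_pos hiN]; split_ifs <;> linarith
      · have := hN i hi hiN
        simp only [hiN, if_false, one_mul, this.1, this.2]; exact le_rfl
  refine h1.trans ?_
  rw [Finset.prod_mul_distrib]
  refine mul_le_mul_of_nonneg_right ?_ (bW_nonneg hq'0 S')
  rw [← Finset.prod_filter, Finset.prod_const]
  refine pow_le_pow_right₀ hc (Finset.card_le_card ?_)
  intro i hi; exact (Finset.mem_filter.1 hi).2

theorem bPr_param {ι : Type} [DecidableEq ι] {I : Finset ι} {q q' : ι → ℝ} {c : ℝ} (hc : 1 ≤ c)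
    (N : Finset ι)
    (hq : ∀ i ∈ I, 0 ≤ q i ∧ q i ≤ 1) (hq' : ∀ i ∈ I, 1 ≤ c * q' i ∧ 1 ≤ c * (1 - q' i))
    (hN : ∀ i ∈ I, i ∉ N → q i = q' i) (F : Finset ι → Prop) :
    bPr I q F ≤ c ^ N.card * bPr I q' F := by
  unfold bPr
  rw [Finset.mul_sum]
  refine Finset.sum_le_sum fun S _ => ?_
  split_ifs
  · exact bW_compare hc N S S hq hq' fun i hi h => ⟨hN i hi h, Iff.rfl⟩
  · simp

theorem bPr_transfer {ι : Type} [DecidableEq ι] {I : Finset ι} {q : ι → ℝ} {c : ℝ} (hc : 1 ≤ c)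
    (N : Finset ι) (hq' : ∀ i ∈ I, 1 ≤ c * q i ∧ 1 ≤ c * (1 - q i))
    (A B : Finset ι → Prop)
    (h : ∀ S ⊆ I, A S → ∃ S' ⊆ I, B S' ∧ ∀ i, i ∉ N → (i ∈ S ↔ i ∈ S')) :
    bPr I q A ≤ (2 * c) ^ N.card * bPr I q B := by
  classical
  have hc0 : (0:ℝ) < c := by linarith
  have hq : ∀ i ∈ I, 0 ≤ q i ∧ q i ≤ 1 := by
    intro i hi
    have := hq' i hi
    constructor
    · by_contra hh; push Not at hh; nlinarith
    · by_contra hh; push Not at hh; nlinarith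
  have h' : ∀ S, ∃ S', S ⊆ I → A S → (S' ⊆ I ∧ B S' ∧ ∀ i, i ∉ N → (i ∈ S ↔ i ∈ S')) := by
    intro S
    by_cases h1 : S ⊆ I ∧ A S
    · obtain ⟨S', a, b⟩ := h S h1.1 h1.2
      exact ⟨S', fun _ _ => ⟨a, b⟩⟩
    · exact ⟨∅, fun a b => absurd ⟨a, b⟩ h1⟩
  choose g hg using h'
  unfold bPr
  rw [← Finset.sum_filter, ← Finset.sum_filter]
  have hmaps : ∀ S ∈ I.powerset.filter A, g S ∈ I.powerset.filter B := by
    intro S hS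
    rw [Finset.mem_filter, Finset.mem_powerset] at hS ⊢
    have := hg S hS.1 hS.2
    exact ⟨this.1, this.2.1⟩
  rw [← Finset.sum_fiberwise_of_maps_to hmaps, Finset.mul_sum]
  refine Finset.sum_le_sum fun S' hS' => ?_
  have h1 : ∀ S ∈ (I.powerset.filter A).filter (fun S => g S = S'),
      bW I q S ≤ c ^ N.card * bW I q S' := by
    intro S hS
    rw [Finset.mem_filter, Finset.mem_filter, Finset.mem_powerset] at hS
    refine bW_compare hc N S S' hq hq' fun i hi hiN => ⟨rfl, ?_⟩
    rw [← hS.2]; exact (hg S hS.1.1 hS.1.2).2.2 i hiN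
  refine (Finset.sum_le_sum h1).trans ?_
  rw [Finset.sum_const, nsmul_eq_mul, mul_pow, ← mul_assoc]
  refine mul_le_mul_of_nonneg_right ?_ (bW_nonneg hq _)
  refine mul_le_mul_of_nonneg_right ?_ (by positivity)
  have h2 : ((I.powerset.filter A).filter (fun S => g S = S')).card ≤ N.powerset.card := by
    refine Finset.card_le_card_of_injOn (fun S => S ∩ N) ?_ ?_
    · intro S _
      simp
    · intro S hS T hT hST
      rw [Finset.mem_coe, Finset.mem_filter, Finset.mem_filter, Finset.mem_powerset] at hS hT
      ext i
      by_cases hi : i ∈ N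
      · have : i ∈ S ∩ N ↔ i ∈ T ∩ N := by
          simp only at hST; rw [hST]
        simpa [hi] using this
      · rw [(hg S hS.1.1 hS.1.2).2.2 i hi, (hg T hT.1.1 hT.1.2).2.2 i hi, hS.2, hT.2]
  rw [Finset.card_powerset] at h2
  exact_mod_cast h2



/-! ### Events and local modification -/

def ctr {d : ℕ} (E0 : Set (Fin d → ℤ) → Set (Fin d → ℤ)) (ω α : Set (Fin d → ℤ)) :
    Set (Fin d → ℤ) := {z | ∃ u ∈ α, z - u ∈ E0 {x | x + u ∈ ω}}

theorem enh_eq {d : ℕ} (E0 : Set (Fin d → ℤ) → Set (Fin d → ℤ)) (ω α : Set (Fin d → ℤ)) :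
    enhancedConfig E0 ω α = ω ∪ ctr E0 ω α := by
  unfold enhancedConfig ctr
  congr 1
  ext z
  simp only [Set.mem_iUnion, Set.mem_image, Set.mem_ofPred_eq, exists_prop]
  refine exists_congr fun u => and_congr_right fun _ => ?_
  have h : (fun x => x - u) '' ω = {x | x + u ∈ ω} := by
    ext x
    constructor
    · rintro ⟨y, hy, rfl⟩; simpa using hy
    · intro hx; exact ⟨x + u, hx, by simp⟩
  rw [h]
  constructor
  · rintro ⟨y, hy, rfl⟩; simpa using hy
  · intro hz; exact ⟨z - u, hz, by simp⟩

theorem E0_congr {d : ℕ} {r : ℤ} {E0 : Set (Fin d → ℤ) → Set (Fin d → ℤ)}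
    (hloc : ∀ ω ω' : Set (Fin d → ℤ), ω ∩ Binf d r = ω' ∩ Binf d r → E0 ω = E0 ω')
    {ω ω' : Set (Fin d → ℤ)} (h : ∀ z ∈ Binf d r, z ∈ ω ↔ z ∈ ω') : E0 ω = E0 ω' := by
  refine hloc _ _ ?_
  ext z
  simp only [Set.mem_inter_iff]
  exact ⟨fun ⟨a, b⟩ => ⟨(h z b).1 a, b⟩, fun ⟨a, b⟩ => ⟨(h z b).2 a, b⟩⟩

theorem enh_mono {d : ℕ} (E0 : Set (Fin d → ℤ) → Set (Fin d → ℤ)) (ω : Set (Fin d → ℤ))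
    {α α' : Set (Fin d → ℤ)} (h : α ⊆ α') : enhancedConfig E0 ω α ⊆ enhancedConfig E0 ω α' := by
  rw [enh_eq, enh_eq]
  refine Set.union_subset_union_right _ ?_
  rintro z ⟨u, hu, hz⟩
  exact ⟨u, h hu, hz⟩

def Ev {d : ℕ} (E0 : Set (Fin d → ℤ) → Set (Fin d → ℤ)) (n : ℤ) (ω α : Set (Fin d → ℤ)) : Prop :=
  ∃ t, t ∉ Binf d n ∧ Conn (enhancedConfig E0 ω α) 0 t

theorem Ev_mono {d : ℕ} {E0 : Set (Fin d → ℤ) → Set (Fin d → ℤ)} {n : ℤ} {ω : Set (Fin d → ℤ)}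
    {α α' : Set (Fin d → ℤ)} (h : α ⊆ α') (he : Ev E0 n ω α) : Ev E0 n ω α' := by
  obtain ⟨t, ht, hc⟩ := he
  exact ⟨t, ht, hc.mono (enh_mono E0 ω h)⟩

theorem Ev_anti {d : ℕ} {E0 : Set (Fin d → ℤ) → Set (Fin d → ℤ)} {n m : ℤ} (hm : m ≤ n)
    {ω α : Set (Fin d → ℤ)} (he : Ev E0 n ω α) : Ev E0 m ω α := by
  obtain ⟨t, ht, hc⟩ := he
  exact ⟨t, fun h => ht (Binf_mono hm h), hc⟩

theorem conn_exit {d : ℕ} {σ : Set (Fin d → ℤ)} {n : ℤ} {a b : Fin d → ℤ} (ha : a ∈ Binf d n)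
    (h : Conn σ a b) :
    (b ∈ Binf d n ∧ Conn (σ ∩ Binf d (n+1)) a b) ∨
      ∃ t, t ∉ Binf d n ∧ Conn (σ ∩ Binf d (n+1)) a t := by
  obtain ⟨h1, h2⟩ := h
  induction h2 with
  | refl => exact Or.inl ⟨ha, Conn.refl ⟨h1, Binf_mono (by omega) ha⟩⟩
  | @tail b c hb hc ih =>
    rcases ih with ⟨ih1, ih2⟩ | ih
    · have hc1 : c ∈ Binf d (n+1) := by
        rw [mem_Binf] at ih1 ⊢
        intro i
        have := ih1 i
        have := adj_coord_le hc.1 i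
        omega
      have h3 := ih2.tail hc.1 ⟨hc.2, hc1⟩
      by_cases h4 : c ∈ Binf d n
      · exact Or.inl ⟨h4, h3⟩
      · exact Or.inr ⟨c, h4, h3⟩
    · exact Or.inr ih

theorem zero_mem_Binf {d : ℕ} {n : ℤ} (hn : 0 ≤ n) : (0 : Fin d → ℤ) ∈ Binf d n := by
  rw [mem_Binf]; intro i; simp; exact hn

theorem Ev_local_aux {d : ℕ} {r : ℤ} (hr : 1 ≤ r) {E0 : Set (Fin d → ℤ) → Set (Fin d → ℤ)}
    (hloc : ∀ ω ω' : Set (Fin d → ℤ), ω ∩ Binf d r = ω' ∩ Binf d r → E0 ω = E0 ω')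
    (hrange : ∀ ω : Set (Fin d → ℤ), E0 ω ⊆ Binf d r) {n : ℤ} (hn : 0 ≤ n)
    {ω ω' α α' : Set (Fin d → ℤ)}
    (h1 : ∀ z ∈ Binf d (n+1+2*r), z ∈ ω ↔ z ∈ ω')
    (h2 : ∀ z ∈ Binf d (n+1+2*r), z ∈ α ↔ z ∈ α') (h : Ev E0 n ω α) : Ev E0 n ω' α' := by
  obtain ⟨t, ht, hc⟩ := h
  rcases conn_exit (zero_mem_Binf hn) hc with h3 | ⟨t', ht', hc'⟩
  · exact absurd h3.1 ht
  refine ⟨t', ht', hc'.mono ?_⟩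
  rintro z ⟨hz, hzB⟩
  rw [enh_eq] at hz ⊢
  rcases hz with hz | ⟨u, hu, hz⟩
  · exact Or.inl ((h1 z (Binf_mono (by omega) hzB)).1 hz)
  · have h4 := hrange _ hz
    have hzB' := mem_Binf.1 hzB
    have h5 : u ∈ Binf d (n+1+r) := by
      rw [mem_Binf] at h4 ⊢
      intro i; have a := h4 i; have b := hzB' i; rw [Pi.sub_apply] at a; omega
    refine Or.inr ⟨u, (h2 u (Binf_mono (by omega) h5)).1 hu, ?_⟩
    rw [← E0_congr hloc (ω := {x | x + u ∈ ω})]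
    · exact hz
    · intro x hx
      refine h1 _ ?_
      rw [mem_Binf] at *
      intro i; have a := h5 i; have b := hx i; rw [Pi.add_apply]; omega

theorem Ev_local {d : ℕ} {r : ℤ} (hr : 1 ≤ r) {E0 : Set (Fin d → ℤ) → Set (Fin d → ℤ)}
    (hloc : ∀ ω ω' : Set (Fin d → ℤ), ω ∩ Binf d r = ω' ∩ Binf d r → E0 ω = E0 ω')
    (hrange : ∀ ω : Set (Fin d → ℤ), E0 ω ⊆ Binf d r) {n : ℤ} (hn : 0 ≤ n)
    {ω ω' α α' : Set (Fin d → ℤ)}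
    (h1 : ∀ z ∈ Binf d (n+1+2*r), z ∈ ω ↔ z ∈ ω')
    (h2 : ∀ z ∈ Binf d (n+1+2*r), z ∈ α ↔ z ∈ α') : Ev E0 n ω α ↔ Ev E0 n ω' α' :=
  ⟨Ev_local_aux hr hloc hrange hn h1 h2,
    Ev_local_aux hr hloc hrange hn (fun z hz => (h1 z hz).symm) (fun z hz => (h2 z hz).symm)⟩

theorem ctr_congr {d : ℕ} {r R : ℤ} (hr : 1 ≤ r) {E0 : Set (Fin d → ℤ) → Set (Fin d → ℤ)}
    (hloc : ∀ ω ω' : Set (Fin d → ℤ), ω ∩ Binf d r = ω' ∩ Binf d r → E0 ω = E0 ω')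
    {ω ω' α : Set (Fin d → ℤ)} {v : Fin d → ℤ}
    (hα : ∀ u ∈ α, u - v ∉ Binf d (R + 2*r)) (h : ∀ z, z - v ∉ Binf d R → (z ∈ ω ↔ z ∈ ω')) :
    ctr E0 ω α = ctr E0 ω' α := by
  ext z
  refine exists_congr fun u => and_congr_right fun hu => ?_
  rw [E0_congr hloc (ω := {x | x + u ∈ ω}) (ω' := {x | x + u ∈ ω'})]
  intro x hx
  refine h _ ?_
  intro h3
  refine hα u hu ?_
  rw [mem_Binf] at *
  intro i; have a := h3 i; have b := hx i; simp only [Pi.add_apply, Pi.sub_apply] at *; omega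

theorem ctr_far {d : ℕ} {r R : ℤ} {E0 : Set (Fin d → ℤ) → Set (Fin d → ℤ)}
    (hrange : ∀ ω : Set (Fin d → ℤ), E0 ω ⊆ Binf d r)
    {ω α : Set (Fin d → ℤ)} {v : Fin d → ℤ}
    (hα : ∀ u ∈ α, u - v ∉ Binf d (R + 2*r)) {z : Fin d → ℤ} (hz : z ∈ ctr E0 ω α) :
    z - v ∉ Binf d (R + r) := by
  obtain ⟨u, hu, hz⟩ := hz
  intro h3
  refine hα u hu ?_
  have h4 := hrange _ hz
  rw [mem_Binf] at *
  intro i; have a := h3 i; have b := h4 i; simp only [Pi.sub_apply] at *; omega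

theorem turn_off {V : Type} {P : Set V → Prop} {A : Set V} (hA : A.Finite) (α : Set V)
    (hmono : ∀ α α', α ⊆ α' → P α → P α')
    (h1 : P α) (h2 : ¬ P (α \ A)) :
    ∃ α', ∃ w ∈ A, (∀ z, z ∉ A → (z ∈ α ↔ z ∈ α')) ∧ P (insert w α') ∧ ¬ P (α' \ {w}) := by
  induction A, hA using Set.Finite.induction_on with
  | empty => simp at h2; exact absurd h1 h2
  | @insert a A ha hA ih =>
    by_cases h3 : P (α \ A)
    · refine ⟨α \ A, a, Or.inl rfl, ?_, hmono _ _ (Set.subset_insert _ _) h3, ?_⟩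
      · intro z hz
        simp only [Set.mem_insert_iff, not_or] at hz
        simp [hz.2]
      · have : (α \ A) \ {a} = α \ insert a A := by ext; simp; tauto
        rwa [this]
    · obtain ⟨α', w, hw, h4, h5⟩ := ih h3
      exact ⟨α', w, Or.inr hw, fun z hz => h4 z (fun h => hz (Or.inr h)), h5⟩

theorem local_mod {d : ℕ} (hd : d = 2 ∨ d = 3) {r : ℤ} (hr : 1 ≤ r)
    {E0 : Set (Fin d → ℤ) → Set (Fin d → ℤ)}
    (hloc : ∀ ω ω' : Set (Fin d → ℤ), ω ∩ Binf d r = ω' ∩ Binf d r → E0 ω = E0 ω')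
    (hrange : ∀ ω : Set (Fin d → ℤ), E0 ω ⊆ Binf d r)
    (hess : ∃ ω : Set (Fin d → ℤ),
      ¬ HasDoublyInfinitePath ω ∧ HasDoublyInfinitePath (ω ∪ E0 ω)) :
    ∃ R : ℤ, 1 ≤ R ∧ ∀ (n : ℤ) (v : Fin d → ℤ), v ∉ Binf d R → v ∈ Binf d (n - R) →
      ∀ ω α : Set (Fin d → ℤ), Ev E0 n (insert v ω) α → ¬ Ev E0 n (ω \ {v}) α →
      ∃ ω' α' : Set (Fin d → ℤ), ∃ w, w - v ∈ Binf d (R + 2*r) ∧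
        (∀ z, z - v ∉ Binf d (R + 2*r) → (z ∈ ω ↔ z ∈ ω') ∧ (z ∈ α ↔ z ∈ α')) ∧
        Ev E0 n ω' (insert w α') ∧ ¬ Ev E0 n ω' (α' \ {w}) := by
  obtain ⟨ω0, hω1, hω2⟩ := hess
  obtain ⟨R, hR, hcomb⟩ := comb hd hr (hrange ω0) hω1 hω2
  refine ⟨R, hR, ?_⟩
  intro n v hv1 hv2 ω α hF1 hF2
  set A : Set (Fin d → ℤ) := {z | z - v ∈ Binf d (R + 2*r)} with hAdef
  have hAfin : A.Finite := by
    have : A = (fun z => z + v) '' Binf d (R + 2*r) := by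
      ext z
      constructor
      · intro hz; exact ⟨z - v, hz, by simp⟩
      · rintro ⟨y, hy, rfl⟩; simpa [hAdef] using hy
    rw [this]; exact (Binf_finite _ _).image _
  have hvA : v - v ∈ Binf d R := by rw [sub_self]; exact zero_mem_Binf (by omega)
  by_cases hoff : Ev E0 n (insert v ω) (α \ A)
  swap
  · obtain ⟨α', w, hw, h1, h2, h3⟩ := turn_off (P := fun α => Ev E0 n (insert v ω) α) hAfin α
      (fun _ _ h => Ev_mono h) hF1 hoff
    refine ⟨insert v ω, α', w, hw, ?_, h2, h3⟩
    intro z hz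
    refine ⟨?_, h1 z hz⟩
    have : z ≠ v := by
      rintro rfl; exact hz (Binf_mono (by omega) hvA)
    simp [this]
  have hα : ∀ u ∈ α \ A, u - v ∉ Binf d (R + 2*r) := fun u hu => hu.2
  have hF3 : ¬ Ev E0 n (ω \ {v}) (α \ A) := fun h => hF2 (Ev_mono Set.sdiff_subset h)
  set D := ctr E0 ω (α \ A) with hD
  have hDe : ∀ ω', (∀ z, z - v ∉ Binf d R → (z ∈ ω ↔ z ∈ ω')) →
      enhancedConfig E0 ω' (α \ A) = ω' ∪ D := by
    intro ω' h
    rw [enh_eq, hD, ctr_congr hr hloc hα h]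
  have hDfar : ∀ z ∈ D, z - v ∉ Binf d (R + r) := fun z hz => ctr_far hrange hα hz
  have hne : ∀ z, z - v ∉ Binf d R → z ≠ v := by rintro z hz rfl; exact hz hvA
  have e1 := hDe (insert v ω) (by intro z hz; simp [hne z hz])
  have e2 := hDe (ω \ {v}) (by intro z hz; simp [hne z hz])
  set H : Set (Fin d → ℤ) := {z | z + v ∈ (ω \ {v}) ∪ D} with hH
  obtain ⟨t, htn, htc⟩ := hoff
  obtain ⟨w, hw, K, hK, c1, c2, c3⟩ := hcomb H (-v) {t | t + v ∉ Binf d n}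
    (by
      intro h; apply hv1; rw [mem_Binf] at *
      intro i; have := h i; rw [Pi.neg_apply] at this; omega)
    (by
      intro t ht h; apply ht; rw [mem_Binf] at *
      intro i; have a := h i; have b := hv2 i; rw [Pi.add_apply]; omega)
    (by
      rintro (h | h)
      · exact h.2 (by simp)
      · refine hDfar _ h ?_
        have : (0 : Fin d → ℤ) + v - v = 0 := by simp
        rw [this]; exact zero_mem_Binf (by omega))
    (by
      refine ⟨t + -v, by simpa using htn, ?_⟩
      rw [e1] at htc
      have := htc.translate (-v)
      rw [zero_add] at this
      refine this.mono ?_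
      intro z hz
      simp only [sub_neg_eq_add, Set.mem_ofPred_eq] at hz
      by_cases hzv : z = 0
      · exact Or.inl hzv
      · refine Or.inr ?_
        have hz' : z + v ≠ v := by simpa using hzv
        rcases hz with (hz | hz) | hz
        · exact absurd hz hz'
        · exact Or.inl ⟨hz, hz'⟩
        · exact Or.inr hz)
    (by
      rintro ⟨t, ht, hc⟩
      refine hF3 ⟨t + v, ht, ?_⟩
      rw [e2]
      have := hc.translate v
      rw [neg_add_cancel] at this
      refine this.mono ?_
      intro z hz
      simpa [hH, sub_eq_zero] using hz)
  set ω' : Set (Fin d → ℤ) := {z | (z ∈ ω ∧ z - v ∉ Binf d R) ∨ z - v ∈ K} with hω'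
  have hagree : ∀ z, z - v ∉ Binf d R → (z ∈ ω ↔ z ∈ ω') := by
    intro z hz
    constructor
    · intro h; exact Or.inl ⟨h, hz⟩
    · rintro (h | h)
      · exact h.1
      · exact absurd (hK h) hz
  have e3 := hDe ω' hagree
  have hG : ∀ z, z ∈ ω' ∪ D ↔ z - v ∈ (H \ Binf d R) ∪ K := by
    intro z
    constructor
    · rintro ((h | h) | h)
      · refine Or.inl ⟨?_, h.2⟩
        rw [hH]; simp only [Set.mem_ofPred_eq, sub_add_cancel]
        exact Or.inl ⟨h.1, hne z h.2⟩
      · exact Or.inr h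
      · refine Or.inl ⟨?_, fun hh => hDfar z h (Binf_mono (by omega) hh)⟩
        rw [hH]; simp only [Set.mem_ofPred_eq, sub_add_cancel]
        exact Or.inr h
    · rintro (⟨h, h'⟩ | h)
      · rw [hH] at h; simp only [Set.mem_ofPred_eq, sub_add_cancel] at h
        rcases h with h | h
        · exact Or.inl (Or.inl ⟨h.1, h'⟩)
        · exact Or.inr h
      · exact Or.inl (Or.inr h)
  have hwA : w + v - v ∈ Binf d (R + 2*r) := by
    rw [add_sub_cancel_right]; exact Binf_mono (by omega) hw
  have hE0 : E0 {x | x + (w + v) ∈ ω'} = E0 ω0 := by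
    refine E0_congr hloc fun x hx => ?_
    have h1 := c3 (x + w) (by simpa using hx)
    rw [add_sub_cancel_right] at h1
    rw [← h1]
    have h2 := hG (x + (w + v))
    rw [show x + (w + v) - v = x + w by abel] at h2
    rw [← h2]
    constructor
    · intro h; exact Or.inl h
    · rintro (h | h)
      · exact h
      · exfalso
        refine hDfar _ h ?_
        rw [show x + (w + v) - v = x + w by abel]
        rw [mem_Binf] at *
        intro i; have a := hx i; have b := hw i; rw [Pi.add_apply]; omega
  refine ⟨ω', α \ A, w + v, hwA, ?_, ?_, ?_⟩
  · intro z hz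
    refine ⟨hagree z (fun h => hz (Binf_mono (by omega) h)), ?_⟩
    constructor
    · intro h; exact ⟨h, hz⟩
    · intro h; exact h.1
  · obtain ⟨t, ht, hc⟩ := c2
    refine ⟨t + v, ht, ?_⟩
    have := hc.translate v
    rw [neg_add_cancel] at this
    refine this.mono ?_
    intro z hz
    rcases hz with hz | hz
    · have h1 := (hG z).2 hz
      rw [← e3] at h1
      exact enh_mono E0 ω' (Set.subset_insert _ _) h1
    · rw [enh_eq]
      refine Or.inr ⟨w + v, Or.inl rfl, ?_⟩
      rw [hE0]
      have h2 : z - v - w ∈ E0 ω0 := hz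
      rwa [show z - (w + v) = z - v - w by abel]
  · have h1 : (α \ A) \ {w + v} = α \ A := by
      ext z
      constructor
      · intro h; exact h.1
      · intro h; exact ⟨h, by rintro rfl; exact h.2 hwA⟩
    rw [h1]
    rintro ⟨t, ht, hc⟩
    rw [e3] at hc
    refine c1 ⟨t + -v, by simpa using ht, ?_⟩
    have := hc.translate (-v)
    rw [zero_add] at this
    refine this.mono ?_
    intro z hz
    have h2 : z + v ∈ ω' ∪ D := by simpa using hz
    have h3 := (hG _).1 h2
    simpa using h3



/-! ### The comparison in a finite box -/

noncomputable def boxF (d : ℕ) (m : ℤ) : Finset (Fin d → ℤ) := (Binf_finite d m).toFinset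

theorem mem_boxF {d : ℕ} {m : ℤ} {z : Fin d → ℤ} : z ∈ boxF d m ↔ z ∈ Binf d m := by
  simp [boxF]

noncomputable def boxI (d : ℕ) (m : ℤ) : Finset ((Fin d → ℤ) ⊕ (Fin d → ℤ)) :=
  (boxF d m).disjSum (boxF d m)

theorem inl_mem_boxI {d : ℕ} {m : ℤ} {z : Fin d → ℤ} : Sum.inl z ∈ boxI d m ↔ z ∈ Binf d m := by
  simp [boxI, mem_boxF]
theorem inr_mem_boxI {d : ℕ} {m : ℤ} {z : Fin d → ℤ} : Sum.inr z ∈ boxI d m ↔ z ∈ Binf d m := by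
  simp [boxI, mem_boxF]

def omS {d : ℕ} (S : Finset ((Fin d → ℤ) ⊕ (Fin d → ℤ))) : Set (Fin d → ℤ) := {v | Sum.inl v ∈ S}
def alS {d : ℕ} (S : Finset ((Fin d → ℤ) ⊕ (Fin d → ℤ))) : Set (Fin d → ℤ) := {v | Sum.inr v ∈ S}

theorem mem_omS {d : ℕ} {S : Finset ((Fin d → ℤ) ⊕ (Fin d → ℤ))} {v : Fin d → ℤ} :
    v ∈ omS S ↔ Sum.inl v ∈ S := Iff.rfl
theorem mem_alS {d : ℕ} {S : Finset ((Fin d → ℤ) ⊕ (Fin d → ℤ))} {v : Fin d → ℤ} :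
    v ∈ alS S ↔ Sum.inr v ∈ S := Iff.rfl

def FE {d : ℕ} (E0 : Set (Fin d → ℤ) → Set (Fin d → ℤ)) (n : ℤ)
    (S : Finset ((Fin d → ℤ) ⊕ (Fin d → ℤ))) : Prop := Ev E0 n (omS S) (alS S)

theorem FE_local {d : ℕ} {r : ℤ} (hr : 1 ≤ r) {E0 : Set (Fin d → ℤ) → Set (Fin d → ℤ)}
    (hloc : ∀ ω ω' : Set (Fin d → ℤ), ω ∩ Binf d r = ω' ∩ Binf d r → E0 ω = E0 ω')
    (hrange : ∀ ω : Set (Fin d → ℤ), E0 ω ⊆ Binf d r) {n : ℤ} (hn : 0 ≤ n)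
    (S S' : Finset ((Fin d → ℤ) ⊕ (Fin d → ℤ)))
    (h : ∀ i ∈ boxI d (n+1+2*r), i ∈ S ↔ i ∈ S') : FE E0 n S ↔ FE E0 n S' :=
  Ev_local hr hloc hrange hn (fun z hz => h _ (inl_mem_boxI.2 hz))
    (fun z hz => h _ (inr_mem_boxI.2 hz))

theorem pivM_inr {d : ℕ} (E0 : Set (Fin d → ℤ) → Set (Fin d → ℤ)) (n : ℤ) (w : Fin d → ℤ)
    (S : Finset ((Fin d → ℤ) ⊕ (Fin d → ℤ))) : ¬ pivM (FE E0 n) (Sum.inr w) S := by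
  rintro ⟨h1, h2⟩
  apply h1
  unfold FE at h2 ⊢
  have e : omS (insert (Sum.inr w) S) = omS (S.erase (Sum.inr w)) := by
    ext z; simp [mem_omS]
  rw [e]
  refine Ev_mono ?_ h2
  intro z hz
  rw [mem_alS] at *
  exact Finset.mem_insert_of_mem (Finset.mem_of_mem_erase hz)

theorem pivP_transfer {d : ℕ} (hd : d = 2 ∨ d = 3) {r : ℤ} (hr : 1 ≤ r)
    {E0 : Set (Fin d → ℤ) → Set (Fin d → ℤ)}
    (hloc : ∀ ω ω' : Set (Fin d → ℤ), ω ∩ Binf d r = ω' ∩ Binf d r → E0 ω = E0 ω')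
    (hrange : ∀ ω : Set (Fin d → ℤ), E0 ω ⊆ Binf d r)
    (hess : ∃ ω : Set (Fin d → ℤ),
      ¬ HasDoublyInfinitePath ω ∧ HasDoublyInfinitePath (ω ∪ E0 ω)) :
    ∃ R : ℤ, 1 ≤ R ∧ ∀ (n : ℤ) (c : ℝ) (_ : 1 ≤ c)
      (q : (Fin d → ℤ) ⊕ (Fin d → ℤ) → ℝ)
      (_ : ∀ i ∈ boxI d (n+1+2*r), 1 ≤ c * q i ∧ 1 ≤ c * (1 - q i)),
      ∀ (v : Fin d → ℤ), v ∉ Binf d R → v ∈ Binf d (n - R) →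
      bPr (boxI d (n+1+2*r)) q (pivP (FE E0 n) (Sum.inl v)) ≤
        (2 * c) ^ (2 * (boxF d (R+2*r)).card) *
          ∑ w ∈ boxF d (R+2*r), bPr (boxI d (n+1+2*r)) q (pivP (FE E0 n) (Sum.inr (w + v))) := by
  classical
  obtain ⟨R, hR, hmod⟩ := local_mod hd hr hloc hrange hess
  refine ⟨R, hR, ?_⟩
  intro n c hc q hq v hv1 hv2
  set I := boxI d (n+1+2*r) with hI
  have hc0 : (0:ℝ) < c := by linarith
  have hq01 : ∀ i ∈ I, 0 ≤ q i ∧ q i ≤ 1 := by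
    intro i hi
    have := hq i hi
    constructor
    · by_contra hh; push Not at hh; nlinarith
    · by_contra hh; push Not at hh; nlinarith
  set X : Finset (Fin d → ℤ) := (boxF d (R+2*r)).image (fun w => w + v) with hX
  have hmX : ∀ z, z ∈ X ↔ z - v ∈ Binf d (R+2*r) := by
    intro z
    rw [hX, Finset.mem_image]
    constructor
    · rintro ⟨w, hw, rfl⟩; simpa using mem_boxF.1 hw
    · intro h; exact ⟨z - v, mem_boxF.2 h, by simp⟩
  have hXc : X.card = (boxF d (R+2*r)).card :=
    Finset.card_image_of_injective _ (add_left_injective v)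
  set N : Finset ((Fin d → ℤ) ⊕ (Fin d → ℤ)) := X.disjSum X with hN
  have hNc : N.card = 2 * (boxF d (R+2*r)).card := by
    rw [hN, Finset.card_disjSum, hXc]; ring
  have hXI : ∀ z ∈ X, z ∈ Binf d (n+1+2*r) := by
    intro z hz
    rw [hmX] at hz
    rw [mem_Binf] at *
    intro i; have a := hz i; have b := hv2 i; rw [Pi.sub_apply] at a; omega
  have hNI : N ⊆ I := by
    rintro (z | z) hz
    · exact inl_mem_boxI.2 (hXI z (by simpa [hN] using hz))
    · exact inr_mem_boxI.2 (hXI z (by simpa [hN] using hz))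
  have h1 := bPr_transfer (I := I) (q := q) hc N hq (pivP (FE E0 n) (Sum.inl v))
    (fun S => ∃ w ∈ boxF d (R+2*r), pivP (FE E0 n) (Sum.inr (w + v)) S) (by
      rintro S hSI ⟨hS1, hS2⟩
      have a1 : omS (insert (Sum.inl v) S) = insert v (omS S) := by
        ext z; simp [mem_omS]
      have a2 : omS (S.erase (Sum.inl v)) = omS S \ {v} := by
        ext z; simp [mem_omS, and_comm]
      have a3 : alS (insert (Sum.inl v) S) = alS S := by
        ext z; simp [mem_alS]
      have a4 : alS (S.erase (Sum.inl v)) = alS S := by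
        ext z; simp [mem_alS]
      unfold FE at hS1 hS2
      rw [a1, a3] at hS1
      rw [a2, a4] at hS2
      obtain ⟨ω', α', w, hw, hag, hE1, hE2⟩ := hmod n v hv1 hv2 (omS S) (alS S) hS1 hS2
      let S' : Finset ((Fin d → ℤ) ⊕ (Fin d → ℤ)) :=
        (S \ N) ∪ (X.filter (fun z => z ∈ ω')).disjSum (X.filter (fun z => z ∈ α'))
      have b1 : ∀ i, i ∉ N → (i ∈ S ↔ i ∈ S') := by
        intro i hi
        rcases i with z | z
        · have : z ∉ X := by simpa [hN] using hi
          simp [S', hi, this]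
        · have : z ∉ X := by simpa [hN] using hi
          simp [S', hi, this]
      have b2 : omS S' = ω' := by
        ext z
        rw [mem_omS]
        by_cases hz : z ∈ X
        · have : Sum.inl z ∈ N := by simpa [hN] using hz
          simp [S', this, hz]
        · have : Sum.inl z ∉ N := by simpa [hN] using hz
          rw [← b1 _ this]
          exact (hag z (fun h => hz ((hmX z).2 h))).1
      have b3 : alS S' = α' := by
        ext z
        rw [mem_alS]
        by_cases hz : z ∈ X
        · have : Sum.inr z ∈ N := by simpa [hN] using hz
          simp [S', this, hz]
        · have : Sum.inr z ∉ N := by simpa [hN] using hz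
          rw [← b1 _ this]
          exact (hag z (fun h => hz ((hmX z).2 h))).2
      refine ⟨S', ?_, ⟨w - v, mem_boxF.2 hw, ?_⟩, b1⟩
      · intro i hi
        by_cases hiN : i ∈ N
        · exact hNI hiN
        · exact hSI ((b1 i hiN).2 hi)
      · rw [sub_add_cancel]
        unfold pivP FE
        have c1 : omS (insert (Sum.inr w) S') = omS S' := by
          ext z; simp [mem_omS]
        have c2 : omS (S'.erase (Sum.inr w)) = omS S' := by
          ext z; simp [mem_omS]
        have c3 : alS (insert (Sum.inr w) S') = insert w (alS S') := by
          ext z; simp [mem_alS]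
        have c4 : alS (S'.erase (Sum.inr w)) = alS S' \ {w} := by
          ext z; simp [mem_alS, and_comm]
        rw [c1, c2, c3, c4, b2, b3]
        exact ⟨hE1, hE2⟩)
  rw [hNc] at h1
  refine h1.trans ?_
  refine mul_le_mul_of_nonneg_left ?_ (by positivity)
  exact bPr_union hq01 _ _

noncomputable def qq {d : ℕ} (p s : ℝ) : (Fin d → ℤ) ⊕ (Fin d → ℤ) → ℝ :=
  Sum.elim (fun _ => p) (fun _ => s)

theorem finite_main {d : ℕ} (hd : d = 2 ∨ d = 3) {r : ℤ} (hr : 1 ≤ r)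
    {E0 : Set (Fin d → ℤ) → Set (Fin d → ℤ)}
    (hloc : ∀ ω ω' : Set (Fin d → ℤ), ω ∩ Binf d r = ω' ∩ Binf d r → E0 ω = E0 ω')
    (hrange : ∀ ω : Set (Fin d → ℤ), E0 ω ⊆ Binf d r)
    (hess : ∃ ω : Set (Fin d → ℤ),
      ¬ HasDoublyInfinitePath ω ∧ HasDoublyInfinitePath (ω ∪ E0 ω)) :
    ∃ (R : ℤ) (k k' : ℕ), 1 ≤ R ∧ ∀ (c p p' s : ℝ) (_ : 1 ≤ c) (_ : p ≤ p')
      (_ : 1 ≤ c * p) (_ : 1 ≤ c * (1 - p')) (_ : 1 ≤ c * (s/2)) (_ : 1 ≤ c * (1 - s))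
      (_ : (p' - p) * (k * (2 * c) ^ (2 * k)) ≤ s/2) (m : ℤ) (_ : 0 ≤ m),
      bPr (boxI d (m+1+2*r+R+1+2*r)) (qq p' (s/2)) (FE E0 (m+1+2*r+R)) ≤
        c ^ k' * bPr (boxI d (m+1+2*r)) (qq p s) (FE E0 m) := by
  classical
  obtain ⟨R, hR, htr⟩ := pivP_transfer hd hr hloc hrange hess
  refine ⟨R, (boxF d (R+2*r)).card, (boxF d R).card, hR, ?_⟩
  intro c p p' s hc hpp hcp hcp' hcs hcs' hsmall m hm
  set k := (boxF d (R+2*r)).card with hk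
  set n := m+1+2*r+R with hn
  have hc0 : (0:ℝ) < c := by linarith
  set I := boxI d (n+1+2*r) with hI
  set bulk : Finset (Fin d → ℤ) := (boxF d (n - R)).filter (fun v => v ∉ Binf d R) with hbulk
  have hmb : ∀ v, v ∈ bulk ↔ v ∈ Binf d (n-R) ∧ v ∉ Binf d R := by
    intro v; rw [hbulk, Finset.mem_filter, mem_boxF]
  let q : ℝ → (Fin d → ℤ) ⊕ (Fin d → ℤ) → ℝ := fun t =>
    Sum.elim (fun v => if v ∈ bulk then p' + t * (p - p') else p') (fun _ => s/2 + t * (s/2))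
  let q' : (Fin d → ℤ) ⊕ (Fin d → ℤ) → ℝ :=
    Sum.elim (fun v => if v ∈ bulk then (p - p') else 0) (fun _ => s/2)
  have hq' : ∀ t i, HasDerivAt (fun t => q t i) (q' i) t := by
    intro t i
    rcases i with v | v
    · by_cases hv : v ∈ bulk
      · simp only [q, q', Sum.elim_inl, hv, if_true]
        simpa using ((hasDerivAt_id t).mul_const (p - p')).const_add p'
      · simp only [q, q', Sum.elim_inl, hv, if_false]
        exact hasDerivAt_const _ _
    · simp only [q, q', Sum.elim_inr]
      simpa using ((hasDerivAt_id t).mul_const (s/2)).const_add (s/2)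
  have hs : 0 ≤ s := by
    by_contra hh; push Not at hh; nlinarith
  have hp0 : 0 ≤ p := by
    by_contra hh; push Not at hh; nlinarith
  have hqc : ∀ t ∈ Set.Icc (0:ℝ) 1, ∀ i, 1 ≤ c * q t i ∧ 1 ≤ c * (1 - q t i) := by
    rintro t ⟨ht0, ht1⟩ i
    have key : ∀ a x b : ℝ, a ≤ x → x ≤ b → 1 ≤ c * a → 1 ≤ c * (1 - b) →
        1 ≤ c * x ∧ 1 ≤ c * (1 - x) := by
      intro a x b h1 h2 h3 h4
      constructor <;> nlinarith
    rcases i with v | v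
    · by_cases hv : v ∈ bulk
      · simp only [q, Sum.elim_inl, hv, if_true]
        exact key p _ p' (by nlinarith) (by nlinarith) hcp hcp'
      · simp only [q, Sum.elim_inl, hv, if_false]
        exact key p _ p' hpp le_rfl hcp hcp'
    · simp only [q, Sum.elim_inr]
      exact key (s/2) _ s (by nlinarith) (by nlinarith) hcs hcs'
  have h01 : ∀ t ∈ Set.Icc (0:ℝ) 1, ∀ i, 0 ≤ q t i ∧ q t i ≤ 1 := by
    intro t ht i
    have := hqc t ht i
    constructor
    · by_contra hh; push Not at hh; nlinarith
    · by_contra hh; push Not at hh; nlinarith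
  -- derivative is nonnegative
  have hder := fun t => bPr_deriv I q q' t (fun i _ => hq' t i) (FE E0 n)
  have hnn : ∀ t ∈ Set.Icc (0:ℝ) 1, 0 ≤ ∑ i ∈ I, q' i *
      (bPr I (q t) (pivP (FE E0 n) i) - bPr I (q t) (pivM (FE E0 n) i)) := by
    intro t ht
    have h01' : ∀ i ∈ I, 0 ≤ q t i ∧ q t i ≤ 1 := fun i _ => h01 t ht i
    set Sw := ∑ w ∈ boxF d (n+1+2*r), bPr I (q t) (pivP (FE E0 n) (Sum.inr w)) with hSw
    have hS0 : 0 ≤ Sw := Finset.sum_nonneg fun w _ => bPr_nonneg h01' _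
    have hbb : ∑ v ∈ bulk, bPr I (q t) (pivP (FE E0 n) (Sum.inl v)) ≤
        (k * (2 * c) ^ (2 * k)) * Sw := by
      have s1 : ∑ v ∈ bulk, bPr I (q t) (pivP (FE E0 n) (Sum.inl v)) ≤
          ∑ v ∈ bulk, (2 * c) ^ (2 * k) *
            ∑ w ∈ boxF d (R+2*r), bPr I (q t) (pivP (FE E0 n) (Sum.inr (w + v))) := by
        refine Finset.sum_le_sum fun v hv => ?_
        rw [hmb] at hv
        exact htr n c hc (q t) (fun i _ => hqc t ht i) v hv.2 hv.1
      refine s1.trans ?_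
      rw [← Finset.mul_sum, Finset.sum_comm]
      have s2 : ∑ w ∈ boxF d (R+2*r), ∑ v ∈ bulk,
          bPr I (q t) (pivP (FE E0 n) (Sum.inr (w + v))) ≤ ∑ w ∈ boxF d (R+2*r), Sw := by
        refine Finset.sum_le_sum fun w hw => ?_
        rw [← Finset.sum_image (s := bulk) (g := fun v => w + v)
          (f := fun u => bPr I (q t) (pivP (FE E0 n) (Sum.inr u)))
          (fun a _ b _ h => add_left_cancel h)]
        refine Finset.sum_le_sum_of_subset_of_nonneg ?_ fun _ _ _ => bPr_nonneg h01' _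
        intro u hu
        obtain ⟨v, hv, rfl⟩ := Finset.mem_image.1 hu
        rw [hmb] at hv
        have hv1 := mem_Binf.1 hv.1
        have hw1 := mem_Binf.1 (mem_boxF.1 hw)
        rw [mem_boxF, mem_Binf]
        intro i; have a := hv1 i; have b := hw1 i; rw [Pi.add_apply]; omega
      rw [Finset.sum_const, nsmul_eq_mul] at s2
      calc _ ≤ (2 * c) ^ (2 * k) * (k * Sw) := mul_le_mul_of_nonneg_left s2 (by positivity)
        _ = _ := by ring
    rw [hI]; unfold boxI
    rw [Finset.sum_disjSum, ← boxI, ← hI]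
    have t1 : ∑ w ∈ boxF d (n+1+2*r), q' (Sum.inr w) *
        (bPr I (q t) (pivP (FE E0 n) (Sum.inr w)) - bPr I (q t) (pivM (FE E0 n) (Sum.inr w)))
        = s/2 * Sw := by
      rw [hSw, Finset.mul_sum]
      refine Finset.sum_congr rfl fun w _ => ?_
      have : bPr I (q t) (pivM (FE E0 n) (Sum.inr w)) = 0 := by
        unfold bPr
        refine Finset.sum_eq_zero fun S _ => ?_
        rw [if_neg (pivM_inr E0 n w S)]
      rw [this, sub_zero]; simp [q']
    have t2 : -((p' - p) * ∑ v ∈ bulk, bPr I (q t) (pivP (FE E0 n) (Sum.inl v))) ≤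
        ∑ v ∈ boxF d (n+1+2*r), q' (Sum.inl v) *
        (bPr I (q t) (pivP (FE E0 n) (Sum.inl v)) - bPr I (q t) (pivM (FE E0 n) (Sum.inl v))) := by
      have hsub : bulk ⊆ boxF d (n+1+2*r) := by
        intro v hv
        rw [hmb] at hv
        exact mem_boxF.2 (Binf_mono (by omega) hv.1)
      rw [← Finset.sum_subset hsub (fun v _ hv => by simp [q', hv]), Finset.mul_sum,
        ← Finset.sum_neg_distrib]
      refine Finset.sum_le_sum fun v hv => ?_
      simp only [q', Sum.elim_inl, hv, if_true]
      have := bPr_nonneg h01' (pivM (FE E0 n) (Sum.inl v))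
      nlinarith
    rw [t1]
    have t3 : (p' - p) * ∑ v ∈ bulk, bPr I (q t) (pivP (FE E0 n) (Sum.inl v)) ≤ s/2 * Sw := by
      calc _ ≤ (p' - p) * ((k * (2 * c) ^ (2 * k)) * Sw) :=
            mul_le_mul_of_nonneg_left hbb (by linarith)
        _ = ((p' - p) * (k * (2 * c) ^ (2 * k))) * Sw := by ring
        _ ≤ _ := mul_le_mul_of_nonneg_right hsmall hS0
    linarith
  have hmono : MonotoneOn (fun t => bPr I (q t) (FE E0 n)) (Set.Icc 0 1) := by
    refine monotoneOn_of_deriv_nonneg (convex_Icc _ _) ?_ ?_ ?_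
    · exact fun t _ => (hder t).continuousAt.continuousWithinAt
    · exact fun t _ => (hder t).differentiableAt.differentiableWithinAt
    · intro t ht
      rw [(hder t).deriv]
      exact hnn t (interior_subset ht)
  have e0 : bPr I (qq p' (s/2)) (FE E0 n) = bPr I (q 0) (FE E0 n) := by
    refine bPr_congr ?_ fun _ _ => Iff.rfl
    rintro (v | v) _ <;> simp [q, qq]
  have e1 : bPr I (q 0) (FE E0 n) ≤ bPr I (q 1) (FE E0 n) :=
    hmono (by simp) (by simp) zero_le_one
  have e2 : bPr I (q 1) (FE E0 n) ≤ bPr I (q 1) (FE E0 m) :=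
    bPr_mono (fun i _ => h01 1 (by simp) i) fun S _ h => Ev_anti (by omega) h
  have e3 : bPr I (q 1) (FE E0 m) = bPr (boxI d (m+1+2*r)) (q 1) (FE E0 m) := by
    refine bPr_marg' ?_ _ _ (FE_local hr hloc hrange hm)
    rintro (v | v) hv
    · exact inl_mem_boxI.2 (Binf_mono (by omega) (inl_mem_boxI.1 hv))
    · exact inr_mem_boxI.2 (Binf_mono (by omega) (inr_mem_boxI.1 hv))
  have e4 : bPr (boxI d (m+1+2*r)) (q 1) (FE E0 m) ≤
      c ^ (boxF d R).card * bPr (boxI d (m+1+2*r)) (qq p s) (FE E0 m) := by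
    have := bPr_param (I := boxI d (m+1+2*r)) (q := q 1) (q' := qq p s) hc
      ((boxF d R).image Sum.inl) (fun i _ => h01 1 (by simp) i) ?_ ?_ (FE E0 m)
    · rwa [Finset.card_image_of_injective _ Sum.inl_injective] at this
    · rintro (v | v) _
      · simp only [qq, Sum.elim_inl]; exact ⟨hcp, by nlinarith⟩
      · simp only [qq, Sum.elim_inr]; exact ⟨by nlinarith, hcs'⟩
    · rintro (v | v) hv hN
      · have h1 : v ∈ bulk := by
          rw [hmb]
          refine ⟨Binf_mono (by omega) (inl_mem_boxI.1 hv), ?_⟩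
          intro h
          exact hN (Finset.mem_image_of_mem _ (mem_boxF.2 h))
        simp [q, qq, h1]
      · simp [q, qq]
  rw [e0]
  exact e1.trans (e2.trans (e3.le.trans e4))



/-! ### Linking to the measures -/

theorem exists_Binf {d : ℕ} {S : Set (Fin d → ℤ)} (hS : S.Finite) :
    ∃ m : ℕ, S ⊆ Binf d m := by
  induction S, hS using Set.Finite.induction_on with
  | empty => exact ⟨0, by simp⟩
  | @insert a A ha hA ih =>
    obtain ⟨m, hm⟩ := ih
    refine ⟨m + ∑ i, (a i).natAbs, ?_⟩
    rintro z (rfl | hz)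
    · rw [mem_Binf]
      intro i
      have : (z i).natAbs ≤ ∑ i, (z i).natAbs :=
        Finset.single_le_sum (f := fun i => (z i).natAbs) (fun _ _ => Nat.zero_le _)
          (Finset.mem_univ i)
      rw [Nat.cast_add]
      have h2 : ((z i).natAbs : ℤ) ≤ ((∑ i, (z i).natAbs : ℕ) : ℤ) := by exact_mod_cast this
      omega
    · exact Binf_mono (by push_cast; exact le_add_of_nonneg_right (Finset.sum_nonneg fun i _ => abs_nonneg _)) (hm hz)

theorem origin_iff {d : ℕ} {σ : Set (Fin d → ℤ)} :
    OriginInInfiniteCluster σ ↔ ∀ n : ℕ, ∃ t, t ∉ Binf d n ∧ Conn σ 0 t := by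
  constructor
  · rintro ⟨h0, hinf⟩ n
    by_contra hcon
    push Not at hcon
    refine hinf ((Binf_finite d n).subset ?_)
    intro x hx
    have hx' : HasPathJoining σ 0 x := hx
    by_contra h
    exact hcon x h hx'.conn
  · intro h
    refine ⟨?_, ?_⟩
    · obtain ⟨t, -, hc⟩ := h 0
      exact hc.left_mem
    · intro hfin
      obtain ⟨m, hm⟩ := exists_Binf hfin
      obtain ⟨t, ht, hc⟩ := h m
      exact ht (hm hc.hasPathJoining)

theorem cyl_measurable {d : ℕ} (J : Finset (Fin d → ℤ)) (g : (Fin d → ℤ) → Bool) :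
    MeasurableSet {ω : (Fin d → ℤ) → Bool | ∀ v ∈ J, ω v = g v} := by
  have : {ω : (Fin d → ℤ) → Bool | ∀ v ∈ J, ω v = g v}
      = ⋂ v ∈ J, (fun ω : (Fin d → ℤ) → Bool => ω v) ⁻¹' {g v} := by
    ext ω; simp
  rw [this]
  exact Finset.measurableSet_biInter _ fun v _ => measurable_pi_apply v (measurableSet_singleton _)

open Classical in
noncomputable def cylS {d : ℕ} (m : ℤ) (S : Finset ((Fin d → ℤ) ⊕ (Fin d → ℤ))) :
    Set (((Fin d → ℤ) → Bool) × ((Fin d → ℤ) → Bool)) :=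
  {ω | ∀ v ∈ boxF d m, ω v = decide (Sum.inl v ∈ S)} ×ˢ
    {α | ∀ v ∈ boxF d m, α v = decide (Sum.inr v ∈ S)}

theorem ev_union {d : ℕ} (m : ℤ) (G : Set (Fin d → ℤ) → Set (Fin d → ℤ) → Prop)
    (hG : ∀ ω ω' α α', (∀ z ∈ Binf d m, z ∈ ω ↔ z ∈ ω') → (∀ z ∈ Binf d m, z ∈ α ↔ z ∈ α') →
      (G ω α ↔ G ω' α')) :
    letI := Classical.decPred (fun S : Finset ((Fin d → ℤ) ⊕ (Fin d → ℤ)) => G (omS S) (alS S))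
    {x : ((Fin d → ℤ) → Bool) × ((Fin d → ℤ) → Bool) | G (toConfig x.1) (toConfig x.2)}
      = ⋃ S ∈ (boxI d m).powerset.filter (fun S => G (omS S) (alS S)), cylS m S := by
  classical
  ext ⟨ω, α⟩
  simp only [Set.mem_iUnion, exists_prop, Finset.mem_filter, Finset.mem_powerset]
  have key : ∀ S, (ω, α) ∈ cylS m S → (G (omS S) (alS S) ↔ G (toConfig ω) (toConfig α)) := by
    rintro S ⟨h1, h2⟩
    refine hG _ _ _ _ ?_ ?_
    · intro z hz
      have h3 : ω z = decide (Sum.inl z ∈ S) := h1 z (mem_boxF.2 hz)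
      show Sum.inl z ∈ S ↔ ω z = true
      rw [h3]; simp
    · intro z hz
      have h3 : α z = decide (Sum.inr z ∈ S) := h2 z (mem_boxF.2 hz)
      show Sum.inr z ∈ S ↔ α z = true
      rw [h3]; simp
  constructor
  · intro h
    have h' : G (toConfig ω) (toConfig α) := h
    let S : Finset ((Fin d → ℤ) ⊕ (Fin d → ℤ)) :=
      ((boxF d m).filter (fun v => ω v = true)).disjSum ((boxF d m).filter (fun v => α v = true))
    have hS : (ω, α) ∈ cylS m S := by
      refine ⟨?_, ?_⟩
      · intro v hv
        simp [S, hv]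
      · intro v hv
        simp [S, hv]
    refine ⟨S, ⟨?_, (key S hS).2 h'⟩, hS⟩
    rintro (v | v) hv
    · simp only [S, Finset.inl_mem_disjSum, Finset.mem_filter] at hv
      exact inl_mem_boxI.2 (mem_boxF.1 hv.1)
    · simp only [S, Finset.inr_mem_disjSum, Finset.mem_filter] at hv
      exact inr_mem_boxI.2 (mem_boxF.1 hv.1)
  · rintro ⟨S, ⟨-, h⟩, hS⟩
    exact (key S hS).1 h

theorem cylS_measurable {d : ℕ} (m : ℤ) (S : Finset ((Fin d → ℤ) ⊕ (Fin d → ℤ))) :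
    MeasurableSet (cylS m S) := (cyl_measurable _ _).prod (cyl_measurable _ _)

theorem ev_measurable {d : ℕ} (m : ℤ) (G : Set (Fin d → ℤ) → Set (Fin d → ℤ) → Prop)
    (hG : ∀ ω ω' α α', (∀ z ∈ Binf d m, z ∈ ω ↔ z ∈ ω') → (∀ z ∈ Binf d m, z ∈ α ↔ z ∈ α') →
      (G ω α ↔ G ω' α')) :
    MeasurableSet {x : ((Fin d → ℤ) → Bool) × ((Fin d → ℤ) → Bool) |
      G (toConfig x.1) (toConfig x.2)} := by
  rw [ev_union m G hG]
  exact Finset.measurableSet_biUnion _ fun S _ => cylS_measurable m S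

theorem cylS_measure {d : ℕ} {p s : ℝ} (hp : p ∈ Set.Icc (0:ℝ) 1) (hs : s ∈ Set.Icc (0:ℝ) 1)
    {μ ν : Measure ((Fin d → ℤ) → Bool)} (hμ : IsBernoulliProduct d p μ)
    (hν : IsBernoulliProduct d s ν) (m : ℤ) (S : Finset ((Fin d → ℤ) ⊕ (Fin d → ℤ))) :
    (μ.prod ν) (cylS m S) = ENNReal.ofReal (bW (boxI d m) (qq p s) S) := by
  classical
  have := hμ.1
  have := hν.1
  unfold cylS
  rw [Measure.prod_prod, hμ.2, hν.2]
  unfold bW boxI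
  rw [Finset.prod_disjSum, ENNReal.ofReal_mul, ENNReal.ofReal_prod_of_nonneg,
    ENNReal.ofReal_prod_of_nonneg]
  · congr 1
    · refine Finset.prod_congr rfl fun v _ => ?_
      by_cases h : Sum.inl v ∈ S <;> simp [h, qq]
    · refine Finset.prod_congr rfl fun v _ => ?_
      by_cases h : Sum.inr v ∈ S <;> simp [h, qq]
  · intro v _
    have := hs.1; have := hs.2
    split_ifs <;> simp [qq] <;> linarith
  · intro v _
    have := hp.1; have := hp.2
    split_ifs <;> simp [qq] <;> linarith
  · refine Finset.prod_nonneg fun v _ => ?_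
    have := hp.1; have := hp.2
    split_ifs <;> simp [qq] <;> linarith

theorem ev_measure {d : ℕ} {p s : ℝ} (hp : p ∈ Set.Icc (0:ℝ) 1) (hs : s ∈ Set.Icc (0:ℝ) 1)
    {μ ν : Measure ((Fin d → ℤ) → Bool)} (hμ : IsBernoulliProduct d p μ)
    (hν : IsBernoulliProduct d s ν) (m : ℤ) (G : Set (Fin d → ℤ) → Set (Fin d → ℤ) → Prop)
    (hG : ∀ ω ω' α α', (∀ z ∈ Binf d m, z ∈ ω ↔ z ∈ ω') → (∀ z ∈ Binf d m, z ∈ α ↔ z ∈ α') →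
      (G ω α ↔ G ω' α')) :
    (μ.prod ν) {x | G (toConfig x.1) (toConfig x.2)}
      = ENNReal.ofReal (bPr (boxI d m) (qq p s) (fun S => G (omS S) (alS S))) := by
  classical
  have hq : ∀ i ∈ boxI d m, 0 ≤ (qq p s : (Fin d → ℤ) ⊕ (Fin d → ℤ) → ℝ) i ∧ qq p s i ≤ 1 := by
    rintro (v | v) _
    · exact hp
    · exact hs
  rw [ev_union m G hG, measure_biUnion_finset]
  · unfold bPr
    rw [← Finset.sum_filter, ENNReal.ofReal_sum_of_nonneg (fun S _ => bW_nonneg hq S)]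
    refine Finset.sum_congr (by congr) fun S _ => cylS_measure hp hs hμ hν m S
  · intro S hS T hT hST
    rw [Finset.mem_coe, Finset.mem_filter, Finset.mem_powerset] at hS hT
    rw [Function.onFun, Set.disjoint_left]
    rintro ⟨ω, α⟩ ⟨h1, h2⟩ ⟨h3, h4⟩
    apply hST
    ext i
    rcases i with v | v
    · by_cases hv : v ∈ boxF d m
      · have a : ω v = decide (Sum.inl v ∈ S) := h1 v hv
        have b : ω v = decide (Sum.inl v ∈ T) := h3 v hv
        rw [a] at b; simpa using b
      · have hv' : Sum.inl v ∉ boxI d m := fun h => hv (mem_boxF.2 (inl_mem_boxI.1 h))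
        exact ⟨fun h => absurd (hS.1 h) hv', fun h => absurd (hT.1 h) hv'⟩
    · by_cases hv : v ∈ boxF d m
      · have a : α v = decide (Sum.inr v ∈ S) := h2 v hv
        have b : α v = decide (Sum.inr v ∈ T) := h4 v hv
        rw [a] at b; simpa using b
      · have hv' : Sum.inr v ∉ boxI d m := fun h => hv (mem_boxF.2 (inr_mem_boxI.1 h))
        exact ⟨fun h => absurd (hS.1 h) hv', fun h => absurd (hT.1 h) hv'⟩
  · exact fun S _ => cylS_measurable m S

theorem theta_pos_of {d : ℕ} (hd : d = 2 ∨ d = 3) {r : ℤ} (hr : 1 ≤ r)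
    {E0 : Set (Fin d → ℤ) → Set (Fin d → ℤ)}
    (hloc : ∀ ω ω' : Set (Fin d → ℤ), ω ∩ Binf d r = ω' ∩ Binf d r → E0 ω = E0 ω')
    (hrange : ∀ ω : Set (Fin d → ℤ), E0 ω ⊆ Binf d r)
    (hess : ∃ ω : Set (Fin d → ℤ),
      ¬ HasDoublyInfinitePath ω ∧ HasDoublyInfinitePath (ω ∪ E0 ω)) :
    ∃ (k : ℕ), ∀ (c p p' s : ℝ) (_ : 1 ≤ c) (_ : p ≤ p')
      (_ : 1 ≤ c * p) (_ : 1 ≤ c * (1 - p')) (_ : 1 ≤ c * (s/2)) (_ : 1 ≤ c * (1 - s))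
      (_ : (p' - p) * (k * (2 * c) ^ (2 * k)) ≤ s/2)
      (_ : p ∈ Set.Icc (0:ℝ) 1) (_ : p' ∈ Set.Icc (0:ℝ) 1) (_ : s ∈ Set.Icc (0:ℝ) 1)
      (μ : ℝ → Measure ((Fin d → ℤ) → Bool))
      (_ : ∀ p ∈ Set.Icc (0 : ℝ) 1, IsBernoulliProduct d p (μ p))
      (_ : 0 < theta0 (μ p')), 0 < theta E0 (μ p) (μ s) := by
  obtain ⟨R, k, k', hR, hmain⟩ := finite_main hd hr hloc hrange hess
  refine ⟨k, ?_⟩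
  intro c p p' s hc hpp h1 h2 h3 h4 h5 hp hp' hs μ hμ hth
  have hs2 : s/2 ∈ Set.Icc (0:ℝ) 1 := ⟨by have := hs.1; linarith, by have := hs.1; have := hs.2; linarith⟩
  have hμp := hμ p hp
  have hμp' := hμ p' hp'
  have hμs := hμ s hs
  have hμs2 := hμ (s/2) hs2
  have := hμp.1
  have := hμp'.1
  have := hμs.1
  have := hμs2.1
  have hGloc : ∀ n : ℤ, 0 ≤ n → ∀ ω ω' α α' : Set (Fin d → ℤ),
      (∀ z ∈ Binf d (n+1+2*r), z ∈ ω ↔ z ∈ ω') → (∀ z ∈ Binf d (n+1+2*r), z ∈ α ↔ z ∈ α') →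
      (Ev E0 n ω α ↔ Ev E0 n ω' α') := fun n hn ω ω' α α' a b => Ev_local hr hloc hrange hn a b
  -- start
  have hstart : ∀ n : ℤ, 0 ≤ n → theta0 (μ p') ≤
      ENNReal.ofReal (bPr (boxI d (n+1+2*r)) (qq p' (s/2)) (FE E0 n)) := by
    intro n hn
    have e := ev_measure hp' hs2 hμp' hμs2 (n+1+2*r) (Ev E0 n) (hGloc n hn)
    unfold FE
    rw [← e]
    have e2 : theta0 (μ p') = ((μ p').prod (μ (s/2)))
        ({ω | OriginInInfiniteCluster (toConfig ω)} ×ˢ Set.univ) := by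
      rw [Measure.prod_prod, measure_univ, mul_one]; rfl
    rw [e2]
    refine measure_mono ?_
    rintro ⟨ω, α⟩ ⟨hω, -⟩
    have hω' : OriginInInfiniteCluster (toConfig ω) := hω
    obtain ⟨t, ht, hc⟩ := origin_iff.1 hω' n.toNat
    refine ⟨t, ?_, hc.mono ?_⟩
    · rwa [Int.toNat_of_nonneg hn] at ht
    · show toConfig ω ⊆ enhancedConfig E0 (toConfig ω) (toConfig α)
      rw [enh_eq]; exact Set.subset_union_left
  set A : ℕ → Set (((Fin d → ℤ) → Bool) × ((Fin d → ℤ) → Bool)) :=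
    fun m => {x | Ev E0 (m : ℤ) (toConfig x.1) (toConfig x.2)} with hA
  have hcpos : (0:ℝ) < c ^ k' := by positivity
  have hAm : ∀ m, theta0 (μ p') ≤ ENNReal.ofReal (c ^ k') * ((μ p).prod (μ s)) (A m) := by
    intro m
    have a1 := hstart (m+1+2*r+R) (by omega)
    have a2 := hmain c p p' s hc hpp h1 h2 h3 h4 h5 m (by positivity)
    have a3 := ev_measure hp hs hμp hμs (m+1+2*r) (Ev E0 m) (hGloc m (by positivity))
    have a4 : ((μ p).prod (μ s)) (A m) = _ := a3
    rw [a4, ← ENNReal.ofReal_mul hcpos.le]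
    exact a1.trans (ENNReal.ofReal_le_ofReal a2)
  have hanti : Antitone A := by
    intro m m' hmm x hx
    exact Ev_anti (by exact_mod_cast hmm) hx
  have hmeas : ∀ m, MeasurableSet (A m) := fun m =>
    ev_measurable (m+1+2*r) (Ev E0 m) (hGloc m (by positivity))
  have hlim := tendsto_measure_iInter_atTop (μ := (μ p).prod (μ s)) (s := A)
    (fun m => (hmeas m).nullMeasurableSet) hanti ⟨0, measure_ne_top _ _⟩
  have hle : theta0 (μ p') ≤ ENNReal.ofReal (c ^ k') * ((μ p).prod (μ s)) (⋂ m, A m) := by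
    refine ge_of_tendsto (ENNReal.Tendsto.const_mul hlim (Or.inr ENNReal.ofReal_ne_top))
      (Filter.Eventually.of_forall hAm)
  have hpos : 0 < ((μ p).prod (μ s)) (⋂ m, A m) := by
    rw [pos_iff_ne_zero]
    intro h0
    rw [h0, mul_zero] at hle
    exact absurd hth (not_lt.2 hle)
  refine hpos.trans_le (measure_mono ?_)
  intro x hx
  show OriginInInfiniteCluster (enhancedConfig E0 (toConfig x.1) (toConfig x.2))
  rw [origin_iff]
  intro n
  exact Set.mem_iInter.1 hx n



/-! ### The critical probability is positive -/

def posW {d n : ℕ} (u : Fin n → Fin d × Bool) : ℕ → Fin d → ℤ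
  | 0 => 0
  | k + 1 => if h : k < n then mv (posW u k) (u ⟨k, h⟩).1 (if (u ⟨k, h⟩).2 then 1 else -1)
      else posW u k

theorem exists_word {d : ℕ} {σ : Set (Fin d → ℤ)} (h : OriginInInfiniteCluster σ) (n : ℕ) :
    ∃ u : Fin n → Fin d × Bool,
      Set.InjOn (posW u) (Finset.range (n+1)) ∧ ∀ k ≤ n, posW u k ∈ σ := by
  obtain ⟨t, ht, hc⟩ := origin_iff.1 h n
  obtain ⟨N, g, hw, g0, gN, hinj⟩ := hc.exists_path
  have hN : n < N := by
    by_contra hcon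
    push Not at hcon
    apply ht
    rw [mem_Binf]
    intro i
    have := Conn.dist hw i N le_rfl
    rw [gN, g0] at this
    simp only [Pi.zero_apply] at this
    omega
  have hstep : ∀ k : Fin n, ∃ x : Fin d × Bool, g (k+1) = mv (g k) x.1 (if x.2 then 1 else -1) := by
    intro k
    obtain ⟨i, e, he, h1⟩ := (adj_iff _ _).1 (hw.2 k (by omega))
    rcases he with rfl | rfl
    · exact ⟨(i, true), by simpa using h1⟩
    · exact ⟨(i, false), by simpa using h1⟩
  choose u hu using hstep
  have hpos : ∀ k ≤ n, posW u k = g k := by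
    intro k
    induction k with
    | zero => intro _; rw [g0]; rfl
    | succ k ih =>
      intro hk
      have h1 : k < n := by omega
      rw [posW, dif_pos h1, ih (by omega), hu ⟨k, h1⟩]
  refine ⟨u, ?_, ?_⟩
  · intro a ha b hb hab
    simp only [Finset.coe_range, Set.mem_Iio] at ha hb
    rw [hpos a (by omega), hpos b (by omega)] at hab
    exact hinj a (by omega) b (by omega) hab
  · intro k hk
    rw [hpos k hk]; exact hw.1 k (by omega)

theorem theta0_zero {d : ℕ} (hd : d = 2 ∨ d = 3) {p : ℝ} (hp0 : 0 ≤ p) (hp : p < 1/8)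
    {μ : Measure ((Fin d → ℤ) → Bool)} (hμ : IsBernoulliProduct d p μ) : theta0 μ = 0 := by
  classical
  have key : ∀ n : ℕ, theta0 μ ≤ ENNReal.ofReal ((3/4 : ℝ) ^ n) := by
    intro n
    let T : Finset (Fin n → Fin d × Bool) :=
      Finset.univ.filter (fun u => Set.InjOn (posW u) (Finset.range (n+1)))
    have h1 : {ω : (Fin d → ℤ) → Bool | OriginInInfiniteCluster (toConfig ω)} ⊆
        ⋃ u ∈ T, {ω | ∀ v ∈ (Finset.range (n+1)).image (posW u), ω v = (fun _ => true) v} := by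
      intro ω hω
      obtain ⟨u, hu1, hu2⟩ := exists_word hω n
      simp only [Set.mem_iUnion, exists_prop]
      refine ⟨u, by simp [T]; simpa using hu1, ?_⟩
      intro v hv
      obtain ⟨k, hk, rfl⟩ := Finset.mem_image.1 hv
      exact hu2 k (by simpa [Nat.lt_succ_iff] using hk)
    have h2 : ∀ u ∈ T, μ {ω | ∀ v ∈ (Finset.range (n+1)).image (posW u), ω v = (fun _ => true) v}
        = ENNReal.ofReal (p ^ (n+1)) := by
      intro u hu
      rw [hμ.2]
      simp only [if_true, Finset.prod_const]
      rw [Finset.card_image_of_injOn (Finset.mem_filter.1 hu).2, Finset.card_range,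
        ENNReal.ofReal_pow hp0]
    calc theta0 μ ≤ _ := measure_mono h1
      _ ≤ ∑ u ∈ T, _ := measure_biUnion_finset_le T _
      _ = ∑ u ∈ T, ENNReal.ofReal (p ^ (n+1)) := Finset.sum_congr rfl h2
      _ = (T.card : ENNReal) * ENNReal.ofReal (p ^ (n+1)) := by
          rw [Finset.sum_const, nsmul_eq_mul]
      _ = ENNReal.ofReal ((T.card : ℝ) * p ^ (n+1)) := by
          rw [ENNReal.ofReal_mul (by positivity), ENNReal.ofReal_natCast]
      _ ≤ _ := by
          refine ENNReal.ofReal_le_ofReal ?_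
          have h3 : T.card ≤ 6 ^ n := by
            refine (Finset.card_le_univ T).trans ?_
            rw [Fintype.card_fun, Fintype.card_prod, Fintype.card_fin, Fintype.card_fin,
              Fintype.card_bool]
            refine Nat.pow_le_pow_left ?_ n
            omega
          have h4 : (T.card : ℝ) ≤ 6 ^ n := by exact_mod_cast h3
          calc (T.card : ℝ) * p ^ (n+1) ≤ 6 ^ n * (p ^ n * 1) := by
                rw [pow_succ]
                refine mul_le_mul h4 ?_ (by positivity) (by positivity)
                exact mul_le_mul_of_nonneg_left (by linarith) (by positivity)
            _ = (6 * p) ^ n := by rw [mul_pow]; ring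
            _ ≤ (3/4) ^ n := by
                refine pow_le_pow_left₀ (by positivity) (by linarith) n
  have hlim : Filter.Tendsto (fun n : ℕ => ENNReal.ofReal ((3/4 : ℝ) ^ n)) Filter.atTop (nhds 0) := by
    have := ENNReal.tendsto_ofReal
      (tendsto_pow_atTop_nhds_zero_of_lt_one (r := (3/4:ℝ)) (by norm_num) (by norm_num))
    simpa using this
  exact le_antisymm (ge_of_tendsto' hlim key) (zero_le)



/-! ### The critical probability is less than one -/

def GG (ω : Set (ℤ × ℤ)) : ℕ → ℤ → ℤ → Prop
  | 0, a, b => (a, b) ∈ ω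
  | k + 1, a, b => ∀ i j i' j' : Fin 3, ¬ GG ω k (3*a+i.val) (3*b+j.val) →
      ¬ GG ω k (3*a+i'.val) (3*b+j'.val) → i = i' ∧ j = j'

def CC (ω : Set (ℤ × ℤ)) : ℕ → ℤ → ℤ → Set (ℤ × ℤ)
  | 0, a, b => {(a, b)}
  | k + 1, a, b => {x | ∃ i j : Fin 3, GG ω k (3*a+i.val) (3*b+j.val) ∧
      x ∈ CC ω k (3*a+i.val) (3*b+j.val)}

theorem grid_conn {α : Type} (f : Fin 3 → Fin 3 → α) (g : Fin 3 → Fin 3 → Prop)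
    (h1 : ∀ i j i' j', ¬ g i j → ¬ g i' j' → i = i' ∧ j = j')
    (h2 : ∀ i j, g i j → g (i+1) j → i ≠ 2 → f i j = f (i+1) j)
    (h3 : ∀ i j, g i j → g i (j+1) → j ≠ 2 → f i j = f i (j+1)) :
    ∀ i j i' j', g i j → g i' j' → f i j = f i' j' := by
  have e1 : (0 : Fin 3) + 1 = 1 := rfl
  have e2 : (1 : Fin 3) + 1 = 2 := rfl
  have a00 := h2 0 0; have a01 := h2 0 1; have a02 := h2 0 2
  have a10 := h2 1 0; have a11 := h2 1 1; have a12 := h2 1 2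
  have b00 := h3 0 0; have b10 := h3 1 0; have b20 := h3 2 0
  have b01 := h3 0 1; have b11 := h3 1 1; have b21 := h3 2 1
  simp only [e1, e2] at a00 a01 a02 a10 a11 a12 b00 b10 b20 b01 b11 b21
  clear h2 h3
  have hall : ∃ x y : Fin 3, ∀ i j, (i ≠ x ∨ j ≠ y) → g i j := by
    by_cases h : ∀ i j, g i j
    · exact ⟨0, 0, fun i j _ => h i j⟩
    · push Not at h
      obtain ⟨x, y, hxy⟩ := h
      refine ⟨x, y, fun i j hij => ?_⟩
      by_contra hg
      have h4 := h1 i j x y hg hxy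
      exact hij.elim (fun h => h h4.1) (fun h => h h4.2)
  obtain ⟨x, y, hxy⟩ := hall
  clear h1
  suffices hs : ∃ c, ∀ i j, g i j → f i j = c by
    obtain ⟨c, hc⟩ := hs
    intro i j i' j' h h'
    rw [hc i j h, hc i' j' h']
  have hg : (x = 0 ∨ x = 1 ∨ x = 2) ∧ (y = 0 ∨ y = 1 ∨ y = 2) := by
    constructor
    · fin_cases x <;> simp
    · fin_cases y <;> simp
  suffices hs : ∃ c, (g 0 0 → f 0 0 = c) ∧ (g 0 1 → f 0 1 = c) ∧ (g 0 2 → f 0 2 = c) ∧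
      (g 1 0 → f 1 0 = c) ∧ (g 1 1 → f 1 1 = c) ∧ (g 1 2 → f 1 2 = c) ∧
      (g 2 0 → f 2 0 = c) ∧ (g 2 1 → f 2 1 = c) ∧ (g 2 2 → f 2 2 = c) by
    obtain ⟨c, c1, c2, c3, c4, c5, c6, c7, c8, c9⟩ := hs
    refine ⟨c, fun i j => ?_⟩
    fin_cases i <;> fin_cases j <;> assumption
  have n01 : (0 : Fin 3) ≠ 1 := by decide
  have n02 : (0 : Fin 3) ≠ 2 := by decide
  have n12 : (1 : Fin 3) ≠ 2 := by decide
  have g00 := hxy 0 0; have g01 := hxy 0 1; have g02 := hxy 0 2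
  have g10 := hxy 1 0; have g11 := hxy 1 1; have g12 := hxy 1 2
  have g20 := hxy 2 0; have g21 := hxy 2 1; have g22 := hxy 2 2
  clear hxy
  generalize g 0 0 = p00 at *
  generalize g 0 1 = p01 at *
  generalize g 0 2 = p02 at *
  generalize g 1 0 = p10 at *
  generalize g 1 1 = p11 at *
  generalize g 1 2 = p12 at *
  generalize g 2 0 = p20 at *
  generalize g 2 1 = p21 at *
  generalize g 2 2 = p22 at *
  generalize f 0 0 = f00 at *
  generalize f 0 1 = f01 at *
  generalize f 0 2 = f02 at *
  generalize f 1 0 = f10 at *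
  generalize f 1 1 = f11 at *
  generalize f 1 2 = f12 at *
  generalize f 2 0 = f20 at *
  generalize f 2 1 = f21 at *
  generalize f 2 2 = f22 at *
  obtain ⟨rfl | rfl | rfl, rfl | rfl | rfl⟩ := hg
  · refine ⟨f22, ?_⟩; grind
  all_goals refine ⟨f00, ?_⟩; grind



def pt {d : ℕ} (x : ℤ × ℤ) : Fin d → ℤ :=
  fun i => if i.val = 0 then x.1 else if i.val = 1 then x.2 else 0

theorem pt_adj1 {d : ℕ} (hd : 2 ≤ d) (a b : ℤ) : Adj (pt (d := d) (a, b)) (pt (a+1, b)) := by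
  refine adj_of_coord ⟨0, by omega⟩ (Or.inl (by simp [pt])) ?_
  intro j hj
  have : j.val ≠ 0 := fun h => hj (Fin.ext h)
  simp [pt, this]

theorem pt_adj2 {d : ℕ} (hd : 2 ≤ d) (a b : ℤ) : Adj (pt (d := d) (a, b)) (pt (a, b+1)) := by
  refine adj_of_coord ⟨1, by omega⟩ (Or.inl (by simp [pt])) ?_
  intro j hj
  have : j.val ≠ 1 := fun h => hj (Fin.ext h)
  simp [pt, this]

theorem pt_inj {d : ℕ} (hd : 2 ≤ d) : Function.Injective (pt (d := d)) := by
  rintro ⟨a, b⟩ ⟨a', b'⟩ h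
  have h0 := congrFun h ⟨0, by omega⟩
  have h1 := congrFun h ⟨1, by omega⟩
  simp [pt] at h0 h1
  rw [h0, h1]

theorem CC_nonempty (ω : Set (ℤ × ℤ)) : ∀ (k : ℕ) (a b : ℤ), GG ω k a b → (CC ω k a b).Nonempty := by
  intro k
  induction k with
  | zero => intro a b _; exact ⟨_, rfl⟩
  | succ k ih =>
    intro a b h
    by_cases h0 : GG ω k (3*a+(0:Fin 3).val) (3*b+(0:Fin 3).val)
    · obtain ⟨x, hx⟩ := ih _ _ h0
      exact ⟨x, 0, 0, h0, hx⟩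
    · by_cases h1 : GG ω k (3*a+(0:Fin 3).val) (3*b+(1:Fin 3).val)
      · obtain ⟨x, hx⟩ := ih _ _ h1
        exact ⟨x, 0, 1, h1, hx⟩
      · exact absurd (h 0 0 0 1 h0 h1).2 (by decide)

theorem CC_conn {d : ℕ} (hd : 2 ≤ d) (σ : Set (Fin d → ℤ)) (k : ℕ) :
    (∀ a b, GG (pt ⁻¹' σ) k a b → ∀ x ∈ CC (pt ⁻¹' σ) k a b, ∀ y ∈ CC (pt ⁻¹' σ) k a b,
      Conn σ (pt x) (pt y)) ∧
    (∀ a b, GG (pt ⁻¹' σ) k a b → GG (pt ⁻¹' σ) k (a+1) b → ∀ x ∈ CC (pt ⁻¹' σ) k a b,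
      ∀ y ∈ CC (pt ⁻¹' σ) k (a+1) b, Conn σ (pt x) (pt y)) ∧
    (∀ a b, GG (pt ⁻¹' σ) k a b → GG (pt ⁻¹' σ) k a (b+1) → ∀ x ∈ CC (pt ⁻¹' σ) k a b,
      ∀ y ∈ CC (pt ⁻¹' σ) k a (b+1), Conn σ (pt x) (pt y)) := by
  set ω : Set (ℤ × ℤ) := pt ⁻¹' σ with hω
  induction k with
  | zero =>
    refine ⟨?_, ?_, ?_⟩
    · intro a b h x hx y hy
      have hx' : x = (a, b) := hx
      have hy' : y = (a, b) := hy
      rw [hx', hy']; exact Conn.refl h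
    · intro a b h h' x hx y hy
      have hx' : x = (a, b) := hx
      have hy' : y = (a+1, b) := hy
      rw [hx', hy']; exact Conn.single h h' (pt_adj1 hd a b)
    · intro a b h h' x hx y hy
      have hx' : x = (a, b) := hx
      have hy' : y = (a, b+1) := hy
      rw [hx', hy']; exact Conn.single h h' (pt_adj2 hd a b)
  | succ k ih =>
    obtain ⟨ih1, ih2, ih3⟩ := ih
    have H1 : ∀ a b, GG ω (k+1) a b → ∀ x ∈ CC ω (k+1) a b, ∀ y ∈ CC ω (k+1) a b,
        Conn σ (pt x) (pt y) := by
      rintro a b h x ⟨i, j, hg, hx⟩ y ⟨i', j', hg', hy⟩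
      have key : ∀ a b a' b', GG ω k a b → GG ω k a' b' →
          (∀ x ∈ CC ω k a b, ∀ y ∈ CC ω k a' b', Conn σ (pt x) (pt y)) →
          {z | ∃ x ∈ CC ω k a b, Conn σ (pt x) z} = {z | ∃ x ∈ CC ω k a' b', Conn σ (pt x) z} := by
        intro a b a' b' g g' hc
        obtain ⟨x0, hx0⟩ := CC_nonempty ω k a b g
        obtain ⟨y0, hy0⟩ := CC_nonempty ω k a' b' g'
        ext z
        constructor
        · rintro ⟨x, hx, hz⟩
          exact ⟨y0, hy0, (hc x hx y0 hy0).symm.trans hz⟩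
        · rintro ⟨x, hx, hz⟩
          exact ⟨x0, hx0, (hc x0 hx0 x hx).trans hz⟩
      have hsucc : ∀ i : Fin 3, i ≠ 2 → (((i + 1 : Fin 3).val : ℕ) : ℤ) = i.val + 1 := by
        intro i hi
        fin_cases i
        · rfl
        · rfl
        · exact absurd rfl hi
      have := grid_conn (fun i j : Fin 3 =>
        {z | ∃ x ∈ CC ω k (3*a+i.val) (3*b+j.val), Conn σ (pt x) z})
        (fun i j => GG ω k (3*a+i.val) (3*b+j.val)) h
        (by
          intro i j g1 g2 hi
          refine key _ _ _ _ g1 g2 ?_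
          simp only [hsucc i hi, ← add_assoc] at g2 ⊢
          exact ih2 _ _ g1 g2)
        (by
          intro i j g1 g2 hj
          refine key _ _ _ _ g1 g2 ?_
          simp only [hsucc j hj, ← add_assoc] at g2 ⊢
          exact ih3 _ _ g1 g2) i j i' j' hg hg'
      have hmem : pt y ∈ {z | ∃ x ∈ CC ω k (3*a+i'.val) (3*b+j'.val), Conn σ (pt x) z} :=
        ⟨y, hy, ih1 _ _ hg' y hy y hy⟩
      rw [← this] at hmem
      obtain ⟨x0, hx0, hc⟩ := hmem
      exact (ih1 _ _ hg x hx x0 hx0).trans hc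
    have pick : ∀ P Q : Fin 3 → Prop, (∀ i j, ¬ P i → ¬ P j → i = j) →
        (∀ i j, ¬ Q i → ¬ Q j → i = j) → ∃ j, P j ∧ Q j := by
      intro P Q hP hQ
      by_contra hcon
      have c : ∀ i, P i → Q i → False := fun i h h' => hcon ⟨i, h, h'⟩
      have p01 : P 0 ∨ P 1 := by
        by_contra hh; rw [not_or] at hh; exact absurd (hP 0 1 hh.1 hh.2) (by decide)
      have p02 : P 0 ∨ P 2 := by
        by_contra hh; rw [not_or] at hh; exact absurd (hP 0 2 hh.1 hh.2) (by decide)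
      have p12 : P 1 ∨ P 2 := by
        by_contra hh; rw [not_or] at hh; exact absurd (hP 1 2 hh.1 hh.2) (by decide)
      have q01 : Q 0 ∨ Q 1 := by
        by_contra hh; rw [not_or] at hh; exact absurd (hQ 0 1 hh.1 hh.2) (by decide)
      have q02 : Q 0 ∨ Q 2 := by
        by_contra hh; rw [not_or] at hh; exact absurd (hQ 0 2 hh.1 hh.2) (by decide)
      have q12 : Q 1 ∨ Q 2 := by
        by_contra hh; rw [not_or] at hh; exact absurd (hQ 1 2 hh.1 hh.2) (by decide)
      have c0 := c 0
      have c1 := c 1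
      have c2 := c 2
      clear c hcon hP hQ H1 ih1 ih2 ih3
      tauto
    refine ⟨H1, ?_, ?_⟩
    · intro a b h h' x hx y hy
      obtain ⟨j, hj1, hj2⟩ := pick (fun j => GG ω k (3*a+(2:Fin 3).val) (3*b+j.val))
        (fun j => GG ω k (3*(a+1)+(0:Fin 3).val) (3*b+j.val))
        (fun i j hi hj => (h 2 i 2 j hi hj).2) (fun i j hi hj => (h' 0 i 0 j hi hj).2)
      obtain ⟨x1, hx1⟩ := CC_nonempty ω k _ _ hj1
      obtain ⟨y1, hy1⟩ := CC_nonempty ω k _ _ hj2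
      have c1 := H1 a b h x hx x1 ⟨2, j, hj1, hx1⟩
      have c2 := H1 (a+1) b h' y1 ⟨0, j, hj2, hy1⟩ y hy
      have e : (3*(a+1)+(0:Fin 3).val : ℤ) = 3*a+(2:Fin 3).val + 1 := by simp; ring
      rw [e] at hj2 hy1
      exact c1.trans ((ih2 _ _ hj1 hj2 x1 hx1 y1 hy1).trans c2)
    · intro a b h h' x hx y hy
      obtain ⟨j, hj1, hj2⟩ := pick (fun j => GG ω k (3*a+j.val) (3*b+(2:Fin 3).val))
        (fun j => GG ω k (3*a+j.val) (3*(b+1)+(0:Fin 3).val))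
        (fun i j hi hj => (h i 2 j 2 hi hj).1) (fun i j hi hj => (h' i 0 j 0 hi hj).1)
      obtain ⟨x1, hx1⟩ := CC_nonempty ω k _ _ hj1
      obtain ⟨y1, hy1⟩ := CC_nonempty ω k _ _ hj2
      have c1 := H1 a b h x hx x1 ⟨j, 2, hj1, hx1⟩
      have c2 := H1 a (b+1) h' y1 ⟨j, 0, hj2, hy1⟩ y hy
      have e : (3*(b+1)+(0:Fin 3).val : ℤ) = 3*b+(2:Fin 3).val + 1 := by simp; ring
      rw [e] at hj2 hy1
      exact c1.trans ((ih3 _ _ hj1 hj2 x1 hx1 y1 hy1).trans c2)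

theorem CC_far (ω : Set (ℤ × ℤ)) : ∀ (k : ℕ) (a b : ℤ), ∀ x ∈ CC ω k a b, 3 ^ k * a ≤ x.1 := by
  intro k
  induction k with
  | zero =>
    intro a b x hx
    have hx' : x = (a, b) := hx
    rw [hx']; simp
  | succ k ih =>
    rintro a b x ⟨i, j, -, hx⟩
    have := ih _ _ x hx
    have h2 : (0:ℤ) ≤ 3 ^ k * (i.val : ℤ) := by positivity
    rw [pow_succ]
    nlinarith

theorem origin_of_good {d : ℕ} (hd : 2 ≤ d) (σ : Set (Fin d → ℤ))
    (h : ∀ k, GG (pt ⁻¹' σ) k 0 0) : OriginInInfiniteCluster σ := by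
  rw [origin_iff]
  intro n
  set ω : Set (ℤ × ℤ) := pt ⁻¹' σ with hω
  have h0 : ∀ k, ((0, 0) : ℤ × ℤ) ∈ CC ω k 0 0 := by
    intro k
    induction k with
    | zero => exact rfl
    | succ k ih => exact ⟨0, 0, by simpa using h k, by simpa using ih⟩
  have hex : ∃ j : Fin 3, GG ω n (3*0+(2:Fin 3).val) (3*0+j.val) := by
    by_contra hcon
    push Not at hcon
    exact absurd (h (n+1) 2 0 2 1 (hcon 0) (hcon 1)).2 (by decide)
  obtain ⟨j, hj⟩ := hex
  obtain ⟨x, hx⟩ := CC_nonempty ω n _ _ hj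
  have hc := (CC_conn hd σ (n+1)).1 0 0 (h (n+1)) (0,0) (h0 (n+1)) x ⟨2, j, hj, hx⟩
  have hpt : (pt (0, 0) : Fin d → ℤ) = 0 := by
    funext i; simp [pt]
  rw [hpt] at hc
  refine ⟨pt x, ?_, hc⟩
  intro hB
  rw [mem_Binf] at hB
  have h1 := (hB ⟨0, by omega⟩).2
  have h2 := CC_far ω n _ _ x hx
  have h3 : (n : ℤ) < 3 ^ n := by exact_mod_cast Nat.lt_pow_self (by norm_num : 1 < 3)
  have e : (pt x : Fin d → ℤ) ⟨0, by omega⟩ = x.1 := by simp [pt]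
  rw [e] at h1
  simp at h2
  omega

theorem witness (k : ℕ) : ∀ a b : ℤ, ∃ T : Finset (Finset (ℤ × ℤ)),
    T.card * 81 ≤ 81 ^ (2 ^ k) ∧
    (∀ A ∈ T, A.card = 2 ^ k ∧ ∀ x ∈ A, (3 ^ k * a ≤ x.1 ∧ x.1 < 3 ^ k * (a+1)) ∧
      (3 ^ k * b ≤ x.2 ∧ x.2 < 3 ^ k * (b+1))) ∧
    ∀ ω : Set (ℤ × ℤ), ¬ GG ω k a b → ∃ A ∈ T, ∀ x ∈ A, x ∉ ω := by
  classical
  induction k with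
  | zero =>
    intro a b
    refine ⟨{{(a, b)}}, by simp, ?_, ?_⟩
    · intro A hA
      rw [Finset.mem_singleton] at hA
      subst hA
      simp
    · intro ω h
      exact ⟨{(a, b)}, by simp, by intro x hx; rw [Finset.mem_singleton] at hx; rw [hx]; exact h⟩
  | succ k ih =>
    intro a b
    choose T hT1 hT2 hT3 using ih
    let P : Finset ((Fin 3 × Fin 3) × (Fin 3 × Fin 3)) := Finset.univ.filter (fun u => u.1 ≠ u.2)
    let t : Fin 3 × Fin 3 → Finset (Finset (ℤ × ℤ)) := fun u => T (3*a+u.1.val) (3*b+u.2.val)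
    refine ⟨P.biUnion fun u => (t u.1 ×ˢ t u.2).image (fun x => x.1 ∪ x.2), ?_, ?_, ?_⟩
    · have h1 : ∀ u ∈ P, ((t u.1 ×ˢ t u.2).image (fun x => x.1 ∪ x.2)).card * (81 * 81) ≤
          81 ^ (2 ^ (k+1)) := by
        intro u _
        have a1 := hT1 (3*a+u.1.1.val) (3*b+u.1.2.val)
        have a2 := hT1 (3*a+u.2.1.val) (3*b+u.2.2.val)
        calc _ ≤ ((t u.1).card * (t u.2).card) * (81 * 81) := by
              refine Nat.mul_le_mul_right _ ?_
              rw [← Finset.card_product]; exact Finset.card_image_le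
          _ = ((t u.1).card * 81) * ((t u.2).card * 81) := by ring
          _ ≤ 81 ^ (2 ^ k) * 81 ^ (2 ^ k) := Nat.mul_le_mul a1 a2
          _ = _ := by rw [← pow_add]; congr 1; rw [pow_succ]; ring
      have hP : P.card ≤ 81 := by
        refine (Finset.card_le_univ P).trans ?_
        simp
      have h2 : (P.biUnion fun u => (t u.1 ×ˢ t u.2).image (fun x => x.1 ∪ x.2)).card * (81 * 81)
          ≤ 81 * 81 ^ (2 ^ (k+1)) := by
        calc _ ≤ (∑ u ∈ P, ((t u.1 ×ˢ t u.2).image (fun x => x.1 ∪ x.2)).card) * (81 * 81) :=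
              Nat.mul_le_mul_right _ Finset.card_biUnion_le
          _ = ∑ u ∈ P, ((t u.1 ×ˢ t u.2).image (fun x => x.1 ∪ x.2)).card * (81 * 81) := by
              rw [Finset.sum_mul]
          _ ≤ ∑ u ∈ P, 81 ^ (2 ^ (k+1)) := Finset.sum_le_sum h1
          _ = P.card * 81 ^ (2 ^ (k+1)) := by rw [Finset.sum_const, smul_eq_mul]
          _ ≤ _ := Nat.mul_le_mul_right _ hP
      generalize (P.biUnion fun u => (t u.1 ×ˢ t u.2).image (fun x => x.1 ∪ x.2)).card = X at *
      generalize (81:ℕ) ^ (2 ^ (k+1)) = Y at *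
      omega
    · intro A hA
      rw [Finset.mem_biUnion] at hA
      obtain ⟨u, hu, hA⟩ := hA
      rw [Finset.mem_image] at hA
      obtain ⟨⟨A1, A2⟩, hA12, rfl⟩ := hA
      rw [Finset.mem_product] at hA12
      obtain ⟨b1, c1⟩ := hT2 _ _ A1 hA12.1
      obtain ⟨b2, c2⟩ := hT2 _ _ A2 hA12.2
      have hne : u.1 ≠ u.2 := (Finset.mem_filter.1 hu).2
      have h3 : (0:ℤ) < 3 ^ k := by positivity
      constructor
      · show (A1 ∪ A2).card = _
        rw [Finset.card_union_of_disjoint, b1, b2, pow_succ]; · ring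
        rw [Finset.disjoint_left]
        intro x hx1 hx2
        have d1 := c1 x hx1
        have d2 := c2 x hx2
        apply hne
        have sep : ∀ y m m' : ℤ, 3 ^ k * m ≤ y → y < 3 ^ k * (m+1) → 3 ^ k * m' ≤ y →
            y < 3 ^ k * (m'+1) → m = m' := by
          intro y m m' e1 e2 e3 e4
          have f1 : m < m' + 1 := lt_of_mul_lt_mul_left (e1.trans_lt e4) h3.le
          have f2 : m' < m + 1 := lt_of_mul_lt_mul_left (e3.trans_lt e2) h3.le
          omega
        have g1 := sep _ _ _ d1.1.1 d1.1.2 d2.1.1 d2.1.2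
        have g2 := sep _ _ _ d1.2.1 d1.2.2 d2.2.1 d2.2.2
        refine Prod.ext (Fin.ext ?_) (Fin.ext ?_) <;> omega
      · intro x hx
        have gen : ∀ (y m : ℤ) (i : Fin 3), 3 ^ k * (3 * m + i.val) ≤ y →
            y < 3 ^ k * (3 * m + i.val + 1) → 3 ^ (k+1) * m ≤ y ∧ y < 3 ^ (k+1) * (m+1) := by
          intro y m i e1 e2
          have hi : (i.val : ℤ) ≤ 2 := by have := i.isLt; omega
          have hi0 : (0:ℤ) ≤ i.val := by positivity
          rw [pow_succ]
          constructor <;> nlinarith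
        rcases Finset.mem_union.1 hx with hx | hx
        · have d1 := c1 x hx
          exact ⟨gen _ _ _ d1.1.1 d1.1.2, gen _ _ _ d1.2.1 d1.2.2⟩
        · have d1 := c2 x hx
          exact ⟨gen _ _ _ d1.1.1 d1.1.2, gen _ _ _ d1.2.1 d1.2.2⟩
    · intro ω h
      have h' : ¬ ∀ i j i' j' : Fin 3, ¬ GG ω k (3*a+i.val) (3*b+j.val) →
        ¬ GG ω k (3*a+i'.val) (3*b+j'.val) → i = i' ∧ j = j' := h
      push Not at h'
      obtain ⟨i, j, i', j', g1, g2, hne⟩ := h'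
      obtain ⟨A1, hA1, e1⟩ := hT3 _ _ ω g1
      obtain ⟨A2, hA2, e2⟩ := hT3 _ _ ω g2
      refine ⟨A1 ∪ A2, ?_, ?_⟩
      · rw [Finset.mem_biUnion]
        refine ⟨((i, j), (i', j')), ?_, ?_⟩
        · rw [Finset.mem_filter]
          refine ⟨Finset.mem_univ _, ?_⟩
          intro he
          have he1 : (i, j) = (i', j') := he
          rw [Prod.mk.injEq] at he1
          exact hne he1.1 he1.2
        · exact Finset.mem_image.2 ⟨(A1, A2), Finset.mem_product.2 ⟨hA1, hA2⟩, rfl⟩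
      · intro x hx
        rcases Finset.mem_union.1 hx with hx | hx
        · exact e1 x hx
        · exact e2 x hx

theorem theta0_pos {d : ℕ} (hd : 2 ≤ d)
    {μ : Measure ((Fin d → ℤ) → Bool)} (hμ : IsBernoulliProduct d (323/324) μ) :
    0 < theta0 μ := by
  classical
  have := hμ.1
  choose T hT1 hT2 hT3 using fun k => witness k 0 0
  let B : ℕ → Set ((Fin d → ℤ) → Bool) := fun k =>
    ⋃ A ∈ T k, {ω | ∀ v ∈ A.image (pt (d := d)), ω v = (fun _ => false) v}
  have hB : ∀ k, μ (B k) ≤ ENNReal.ofReal ((1/4 : ℝ) ^ (k+1)) := by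
    intro k
    have h2 : ∀ A ∈ T k, μ {ω | ∀ v ∈ A.image (pt (d := d)), ω v = (fun _ => false) v}
        = ENNReal.ofReal ((1/324 : ℝ) ^ (2 ^ k)) := by
      intro A hA
      rw [hμ.2]
      simp only [Bool.false_eq_true, if_false, Finset.prod_const]
      rw [Finset.card_image_of_injective _ (pt_inj hd), (hT2 k A hA).1,
        ENNReal.ofReal_pow (by norm_num)]
      norm_num
    calc μ (B k) ≤ ∑ A ∈ T k, _ := measure_biUnion_finset_le (T k) _
      _ = ∑ A ∈ T k, ENNReal.ofReal ((1/324 : ℝ) ^ (2 ^ k)) := Finset.sum_congr rfl h2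
      _ = ((T k).card : ENNReal) * ENNReal.ofReal ((1/324 : ℝ) ^ (2 ^ k)) := by
          rw [Finset.sum_const, nsmul_eq_mul]
      _ = ENNReal.ofReal (((T k).card : ℝ) * (1/324 : ℝ) ^ (2 ^ k)) := by
          rw [ENNReal.ofReal_mul (by positivity), ENNReal.ofReal_natCast]
      _ ≤ _ := by
          refine ENNReal.ofReal_le_ofReal ?_
          have h3 : (T k).card ≤ 81 ^ (2 ^ k) := (Nat.le_mul_of_pos_right _ (by norm_num)).trans (hT1 k)
          have h4 : ((T k).card : ℝ) ≤ 81 ^ (2 ^ k) := by exact_mod_cast h3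
          calc ((T k).card : ℝ) * (1/324 : ℝ) ^ (2 ^ k) ≤ 81 ^ (2 ^ k) * (1/324 : ℝ) ^ (2 ^ k) :=
                mul_le_mul_of_nonneg_right h4 (by positivity)
            _ = (1/4) ^ (2 ^ k) := by rw [← mul_pow]; norm_num
            _ ≤ _ := pow_le_pow_of_le_one (by norm_num) (by norm_num) (Nat.lt_two_pow_self)
  have hcov : (Set.univ : Set ((Fin d → ℤ) → Bool)) ⊆
      {ω | OriginInInfiniteCluster (toConfig ω)} ∪ ⋃ k, B k := by
    intro ω _
    by_cases h : ∀ k, GG (pt ⁻¹' (toConfig ω)) k 0 0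
    · exact Or.inl (origin_of_good hd _ h)
    · push Not at h
      obtain ⟨k, hk⟩ := h
      obtain ⟨A, hA, hA2⟩ := hT3 k _ hk
      refine Or.inr (Set.mem_iUnion.2 ⟨k, ?_⟩)
      simp only [B, Set.mem_iUnion, exists_prop]
      refine ⟨A, hA, ?_⟩
      intro v hv
      obtain ⟨x, hx, rfl⟩ := Finset.mem_image.1 hv
      have h5 := hA2 x hx
      have h6 : ¬ (ω (pt x) = true) := h5
      simpa using h6
  have hsum : μ (⋃ k, B k) ≤ ENNReal.ofReal (1/3) := by
    have hs : HasSum (fun k : ℕ => (1/4 : ℝ) ^ (k+1)) (1/3) := by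
      have := (hasSum_geometric_of_lt_one (r := (1/4:ℝ)) (by norm_num) (by norm_num)).mul_left (1/4)
      have e : (fun k : ℕ => (1/4 : ℝ) ^ (k+1)) = fun i => 1/4 * (1/4) ^ i := by
        funext k; rw [pow_succ]; ring
      have e2 : (1/4 : ℝ) * (1 - 1/4)⁻¹ = 1/3 := by norm_num
      rw [e2] at this
      rw [e]; exact this
    calc μ (⋃ k, B k) ≤ ∑' k, μ (B k) := measure_iUnion_le _
      _ ≤ ∑' k, ENNReal.ofReal ((1/4 : ℝ) ^ (k+1)) := ENNReal.tsum_le_tsum hB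
      _ = ENNReal.ofReal (∑' k, (1/4 : ℝ) ^ (k+1)) :=
          (ENNReal.ofReal_tsum_of_nonneg (fun k => by positivity) hs.summable).symm
      _ = _ := by rw [hs.tsum_eq]
  rw [pos_iff_ne_zero]
  intro h0
  have h1 : (1 : ENNReal) ≤ ENNReal.ofReal (1/3) := by
    calc (1 : ENNReal) = μ Set.univ := measure_univ.symm
      _ ≤ _ := measure_mono hcov
      _ ≤ theta0 μ + μ (⋃ k, B k) := measure_union_le _ _
      _ ≤ _ := by rw [h0, zero_add]; exact hsum
  rw [ENNReal.one_le_ofReal] at h1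
  norm_num at h1


theorem final_aux (d : ℕ) (hd : d = 2 ∨ d = 3) (r : ℤ) (hr : 1 ≤ r)
    (E0 : Set (Fin d → ℤ) → Set (Fin d → ℤ))
    (hloc : ∀ ω ω' : Set (Fin d → ℤ), ω ∩ Binf d r = ω' ∩ Binf d r → E0 ω = E0 ω')
    (hrange : ∀ ω : Set (Fin d → ℤ), E0 ω ⊆ Binf d r)
    (hess : ∃ ω : Set (Fin d → ℤ),
      ¬ HasDoublyInfinitePath ω ∧ HasDoublyInfinitePath (ω ∪ E0 ω))
    (μ : ℝ → Measure ((Fin d → ℤ) → Bool))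
    (hμ : ∀ p ∈ Set.Icc (0 : ℝ) 1, IsBernoulliProduct d p (μ p))
    (s : ℝ) (hs0 : 0 < s) (hs1 : s < 1) :
    ∃ π : ℝ, π < pc μ ∧
      ∀ p : ℝ, π < p → p < pc μ → 0 < theta E0 (μ p) (μ s) := by
  obtain ⟨k, hk⟩ := theta_pos_of hd hr hloc hrange hess
  have hbdd : BddBelow {p : ℝ | p ∈ Set.Icc (0 : ℝ) 1 ∧ 0 < theta0 (μ p)} :=
    ⟨0, fun p hp => hp.1.1⟩
  have hmem : (323/324 : ℝ) ∈ {p : ℝ | p ∈ Set.Icc (0 : ℝ) 1 ∧ 0 < theta0 (μ p)} := by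
    have h : (323/324 : ℝ) ∈ Set.Icc (0:ℝ) 1 := ⟨by norm_num, by norm_num⟩
    exact ⟨h, theta0_pos (by omega) (hμ _ h)⟩
  have hne : {p : ℝ | p ∈ Set.Icc (0 : ℝ) 1 ∧ 0 < theta0 (μ p)}.Nonempty := ⟨_, hmem⟩
  have hup : pc μ ≤ 323/324 := csInf_le hbdd hmem
  have hlow : 1/8 ≤ pc μ := by
    refine le_csInf hne ?_
    rintro p ⟨hp, hpos⟩
    by_contra hlt
    push Not at hlt
    rw [theta0_zero hd hp.1 hlt (hμ p hp)] at hpos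
    exact lt_irrefl _ hpos
  have h1s : 0 < 1 - s := by linarith
  set c : ℝ := 1000 + 2 / s + 1 / (1 - s) with hc
  have i1 : 0 < 2 / s := by positivity
  have i2 : 0 < 1 / (1 - s) := by positivity
  have hc1000 : 1000 ≤ c := by linarith
  set D : ℝ := k * (2 * c) ^ (2 * k) with hD
  have hDnn : 0 ≤ D := by positivity
  set ε : ℝ := min (1/1000) (s / (4 * (D + 1))) with hε
  have hεpos : 0 < ε := by
    refine lt_min (by norm_num) (by positivity)
  have hε1 : ε ≤ 1/1000 := min_le_left _ _
  have hε2 : ε * (4 * (D + 1)) ≤ s := by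
    have := min_le_right (1/1000 : ℝ) (s / (4 * (D + 1)))
    rwa [← hε, le_div_iff₀ (by positivity)] at this
  refine ⟨pc μ - ε, by linarith, ?_⟩
  intro p hp1 hp2
  obtain ⟨p', hp', hlt⟩ := exists_lt_of_csInf_lt hne (show pc μ < pc μ + ε by linarith)
  have hge : pc μ ≤ p' := csInf_le hbdd hp'
  refine hk c p p' s (by linarith) (by linarith) ?_ ?_ ?_ ?_ ?_ ⟨by linarith, by linarith⟩ hp'.1
    ⟨hs0.le, hs1.le⟩ μ hμ hp'.2
  · nlinarith
  · nlinarith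
  · have : (2 / s) * (s / 2) = 1 := by field_simp
    nlinarith [mul_le_mul_of_nonneg_right (show 2 / s ≤ c by linarith) (show 0 ≤ s/2 by linarith)]
  · have : (1 / (1 - s)) * (1 - s) = 1 := by field_simp
    nlinarith [mul_le_mul_of_nonneg_right (show 1 / (1 - s) ≤ c by linarith) h1s.le]
  · have h2 : p' - p ≤ 2 * ε := by linarith
    have h3 := mul_le_mul_of_nonneg_right h2 hDnn
    nlinarith


theorem statement14 (d : ℕ) (hd : d = 2 ∨ d = 3) (r : ℤ) (hr : 1 ≤ r)
    (E0 : Set (Fin d → ℤ) → Set (Fin d → ℤ))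
    (hloc : ∀ ω ω' : Set (Fin d → ℤ), ω ∩ Binf d r = ω' ∩ Binf d r → E0 ω = E0 ω')
    (hrange : ∀ ω : Set (Fin d → ℤ), E0 ω ⊆ Binf d r)
    (hess : ∃ ω : Set (Fin d → ℤ),
      ¬ HasDoublyInfinitePath ω ∧ HasDoublyInfinitePath (ω ∪ E0 ω))
    (μ : ℝ → Measure ((Fin d → ℤ) → Bool))
    (hμ : ∀ p ∈ Set.Icc (0 : ℝ) 1, IsBernoulliProduct d p (μ p))
    (s : ℝ) (hs0 : 0 < s) (hs1 : s < 1) :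
    ∃ π : ℝ, π < pc μ ∧
      ∀ p : ℝ, π < p → p < pc μ → 0 < theta E0 (μ p) (μ s) := by
  exact final_aux d hd r hr E0 hloc hrange hess μ hμ s hs0 hs1
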